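/- In the heteroscedastic normal mixture model, let β ∈ (1/2,1) and σ_0 > 0 with r = ρ(β,σ_0) > 0, and reparametrize ε_n = n^{−β}(log n)^{E(β,σ_0)}. Then the higher criticism test has no asymptotic power: for every x ∈ ℝ, Q_(n)(a_n·HC_n − b_n ≤ x) → exp(−2·exp(−x)), i.e. a_n·HC_n − b_n has the same Gumbel-squared limit under the alternative Q_(n) as under the null. -/

import Mathlib

open MeasureTheory Filter Topology ProbabilityTheory

noncomputable section

/-- Mixture `Q = (1-e)·P + e·μ`. -/
def Qmix {α : Type*} [MeasurableSpace α] (P μ : Measure α) (e : ℝ) : Measure α :=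
  (ENNReal.ofReal (1 - e)) • P + (ENNReal.ofReal e) • μ

/-- Standard normal distribution function `Φ`. -/
def Phi (x : ℝ) : ℝ := ((gaussianReal 0 1) (Set.Iic x)).toReal

open Classical in
/-- Detection boundary `ρ(β,σ₀)` of the heteroscedastic normal mixture model. -/
def rhoNormal (β σ0 : ℝ) : ℝ :=
  if σ0 < Real.sqrt 2 then
    (if β ≤ 1 - σ0 ^ 2 / 4 then (2 - σ0 ^ 2) * (β - 1 / 2)
      else (1 - σ0 * Real.sqrt (1 - β)) ^ 2)
  else
    (if β ≤ 1 - 1 / σ0 ^ 2 then 0 else (1 - σ0 * Real.sqrt (1 - β)) ^ 2)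

open Classical in
/-- Logarithmic exponent `E(β,σ₀)`. -/
def Eexp (β σ0 : ℝ) : ℝ :=
  if σ0 < Real.sqrt 2 ∧ β ≤ 1 - σ0 ^ 2 / 4 then 0
  else 1 / 2 - Real.sqrt (1 - β) / (2 * σ0)

/-- Signal probability `ε_n = n^{−β}(log n)^{E(β,σ₀)}`. -/
def epsNormal (β σ0 : ℝ) (n : ℕ) : ℝ :=
  (n : ℝ) ^ (-β) * Real.log n ^ Eexp β σ0

/-- Signal strength `ϑ_n = √(2 r log n)` with `r = ρ(β,σ₀)`. -/
def thetaNormal (β σ0 : ℝ) (n : ℕ) : ℝ :=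
  Real.sqrt (2 * rhoNormal β σ0 * Real.log n)

/-- The alternative product measure of the heteroscedastic normal mixture model. -/
def QprodNormal (β σ0 : ℝ) (n : ℕ) : Measure (Fin n → ℝ) :=
  Measure.pi (fun _ => Qmix (gaussianReal 0 1)
    (gaussianReal (thetaNormal β σ0 n) ⟨σ0 ^ 2, sq_nonneg σ0⟩) (epsNormal β σ0 n))

/-- Empirical distribution function of the p-values `1 − Φ(y_i)` at `t`. -/
def empCdfNormal (n : ℕ) (y : Fin n → ℝ) (t : ℝ) : ℝ :=
  (∑ i : Fin n, if 1 - Phi (y i) ≤ t then (1 : ℝ) else 0) / n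

/-- Higher criticism statistic applied to the p-values `1 − Φ(Y_i)`. -/
def HCnormal (n : ℕ) (y : Fin n → ℝ) : ℝ :=
  ⨆ t : Set.Ioo (0 : ℝ) 1,
    |Real.sqrt n * (empCdfNormal n y t.1 - t.1) / Real.sqrt (t.1 * (1 - t.1))|

/-- `a_n = √(2 log log n)`. -/
def aHC (n : ℕ) : ℝ := Real.sqrt (2 * Real.log (Real.log n))

/-- `b_n = 2 log log n + (1/2) log log log n − (1/2) log π`. -/
def bHC (n : ℕ) : ℝ :=
  2 * Real.log (Real.log n) + (1 / 2) * Real.log (Real.log (Real.log n)) -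
    (1 / 2) * Real.log Real.pi

open MeasureTheory Filter Topology ProbabilityTheory

noncomputable section

/-! ### Taylor estimates -/

lemma tay1 {h h1 : ℝ → ℝ} {R M : ℝ} (hd : ∀ z, HasDerivAt h (h1 z) z)
    (hM : ∀ z, |z| ≤ R → |h1 z| ≤ M) {a b : ℝ} (ha : |a| ≤ R) (hb : |b| ≤ R) :
    |h b - h a| ≤ M * |b - a| := by
  have := (convex_Icc (-R) R).norm_image_sub_le_of_norm_hasDerivWithin_le (f := h) (f' := h1)
    (C := M) (fun x _ => (hd x).hasDerivWithinAt)
    (fun x hx => by simpa using hM x (abs_le.2 hx)) (abs_le.1 ha) (abs_le.1 hb)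
  simpa using this

lemma abs_le_of_uIcc {a b z R : ℝ} (ha : |a| ≤ R) (hb : |b| ≤ R) (hz : z ∈ Set.uIcc a b) :
    |z| ≤ R ∧ |z - a| ≤ |b - a| := by
  rw [abs_le] at *
  refine ⟨?_, ?_⟩
  · rw [Set.mem_uIcc] at hz
    rcases hz with h | h <;> constructor <;> linarith
  · exact Set.abs_sub_left_of_mem_uIcc hz

lemma tay2 {h h1 h2 : ℝ → ℝ} {R M : ℝ} (hd : ∀ z, HasDerivAt h (h1 z) z)
    (hd1 : ∀ z, HasDerivAt h1 (h2 z) z)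
    (hM : ∀ z, |z| ≤ R → |h2 z| ≤ M) {a b : ℝ} (ha : |a| ≤ R) (hb : |b| ≤ R) :
    |h b - h a - h1 a * (b - a)| ≤ M * |b - a| ^ 2 := by
  have hM0 : 0 ≤ M := (abs_nonneg _).trans (hM a ha)
  have := (convex_uIcc a b).norm_image_sub_le_of_norm_hasDerivWithin_le
    (f := fun y => h y - h1 a * (y - a)) (f' := fun y => h1 y - h1 a * 1)
    (C := M * |b - a|) (fun x _ => ((hd x).sub
      (((hasDerivAt_id x).sub_const a).const_mul (h1 a))).hasDerivWithinAt)
    (fun x hx => by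
      obtain ⟨h3, h4⟩ := abs_le_of_uIcc ha hb hx
      have := tay1 hd1 hM ha h3
      simp only [mul_one, Real.norm_eq_abs]
      exact this.trans (by gcongr)) Set.left_mem_uIcc Set.right_mem_uIcc
  simp only [Real.norm_eq_abs, sub_self, mul_zero, sub_zero] at this
  calc _ = |h b - h1 a * (b - a) - h a| := by ring_nf
    _ ≤ _ := this
    _ = _ := by ring

lemma tay3 {h h1 h2 h3 : ℝ → ℝ} {R M : ℝ} (hd : ∀ z, HasDerivAt h (h1 z) z)
    (hd1 : ∀ z, HasDerivAt h1 (h2 z) z) (hd2 : ∀ z, HasDerivAt h2 (h3 z) z)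
    (hM : ∀ z, |z| ≤ R → |h3 z| ≤ M) {a b : ℝ} (ha : |a| ≤ R) (hb : |b| ≤ R) :
    |h b - h a - h1 a * (b - a) - h2 a * (b - a) ^ 2 / 2| ≤ M * |b - a| ^ 3 := by
  have hM0 : 0 ≤ M := (abs_nonneg _).trans (hM a ha)
  have := (convex_uIcc a b).norm_image_sub_le_of_norm_hasDerivWithin_le
    (f := fun y => h y - h1 a * (y - a) - h2 a / 2 * (y - a) ^ 2)
    (f' := fun y => h1 y - h1 a * 1 - h2 a / 2 * ((2 : ℕ) * (y - a) ^ (2 - 1) * 1))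
    (C := M * |b - a| ^ 2) (fun x _ => (((hd x).sub
      (((hasDerivAt_id x).sub_const a).const_mul (h1 a))).sub
      ((((hasDerivAt_id x).sub_const a).pow 2).const_mul (h2 a / 2))).hasDerivWithinAt)
    (fun x hx => by
      obtain ⟨h3, h4⟩ := abs_le_of_uIcc ha hb hx
      have := tay2 hd1 hd2 hM ha h3
      rw [Real.norm_eq_abs]
      calc _ = |h1 x - h1 a - h2 a * (x - a)| := by
            congr 1; push_cast; ring
        _ ≤ _ := this
        _ ≤ _ := by gcongr) Set.left_mem_uIcc Set.right_mem_uIcc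
  simp only [Real.norm_eq_abs, sub_self, mul_zero, sub_zero, ne_eq, OfNat.ofNat_ne_zero,
    not_false_eq_true, zero_pow] at this
  calc _ = |h b - h1 a * (b - a) - h2 a / 2 * (b - a) ^ 2 - h a| := by ring_nf
    _ ≤ _ := this
    _ = _ := by ring

/-! ### The exit-time function of the Ornstein-Uhlenbeck process -/

def gI (z : ℝ) : ℝ := ∫ y in (0 : ℝ)..z, Real.exp (-(1 / 2) * y ^ 2)

def gw (z : ℝ) : ℝ := Real.exp (z ^ 2 / 2) * gI z

def gg (z : ℝ) : ℝ := ∫ y in (0 : ℝ)..z, gw y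

lemma gI_deriv (z : ℝ) : HasDerivAt gI (Real.exp (-(1 / 2) * z ^ 2)) z := by
  have hc : Continuous (fun y : ℝ => Real.exp (-(1 / 2) * y ^ 2)) := by fun_prop
  exact hc.integral_hasStrictDerivAt 0 z |>.hasDerivAt

lemma gI_cont : Continuous gI := by
  rw [continuous_iff_continuousAt]; exact fun z => (gI_deriv z).continuousAt

lemma hasDerivAt_exp_half (z : ℝ) :
    HasDerivAt (fun z : ℝ => Real.exp (z ^ 2 / 2)) (Real.exp (z ^ 2 / 2) * z) z := by
  have h1 : HasDerivAt (fun z : ℝ => z ^ 2 / 2) z z :=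
    ((hasDerivAt_pow 2 z).div_const 2).congr_deriv (by simp)
  exact h1.exp

lemma gw_deriv (z : ℝ) : HasDerivAt gw (1 + z * gw z) z := by
  have h1 := hasDerivAt_exp_half z
  refine (h1.mul (gI_deriv z)).congr_deriv ?_
  have e : Real.exp (z ^ 2 / 2) * Real.exp (-(1 / 2) * z ^ 2) = 1 := by
    rw [← Real.exp_add]; ring_nf; simp
  rw [e]; unfold gw; ring

lemma gw_cont : Continuous gw := by
  rw [continuous_iff_continuousAt]; exact fun z => (gw_deriv z).continuousAt

lemma gg_deriv (z : ℝ) : HasDerivAt gg (gw z) z :=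
  gw_cont.integral_hasStrictDerivAt 0 z |>.hasDerivAt

lemma gI_neg (z : ℝ) : gI (-z) = - gI z := by
  unfold gI
  have := intervalIntegral.integral_comp_neg (a := 0) (b := z)
    (fun y : ℝ => Real.exp (-(1 / 2) * y ^ 2))
  simp only [neg_zero, neg_sq] at this
  rw [this, intervalIntegral.integral_symm]

lemma gw_neg (z : ℝ) : gw (-z) = - gw z := by
  unfold gw; rw [gI_neg]; simp

lemma gg_neg (z : ℝ) : gg (-z) = gg z := by
  unfold gg
  have := intervalIntegral.integral_comp_neg (a := 0) (b := z) gw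
  simp only [neg_zero, gw_neg] at this
  rw [intervalIntegral.integral_symm, ← this]
  simp

lemma gg_abs (z : ℝ) : gg |z| = gg z := by
  rcases abs_choice z with h | h <;> rw [h]
  exact gg_neg z

lemma gI_nonneg {z : ℝ} (hz : 0 ≤ z) : 0 ≤ gI z :=
  intervalIntegral.integral_nonneg hz (fun y _ => (Real.exp_pos _).le)

lemma gI_mono : Monotone gI := by
  apply monotone_of_deriv_nonneg (fun z => (gI_deriv z).differentiableAt)
  intro z; rw [(gI_deriv z).deriv]; exact (Real.exp_pos _).le

lemma gI_tendsto : Tendsto gI atTop (𝓝 (Real.sqrt (Real.pi / 2))) := by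
  have h1 := intervalIntegral_tendsto_integral_Ioi (μ := volume) (0 : ℝ)
    (f := fun y : ℝ => Real.exp (-(1 / 2) * y ^ 2))
    ((integrable_exp_neg_mul_sq (by norm_num : (0 : ℝ) < 1 / 2)).integrableOn) tendsto_id
  rw [integral_gaussian_Ioi] at h1
  refine h1.congr' (Eventually.of_forall fun _ => rfl) |>.trans (le_of_eq ?_)
  congr 1
  rw [show Real.pi / (1 / 2) = 2 ^ 2 * (Real.pi / 2) by ring, Real.sqrt_mul (by norm_num),
    Real.sqrt_sq (by norm_num)]
  ring

lemma gI_le (z : ℝ) : gI z ≤ Real.sqrt (Real.pi / 2) :=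
  gI_mono.ge_of_tendsto gI_tendsto z

lemma sqrt_pi_two_le : Real.sqrt (Real.pi / 2) ≤ 2 := by
  rw [Real.sqrt_le_left (by norm_num)]
  linarith [Real.pi_le_four]

lemma gw_nonneg {z : ℝ} (hz : 0 ≤ z) : 0 ≤ gw z :=
  mul_nonneg (Real.exp_pos _).le (gI_nonneg hz)

lemma gw_abs_le (z : ℝ) : |gw z| ≤ 2 * Real.exp (z ^ 2 / 2) := by
  wlog hz : 0 ≤ z with H
  · have := H (-z) (by linarith)
    rwa [gw_neg, abs_neg, neg_sq] at this
  · rw [abs_of_nonneg (gw_nonneg hz)]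
    unfold gw
    have := (gI_le z).trans sqrt_pi_two_le
    nlinarith [Real.exp_pos (z ^ 2 / 2)]

lemma gg_mono {a b : ℝ} (ha : 0 ≤ a) (hab : a ≤ b) : gg a ≤ gg b := by
  have : MonotoneOn gg (Set.Ici 0) := by
    apply monotoneOn_of_deriv_nonneg (convex_Ici 0)
    · exact fun z _ => (gg_deriv z).continuousAt.continuousWithinAt
    · exact fun z _ => (gg_deriv z).differentiableAt.differentiableWithinAt
    · intro z hz
      rw [(gg_deriv z).deriv]
      rw [interior_Ici] at hz
      exact gw_nonneg (le_of_lt hz)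
  exact this ha (ha.trans hab) hab

lemma gg_zero : gg 0 = 0 := by simp [gg]

lemma gg_nonneg (z : ℝ) : 0 ≤ gg z := by
  rw [← gg_abs, ← gg_zero]; exact gg_mono le_rfl (abs_nonneg z)

lemma gg_le_of_abs_le {z u : ℝ} (h : |z| ≤ u) : gg z ≤ gg u := by
  rw [← gg_abs]; exact gg_mono (abs_nonneg z) h

lemma gg_le_of_le_abs {z u : ℝ} (hu : 0 ≤ u) (h : u ≤ |z|) : gg u ≤ gg z := by
  rw [← gg_abs z]; exact gg_mono hu h

/-- upper bound for `gg` -/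
lemma gg_upper {a u : ℝ} (ha : 0 < a) (hu : a ≤ u) :
    gg u ≤ Real.sqrt (Real.pi / 2) * (a * Real.exp (a ^ 2 / 2) + Real.exp (u ^ 2 / 2) / a) := by
  set c := Real.sqrt (Real.pi / 2)
  have hc : 0 ≤ c := Real.sqrt_nonneg _
  have h1 : gg a ≤ c * (a * Real.exp (a ^ 2 / 2)) := by
    have := tay1 (h := gg) (h1 := gw) (R := a) (M := c * Real.exp (a ^ 2 / 2)) gg_deriv
      (by
        intro z hz
        have : |gw z| = gw |z| := by
          rcases abs_cases z with ⟨h, h'⟩ | ⟨h, h'⟩ <;> rw [h]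
          · exact abs_of_nonneg (gw_nonneg h')
          · rw [gw_neg, abs_of_nonpos]
            have := gw_nonneg (z := -z) (by linarith)
            rw [gw_neg] at this; linarith
        rw [this, gw, mul_comm c]
        have h2 := gI_le |z|
        have h3 := gI_nonneg (abs_nonneg z)
        gcongr) (a := 0) (b := a) (by simpa using ha.le) (by rw [abs_of_pos ha])
    rw [gg_zero, sub_zero, sub_zero, abs_of_nonneg (gg_nonneg a), abs_of_pos ha] at this
    linarith
  have h2 : MonotoneOn (fun z => c * (Real.exp (z ^ 2 / 2) / a) - gg z) (Set.Ici a) := by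
    apply monotoneOn_of_deriv_nonneg (convex_Ici a)
    · exact fun z _ => ((((hasDerivAt_exp_half z).div_const a).const_mul c).sub
        (gg_deriv z)).continuousAt.continuousWithinAt
    · exact fun z _ => ((((hasDerivAt_exp_half z).div_const a).const_mul c).sub
        (gg_deriv z)).differentiableAt.differentiableWithinAt
    · intro z hz
      rw [interior_Ici] at hz
      have hz : a < z := hz
      have hdv : deriv (fun z => c * (Real.exp (z ^ 2 / 2) / a) - gg z) z = _ :=
        ((((hasDerivAt_exp_half z).div_const a).const_mul c).sub (gg_deriv z)).deriv
      rw [hdv]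
      have h3 := gI_le z
      have h4 := Real.exp_pos (z ^ 2 / 2)
      have h5 : 1 ≤ z / a := by rw [le_div_iff₀ ha]; linarith
      have : gw z ≤ c * (Real.exp (z ^ 2 / 2)) := by unfold gw; nlinarith
      have h6 : c * Real.exp (z ^ 2 / 2) * 1 ≤ c * Real.exp (z ^ 2 / 2) * (z / a) := by gcongr
      have h7 : c * (Real.exp (z ^ 2 / 2) * z / a) = c * Real.exp (z ^ 2 / 2) * (z / a) := by ring
      linarith
  have h3 := h2 (Set.mem_Ici.2 le_rfl) (Set.mem_Ici.2 hu) hu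
  simp only at h3
  have h4 : 0 ≤ c * (Real.exp (a ^ 2 / 2) / a) := by positivity
  linarith

lemma gg_lower {a u : ℝ} (ha : 0 < a) (hu : a ≤ u) :
    gI a * (Real.exp (u ^ 2 / 2) - Real.exp (a ^ 2 / 2)) / u ≤ gg u := by
  have hu0 : 0 < u := ha.trans_le hu
  have hI := gI_nonneg ha.le
  have h2 : MonotoneOn (fun z => gg z - gI a * (Real.exp (z ^ 2 / 2) / u)) (Set.Icc a u) := by
    apply monotoneOn_of_deriv_nonneg (convex_Icc a u)
    · exact fun z _ => ((gg_deriv z).sub (((hasDerivAt_exp_half z).div_const u).const_mul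
        (gI a))).continuousAt.continuousWithinAt
    · exact fun z _ => ((gg_deriv z).sub (((hasDerivAt_exp_half z).div_const u).const_mul
        (gI a))).differentiableAt.differentiableWithinAt
    · intro z hz
      rw [interior_Icc] at hz
      have hdv : deriv (fun z => gg z - gI a * (Real.exp (z ^ 2 / 2) / u)) z = _ :=
        ((gg_deriv z).sub (((hasDerivAt_exp_half z).div_const u).const_mul (gI a))).deriv
      rw [hdv]
      have h3 := gI_mono hz.1.le
      have h4 := Real.exp_pos (z ^ 2 / 2)
      have h5 : z / u ≤ 1 := by rw [div_le_one hu0]; exact hz.2.le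
      have h6 : gI a * Real.exp (z ^ 2 / 2) * (z / u) ≤ gI a * Real.exp (z ^ 2 / 2) * 1 := by
        gcongr
      have h7 : gI a * (Real.exp (z ^ 2 / 2) * z / u) = gI a * Real.exp (z ^ 2 / 2) * (z / u) := by
        ring
      have : gI a * (Real.exp (z ^ 2 / 2)) ≤ gw z := by unfold gw; nlinarith
      linarith
  have h3 := h2 (Set.left_mem_Icc.2 hu) (Set.right_mem_Icc.2 hu) hu
  simp only at h3
  have := gg_nonneg a
  have e : gI a * (Real.exp (u ^ 2 / 2) - Real.exp (a ^ 2 / 2)) / u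
    = gI a * (Real.exp (u ^ 2 / 2) / u) - gI a * (Real.exp (a ^ 2 / 2) / u) := by ring
  linarith

lemma tendsto_exp_sq_decay : Tendsto (fun u : ℝ => u ^ 2 * Real.exp (-(u ^ 2 / 8))) atTop (𝓝 0) := by
  have h := (Real.tendsto_pow_mul_exp_neg_atTop_nhds_zero 1).comp
    (tendsto_pow_atTop (two_ne_zero) |>.atTop_div_const (by norm_num : (0 : ℝ) < 8) :
      Tendsto (fun u : ℝ => u ^ 2 / 8) atTop atTop)
  have := h.const_mul 8
  simp only [mul_zero] at this
  refine this.congr (fun u => ?_)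
  simp only [Function.comp, pow_one]; ring

lemma gg_asymp : Tendsto (fun u => u * Real.exp (-(u ^ 2 / 2)) * gg u) atTop
    (𝓝 (Real.sqrt (Real.pi / 2))) := by
  set c := Real.sqrt (Real.pi / 2) with hc
  have hc0 : 0 ≤ c := Real.sqrt_nonneg _
  have hE : Tendsto (fun u : ℝ => Real.exp (-u)) atTop (𝓝 0) := Real.tendsto_exp_neg_atTop_nhds_zero
  have hE' : Tendsto (fun u : ℝ => (1 + 1) * (u ^ 1 * Real.exp (-u)) + 0) atTop
      (𝓝 ((1 + 1) * 0 + 0)) :=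
    ((Real.tendsto_pow_mul_exp_neg_atTop_nhds_zero 1).const_mul _).add_const 0
  have hinv : Tendsto (fun u : ℝ => u⁻¹) atTop (𝓝 0) := tendsto_inv_atTop_zero
  -- lower with a = u - something ; choose a = √u-like: a = u / 2 
  have hhalf : Tendsto (fun u : ℝ => u / 2) atTop atTop :=
    tendsto_id.atTop_div_const (by norm_num)
  have hsq : Tendsto (fun u : ℝ => u ^ 2 * Real.exp (-(u ^ 2 / 8))) atTop (𝓝 0) :=
    tendsto_exp_sq_decay
  have hlow : Tendsto (fun u : ℝ => gI (u / 2) * (1 - u ^ 2 * Real.exp (-(u ^ 2 / 8)))) atTop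
      (𝓝 (c * (1 - 0))) :=
    (gI_tendsto.comp hhalf).mul (tendsto_const_nhds.sub hsq)
  have hq : Tendsto (fun u : ℝ => u / (u - 1)) atTop (𝓝 1) := by
    have : Tendsto (fun u : ℝ => 1 / (1 - u⁻¹)) atTop (𝓝 (1 / (1 - 0))) :=
      tendsto_const_nhds.div (tendsto_const_nhds.sub hinv) (by norm_num)
    rw [sub_zero, div_one] at this
    refine this.congr' ?_
    filter_upwards [eventually_gt_atTop 1] with u hu
    have h1 : u - 1 ≠ 0 := by linarith
    field_simp
  have hupp : Tendsto (fun u : ℝ => c * (Real.exp 1 * (u ^ 2 * Real.exp (-u)) + u / (u - 1))) atTop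
      (𝓝 (c * (Real.exp 1 * 0 + 1))) :=
    (((Real.tendsto_pow_mul_exp_neg_atTop_nhds_zero 2).const_mul _).add hq).const_mul c
  rw [sub_zero, mul_one] at hlow
  rw [mul_zero, zero_add, mul_one] at hupp
  refine tendsto_of_tendsto_of_tendsto_of_le_of_le' hlow hupp ?_ ?_
  · filter_upwards [eventually_gt_atTop 2] with u hu
    have h1 := gg_lower (a := u / 2) (u := u) (by linarith) (by linarith)
    have hI := gI_nonneg (z := u / 2) (by linarith)
    have h2 : u * Real.exp (-(u ^ 2 / 2)) * (gI (u / 2) * (Real.exp (u ^ 2 / 2) -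
        Real.exp ((u / 2) ^ 2 / 2)) / u) = gI (u / 2) * (1 - Real.exp (-(3 * u ^ 2 / 8))) := by
      have e1 : Real.exp (-(u ^ 2 / 2)) * Real.exp (u ^ 2 / 2) = 1 := by
        rw [← Real.exp_add]; simp
      have e2 : Real.exp (-(u ^ 2 / 2)) * Real.exp ((u / 2) ^ 2 / 2) =
          Real.exp (-(3 * u ^ 2 / 8)) := by
        rw [← Real.exp_add]; ring_nf
      have hu0 : u ≠ 0 := by linarith
      rw [← e2]
      have e3 : u * u⁻¹ = 1 := mul_inv_cancel₀ hu0
      rw [div_eq_mul_inv (gI (u / 2) * (Real.exp (u ^ 2 / 2) - Real.exp ((u / 2) ^ 2 / 2)))]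
      linear_combination gI (u / 2) * e1 + Real.exp (-(u ^ 2 / 2)) * gI (u / 2) *
        (Real.exp (u ^ 2 / 2) - Real.exp ((u / 2) ^ 2 / 2)) * e3
    have h3 : 0 ≤ u * Real.exp (-(u ^ 2 / 2)) := by positivity
    have h4 := mul_le_mul_of_nonneg_left h1 h3
    rw [h2] at h4
    refine le_trans ?_ h4
    gcongr
    have : Real.exp (-(3 * u ^ 2 / 8)) ≤ Real.exp (-(u ^ 2 / 8)) := by
      apply Real.exp_le_exp.2; nlinarith
    have h5 := Real.exp_pos (-(u ^ 2 / 8))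
    have h6 : 1 ≤ u ^ 2 := by nlinarith
    have h7 : 1 * Real.exp (-(u ^ 2 / 8)) ≤ u ^ 2 * Real.exp (-(u ^ 2 / 8)) := by gcongr
    linarith
  · filter_upwards [eventually_gt_atTop 2] with u hu
    have h1 := gg_upper (a := u - 1) (u := u) (by linarith) (by linarith)
    have h3 : 0 ≤ u * Real.exp (-(u ^ 2 / 2)) := by positivity
    have h4 := mul_le_mul_of_nonneg_left h1 h3
    refine h4.trans ?_
    have e1 : Real.exp (-(u ^ 2 / 2)) * Real.exp (u ^ 2 / 2) = 1 := by
      rw [← Real.exp_add]; simp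
    have e2 : Real.exp (-(u ^ 2 / 2)) * Real.exp ((u - 1) ^ 2 / 2) =
        Real.exp (1 / 2) * Real.exp (- u) := by
      rw [← Real.exp_add, ← Real.exp_add]; ring_nf
    have e3 : u * Real.exp (-(u ^ 2 / 2)) * (c * ((u - 1) * Real.exp ((u - 1) ^ 2 / 2) +
        Real.exp (u ^ 2 / 2) / (u - 1))) = c * (Real.exp (1 / 2) * (u * (u - 1)) * Real.exp (- u)
        + u / (u - 1)) := by
      linear_combination c * u * (u - 1) * e2 + c * u / (u - 1) * e1
    rw [e3, ← mul_assoc (Real.exp 1)]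
    have : Real.exp (1 / 2) ≤ Real.exp 1 := Real.exp_le_exp.2 (by norm_num)
    have h6 : u * (u - 1) ≤ u ^ 2 := by nlinarith
    have h7 : 0 ≤ u * (u - 1) := by nlinarith
    gcongr

/-- derivative bounds -/
lemma gg_bounds : ∃ K > 0, ∃ u0 ≥ 1, ∀ u ≥ u0, 0 < gg u ∧ ∀ z, |z| ≤ u + 1 / u →
    |gw z| ≤ K * u ^ 3 * gg u ∧ |1 + z * gw z| ≤ K * u ^ 3 * gg u ∧
    |gw z + z * (1 + z * gw z)| ≤ K * u ^ 3 * gg u := by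
  have hc : 0 < Real.sqrt (Real.pi / 2) := Real.sqrt_pos.2 (by positivity)
  set c := Real.sqrt (Real.pi / 2)
  have h1 := gg_asymp.eventually (lt_mem_nhds (half_lt_self hc))
  obtain ⟨u1, hu1⟩ := eventually_atTop.1 h1
  have hE : 0 < Real.exp 2 := Real.exp_pos _
  refine ⟨50 * Real.exp 2 / c, by positivity, max u1 1, le_max_right _ _, ?_⟩
  intro u hu
  have hu1' : 1 ≤ u := (le_max_right _ _).trans hu
  have h2 := hu1 u ((le_max_left _ _).trans hu)
  have hX : Real.exp (u ^ 2 / 2) ≤ 2 / c * u * gg u := by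
    have e1 : Real.exp (-(u ^ 2 / 2)) * Real.exp (u ^ 2 / 2) = 1 := by
      rw [← Real.exp_add]; simp
    have h3 := mul_lt_mul_of_pos_right h2 (Real.exp_pos (u ^ 2 / 2))
    have h4 : u * Real.exp (-(u ^ 2 / 2)) * gg u * Real.exp (u ^ 2 / 2) = u * gg u := by
      linear_combination u * gg u * e1
    rw [h4] at h3
    rw [show 2 / c * u * gg u = (u * gg u) / (c / 2) by field_simp]
    rw [le_div_iff₀ (by positivity)]
    linarith
  have hg : 0 < gg u := by
    have := (Real.exp_pos (u ^ 2 / 2)).trans_le hX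
    exact pos_of_mul_pos_right this (by positivity)
  refine ⟨hg, ?_⟩
  intro z hz
  have hz2 : |z| ≤ 2 * u := by
    have : 1 / u ≤ 1 := by rw [div_le_one (by linarith)]; exact hu1'
    linarith
  have hzsq : z ^ 2 / 2 ≤ u ^ 2 / 2 + 2 := by
    have h5 : z ^ 2 ≤ (u + 1 / u) ^ 2 := by
      rw [← sq_abs z]; gcongr
    have h6 : (u + 1 / u) ^ 2 = u ^ 2 + 2 + (1 / u) ^ 2 := by
      have : u ≠ 0 := by linarith
      field_simp; ring
    have : 1 / u ≤ 1 := by rw [div_le_one (by linarith)]; exact hu1'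
    have h7 : (1 / u) ^ 2 ≤ 1 := pow_le_one₀ (by positivity) this
    linarith
  set X := 2 / c * u * gg u with hXdef
  have hw : |gw z| ≤ 2 * Real.exp 2 * X := by
    refine (gw_abs_le z).trans ?_
    have : Real.exp (z ^ 2 / 2) ≤ Real.exp (u ^ 2 / 2) * Real.exp 2 := by
      rw [← Real.exp_add]; exact Real.exp_le_exp.2 hzsq
    nlinarith
  have hX1 : 1 ≤ X := le_trans (by rw [Real.one_le_exp_iff]; positivity) hX
  have hE1 : 1 ≤ Real.exp 2 := by rw [Real.one_le_exp_iff]; norm_num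
  have eK : 50 * Real.exp 2 / c * u ^ 3 * gg u = 25 * Real.exp 2 * u ^ 2 * X := by
    rw [hXdef]; field_simp; ring
  rw [eK]
  set Y := Real.exp 2 * X with hY
  have hY1 : 1 ≤ Y := by nlinarith
  have hu2 : u ≤ u ^ 2 := by nlinarith
  have hu21 : 1 ≤ u ^ 2 := by nlinarith
  have hzw : |1 + z * gw z| ≤ 5 * u * Y := by
    calc |1 + z * gw z| ≤ 1 + |z| * |gw z| := by
          refine (abs_add_le _ _).trans ?_
          rw [abs_mul, abs_one]
      _ ≤ 1 + (2 * u) * (2 * Real.exp 2 * X) := by gcongr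
      _ ≤ 5 * u * Y := by rw [hY]; nlinarith
  refine ⟨?_, ?_, ?_⟩
  · calc _ ≤ 2 * Y := by rw [hY]; linarith
      _ ≤ 25 * u ^ 2 * Y := by gcongr; linarith
      _ = _ := by rw [hY]; ring
  · calc _ ≤ 5 * u * Y := hzw
      _ ≤ 25 * u ^ 2 * Y := by gcongr; linarith
      _ = _ := by rw [hY]; ring
  · calc _ ≤ |gw z| + |z| * |1 + z * gw z| := by
          refine (abs_add_le _ _).trans ?_
          rw [abs_mul]
      _ ≤ 2 * Y + (2 * u) * (5 * u * Y) := by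
          gcongr
          rw [hY]; linarith
      _ ≤ 25 * u ^ 2 * Y := by nlinarith
      _ = _ := by rw [hY]; ring

lemma gg_tendsto : Tendsto gg atTop atTop := by
  have hc : 0 < Real.sqrt (Real.pi / 2) := Real.sqrt_pos.2 (by positivity)
  rw [tendsto_atTop]
  intro B
  -- gg u * (u e^{-u²/2}) → c > 0 and u e^{-u²/2} → 0
  have h0 : Tendsto (fun u : ℝ => u ^ 2 * Real.exp (-(u ^ 2 / 8))) atTop (𝓝 0) :=
    tendsto_exp_sq_decay
  have h1 := gg_asymp.eventually (lt_mem_nhds (half_lt_self hc))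
  have h2 := (h0.mul_const (|B|)).eventually (gt_mem_nhds
    (show 0 * |B| < Real.sqrt (Real.pi / 2) / 2 by rw [zero_mul]; positivity))
  filter_upwards [h1, h2, eventually_ge_atTop 1] with u h1 h2 hu
  by_contra hB
  push Not at hB
  have h3 : u * Real.exp (-(u ^ 2 / 2)) ≤ u ^ 2 * Real.exp (-(u ^ 2 / 8)) := by
    gcongr
    · nlinarith
    · norm_num
  have h4 : u * Real.exp (-(u ^ 2 / 2)) * gg u ≤ u ^ 2 * Real.exp (-(u ^ 2 / 8)) * |B| := by
    have := gg_nonneg u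
    gcongr
    exact hB.le.trans (le_abs_self B)
  linarith

/-- `gg (u/2) / gg u → 0`. -/
lemma gg_half : Tendsto (fun u => gg (u / 2) / gg u) atTop (𝓝 0) := by
  have hc : 0 < Real.sqrt (Real.pi / 2) := Real.sqrt_pos.2 (by positivity)
  set c := Real.sqrt (Real.pi / 2) with hcd
  have h1 := gg_asymp.eventually (lt_mem_nhds (half_lt_self hc))
  have h0 := tendsto_exp_sq_decay.const_mul (2 / c)
  rw [mul_zero] at h0
  refine squeeze_zero' (Eventually.of_forall fun u => div_nonneg (gg_nonneg _) (gg_nonneg _)) ?_ h0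
  filter_upwards [h1, eventually_ge_atTop 1] with u h1 hu
  have h2 : gg (u / 2) ≤ u * Real.exp (u ^ 2 / 8) := by
    have := tay1 (h := gg) (h1 := gw) (R := u / 2) (M := 2 * Real.exp (u ^ 2 / 8)) gg_deriv
      (by
        intro z hz
        refine (gw_abs_le z).trans ?_
        have : z ^ 2 ≤ (u / 2) ^ 2 := by rw [← sq_abs z]; gcongr
        have := Real.exp_le_exp.2 (show z ^ 2 / 2 ≤ u ^ 2 / 8 by nlinarith)
        linarith) (a := 0) (b := u / 2) (by simp; linarith) (by rw [abs_of_pos]; linarith)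
    rw [gg_zero, sub_zero, sub_zero, abs_of_nonneg (gg_nonneg _), abs_of_pos (by linarith)] at this
    linarith
  have hg : 0 < gg u := by
    have : 0 < u * Real.exp (-(u ^ 2 / 2)) * gg u := by
      have : c / 2 > 0 := by positivity
      linarith
    exact pos_of_mul_pos_right this (by positivity)
  rw [div_le_iff₀ hg]
  refine h2.trans ?_
  have e : Real.exp (-(u ^ 2 / 8)) * Real.exp (u ^ 2 / 2) * Real.exp (-(u ^ 2 / 2)) =
    Real.exp (-(u ^ 2 / 8)) := by
    rw [mul_assoc, ← Real.exp_add]; simp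
  have e2 : Real.exp (u ^ 2 / 8) ≤ Real.exp (-(u ^ 2 / 8)) * Real.exp (u ^ 2 / 2) := by
    rw [← Real.exp_add]; apply Real.exp_le_exp.2; nlinarith
  calc u * Real.exp (u ^ 2 / 8) ≤ u * (Real.exp (-(u ^ 2 / 8)) * Real.exp (u ^ 2 / 2)) := by
        gcongr
    _ = 2 / c * u * (Real.exp (-(u ^ 2 / 8)) * Real.exp (u ^ 2 / 2)) * (c / 2) := by
        field_simp
    _ ≤ 2 / c * u * (Real.exp (-(u ^ 2 / 8)) * Real.exp (u ^ 2 / 2)) *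
        (u * Real.exp (-(u ^ 2 / 2)) * gg u) := by gcongr
    _ = _ := by linear_combination 2 / c * u ^ 2 * gg u * e

end

open MeasureTheory Filter Topology ProbabilityTheory

noncomputable section

/-! ### Killed lattice paths -/

open Classical in
/-- number of lattice paths from `(0,0)` to `(j,k)` that stay alive -/
def latA (al : ℕ → ℕ → Prop) : ℕ → ℕ → ℕ
  | 0, 0 => 1
  | 0, _ + 1 => 0
  | j + 1, 0 => if al (j + 1) 0 then latA al j 0 else 0
  | j + 1, k + 1 => if al (j + 1) (k + 1) then latA al j (k + 1) + latA al j k else 0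

open Classical in
/-- the good subsets -/
def goodS (al : ℕ → ℕ → Prop) (j k : ℕ) : Finset (Finset ℕ) :=
  (Finset.powersetCard k (Finset.range j)).filter
    (fun S => ∀ i ∈ Finset.Icc 1 j, al i (S.filter (· < i)).card)

lemma mem_goodS {al : ℕ → ℕ → Prop} {j k : ℕ} {S : Finset ℕ} :
    S ∈ goodS al j k ↔ S ∈ Finset.powersetCard k (Finset.range j) ∧
      ∀ i ∈ Finset.Icc 1 j, al i (S.filter (· < i)).card := by
  unfold goodS
  simp only [Finset.mem_filter]

lemma filter_lt_card {S : Finset ℕ} {j k : ℕ} (hS : S ∈ Finset.powersetCard k (Finset.range j)) :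
    (S.filter (· < j)).card = k := by
  rw [Finset.mem_powersetCard] at hS
  rw [Finset.filter_true_of_mem, hS.2]
  intro x hx
  exact Finset.mem_range.1 (hS.1 hx)

lemma filter_lt_succ_card {S : Finset ℕ} {j k : ℕ}
    (hS : S ∈ Finset.powersetCard k (Finset.range j)) :
    (S.filter (· < j + 1)).card = k := by
  rw [Finset.mem_powersetCard] at hS
  rw [Finset.filter_true_of_mem, hS.2]
  intro x hx
  exact (Finset.mem_range.1 (hS.1 hx)).trans (Nat.lt_succ_self j)

lemma filter_insert_lt {S : Finset ℕ} {i j : ℕ} (hi : i ≤ j) :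
    (insert j S).filter (· < i) = S.filter (· < i) := by
  rw [Finset.filter_insert, if_neg (by omega)]

lemma goodS_card (al : ℕ → ℕ → Prop) (j k : ℕ) : (goodS al j k).card = latA al j k := by
  classical
  induction j generalizing k with
  | zero =>
    cases k with
    | zero => simp [goodS, latA]
    | succ k => simp [goodS, latA]
  | succ j ih =>
    have key : ∀ S : Finset ℕ, ∀ k, S ∈ Finset.powersetCard k (Finset.range j) →
        ((∀ i ∈ Finset.Icc 1 (j + 1), al i (S.filter (· < i)).card) ↔
          (al (j + 1) k ∧ S ∈ goodS al j k)) := by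
      intro S k hS
      rw [mem_goodS]
      constructor
      · intro h
        refine ⟨?_, hS, fun i hi => h i ?_⟩
        · have := h (j + 1) (by simp)
          rwa [filter_lt_succ_card hS] at this
        · rw [Finset.mem_Icc] at *; omega
      · rintro ⟨h1, _, h2⟩ i hi
        rcases Nat.lt_or_ge j i with h | h
        · have : i = j + 1 := by rw [Finset.mem_Icc] at hi; omega
          subst this
          rwa [filter_lt_succ_card hS]
        · exact h2 i (by rw [Finset.mem_Icc] at *; omega)
    cases k with
    | zero =>
      have : goodS al (j + 1) 0 = if al (j + 1) 0 then goodS al j 0 else ∅ := by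
        ext S
        have e : Finset.powersetCard 0 (Finset.range (j + 1)) =
            Finset.powersetCard 0 (Finset.range j) := by simp
        rw [mem_goodS, e]
        constructor
        · rintro ⟨h1, h2⟩
          have := (key S 0 h1).1 h2
          rw [if_pos this.1]; exact this.2
        · intro h
          split_ifs at h with hal
          · have hS := (mem_goodS.1 h).1
            exact ⟨hS, (key S 0 hS).2 ⟨hal, h⟩⟩
          · simp at h
      rw [this, latA]
      split_ifs
      · exact ih 0
      · simp
    | succ k =>
      have key2 : ∀ S : Finset ℕ, S ∈ Finset.powersetCard k (Finset.range j) →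
        ((∀ i ∈ Finset.Icc 1 (j + 1), al i ((insert j S).filter (· < i)).card) ↔
          (al (j + 1) (k + 1) ∧ S ∈ goodS al j k)) := by
        intro S hS
        have hj : j ∉ S := by
          intro h
          have := (Finset.mem_powersetCard.1 hS).1 h
          simp at this
        have hc : ((insert j S).filter (· < j + 1)).card = k + 1 := by
          rw [Finset.filter_insert, if_pos (by omega), Finset.card_insert_of_notMem (by simp [hj]),
            filter_lt_succ_card hS]
        rw [mem_goodS]
        constructor
        · intro h
          refine ⟨?_, hS, fun i hi => ?_⟩
          · have := h (j + 1) (by simp)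
            rwa [hc] at this
          · have := h i (by rw [Finset.mem_Icc] at *; omega)
            rwa [filter_insert_lt (by rw [Finset.mem_Icc] at hi; omega)] at this
        · rintro ⟨h1, _, h2⟩ i hi
          rcases Nat.lt_or_ge j i with h | h
          · have : i = j + 1 := by rw [Finset.mem_Icc] at hi; omega
            subst this
            rwa [hc]
          · rw [filter_insert_lt h]
            exact h2 i (by rw [Finset.mem_Icc] at *; omega)
      have : goodS al (j + 1) (k + 1) = if al (j + 1) (k + 1) then
          goodS al j (k + 1) ∪ (goodS al j k).image (insert j) else ∅ := by
        ext S
        rw [mem_goodS, Finset.range_add_one,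
          Finset.powersetCard_succ_insert Finset.notMem_range_self]
        constructor
        · rintro ⟨h1, h2⟩
          rw [Finset.mem_union] at h1
          rcases h1 with h1 | h1
          · have := (key S _ h1).1 h2
            rw [if_pos this.1, Finset.mem_union]
            exact Or.inl this.2
          · obtain ⟨S', hS', rfl⟩ := Finset.mem_image.1 h1
            have := (key2 S' hS').1 h2
            rw [if_pos this.1, Finset.mem_union]
            exact Or.inr (Finset.mem_image_of_mem _ this.2)
        · intro h
          split_ifs at h with hal
          · rw [Finset.mem_union] at h
            rcases h with h | h
            · have hS := (mem_goodS.1 h).1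
              exact ⟨Finset.mem_union_left _ hS, (key S _ hS).2 ⟨hal, h⟩⟩
            · obtain ⟨S', hS', rfl⟩ := Finset.mem_image.1 h
              have hS := (mem_goodS.1 hS').1
              exact ⟨Finset.mem_union_right _ (Finset.mem_image_of_mem _ hS),
                (key2 S' hS).2 ⟨hal, hS'⟩⟩
          · simp at h
      rw [this, latA]
      split_ifs
      · have hnot : ∀ S k', S ∈ goodS al j k' → j ∉ S := by
          intro S k' hS h
          have := (Finset.mem_powersetCard.1 (mem_goodS.1 hS).1).1 h
          simp at this
        rw [Finset.card_union_of_disjoint, Finset.card_image_of_injOn, ih, ih]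
        · intro S hS S' hS' h
          have h1 := hnot S k hS
          have h2 := hnot S' k hS'
          have h : insert j S = insert j S' := h
          rw [← Finset.erase_insert h1, ← Finset.erase_insert h2, h]
        · rw [Finset.disjoint_left]
          intro S hS hS'
          obtain ⟨S'', _, rfl⟩ := Finset.mem_image.1 hS'
          exact hnot _ _ hS (Finset.mem_insert_self _ _)
      · simp

/-- sub-probability mass at time `j` -/
def latP (al : ℕ → ℕ → Prop) (n m j k : ℕ) : ℝ :=
  (latA al j k : ℝ) * ((m - j).choose (n - k) : ℝ) / (m.choose n : ℝ)

/-- jump probability -/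
def latq (n m j k : ℕ) : ℝ := ((n : ℝ) - k) / ((m : ℝ) - j)

lemma latP_nonneg (al : ℕ → ℕ → Prop) (n m j k : ℕ) : 0 ≤ latP al n m j k := by
  unfold latP; positivity

lemma latA_le (al : ℕ → ℕ → Prop) (j k : ℕ) : latA al j k ≤ latA (fun _ _ => True) j k := by
  induction j generalizing k with
  | zero => cases k <;> simp [latA]
  | succ j ih =>
    cases k with
    | zero => simp only [latA, if_true]; split_ifs <;> simp [ih]
    | succ k =>
      simp only [latA, if_true]; split_ifs
      · exact add_le_add (ih _) (ih _)
      · simp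

lemma latP_le (al : ℕ → ℕ → Prop) (n m j k : ℕ) :
    latP al n m j k ≤ latP (fun _ _ => True) n m j k := by
  unfold latP
  have := latA_le al j k
  gcongr

lemma choose_id1 (a b : ℕ) : ((a.choose b : ℕ) : ℝ) * ((a : ℝ) + 1) =
    ((a + 1).choose b : ℕ) * ((a : ℝ) + 1 - b) := by
  rcases Nat.lt_or_ge (a + 1) b with h | h
  · rw [Nat.choose_eq_zero_of_lt h, Nat.choose_eq_zero_of_lt (by omega)]; simp
  · have := Nat.choose_mul_succ_eq a b
    have h2 : (((a + 1 - b : ℕ)) : ℝ) = (a : ℝ) + 1 - b := by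
      rw [Nat.cast_sub h]; push_cast; ring
    rw [← h2]
    exact_mod_cast this

open Classical in
lemma lat_sum (al : ℕ → ℕ → Prop) {n m j : ℕ} (hj : j < m) (f : ℕ → ℝ) :
    ∑ k ∈ Finset.range (n + 1), latP al n m (j + 1) k * f k =
    ∑ k ∈ Finset.range (n + 1), latP al n m j k *
      ((1 - latq n m j k) * (if al (j + 1) k then f k else 0) +
        latq n m j k * (if al (j + 1) (k + 1) then f (k + 1) else 0)) := by
  obtain ⟨a, ha⟩ : ∃ a, m - j = a + 1 := ⟨m - j - 1, by omega⟩
  have ha' : m - (j + 1) = a := by omega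
  have hmj : (m : ℝ) - j = a + 1 := by
    rw [← Nat.cast_sub hj.le, ha]; push_cast; ring
  have hpos : (0 : ℝ) < a + 1 := by positivity
  -- split A (j+1) k
  have hA : ∀ k, (latA al (j + 1) k : ℝ) * f k =
      (latA al j k : ℝ) * (if al (j + 1) k then f k else 0) +
      (if k = 0 then 0 else (latA al j (k - 1) : ℝ) * (if al (j + 1) k then f k else 0)) := by
    intro k
    cases k with
    | zero => simp only [latA]; split_ifs <;> simp_all
    | succ k =>
      simp only [latA, Nat.add_eq_zero_iff, one_ne_zero, and_false, if_false, Nat.add_sub_cancel]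
      split_ifs <;> push_cast <;> ring
  have e1 : ∑ k ∈ Finset.range (n + 1), latP al n m (j + 1) k * f k =
      ∑ k ∈ Finset.range (n + 1), ((latA al j k : ℝ) * (if al (j + 1) k then f k else 0)) *
        ((a.choose (n - k) : ℝ) / (m.choose n : ℝ)) +
      ∑ k ∈ Finset.range (n + 1), (if k = 0 then 0 else (latA al j (k - 1) : ℝ) *
        (if al (j + 1) k then f k else 0)) *
        ((a.choose (n - k) : ℝ) / (m.choose n : ℝ)) := by
    rw [← Finset.sum_add_distrib]
    refine Finset.sum_congr rfl fun k _ => ?_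
    rw [← add_mul, ← hA, latP, ha']; ring
  rw [e1, Finset.sum_range_succ' (fun k => (if k = 0 then 0 else (latA al j (k - 1) : ℝ) *
        (if al (j + 1) k then f k else 0)) *
        ((a.choose (n - k) : ℝ) / (m.choose n : ℝ)))]
  simp only [Nat.add_eq_zero_iff, one_ne_zero, and_false, if_false, Nat.add_sub_cancel, if_true,
    zero_mul, add_zero]
  simp only [mul_add, Finset.sum_add_distrib]
  congr 1
  · refine Finset.sum_congr rfl fun k hk => ?_
    have hk' : k ≤ n := by rw [Finset.mem_range] at hk; omega
    have := choose_id1 a (n - k)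
    rw [Nat.cast_sub hk'] at this
    have e2 : (a.choose (n - k) : ℝ) = ((a + 1).choose (n - k) : ℕ) * (1 - latq n m j k) := by
      rw [latq, hmj]
      field_simp
      linarith
    rw [latP, ha, e2]; ring
  · rw [Finset.sum_range_succ]
    have e3 : latq n m j n = 0 := by simp [latq]
    rw [e3]
    simp only [zero_mul, mul_zero, add_zero]
    refine Finset.sum_congr rfl fun k hk => ?_
    have hk' : k < n := Finset.mem_range.1 hk
    obtain ⟨b, hb⟩ : ∃ b, n - k = b + 1 := ⟨n - k - 1, by omega⟩
    have hb' : n - (k + 1) = b := by omega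
    have hnk : (n : ℝ) - k = b + 1 := by
      rw [← Nat.cast_sub hk'.le, hb]; push_cast; ring
    have := Nat.add_one_mul_choose_eq a b
    have h2 : ((a : ℝ) + 1) * (a.choose b : ℕ) = ((a + 1).choose (b + 1) : ℕ) * ((b : ℝ) + 1) := by
      exact_mod_cast this
    have e2 : (a.choose b : ℝ) = ((a + 1).choose (b + 1) : ℕ) * latq n m j k := by
      rw [latq, hmj, hnk]
      field_simp
      linarith
    rw [latP, ha, hb, hb', e2]; ring

lemma lat_sum_true {n m j : ℕ} (hj : j < m) (f : ℕ → ℝ) :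
    ∑ k ∈ Finset.range (n + 1), latP (fun _ _ => True) n m (j + 1) k * f k =
    ∑ k ∈ Finset.range (n + 1), latP (fun _ _ => True) n m j k *
      ((1 - latq n m j k) * f k + latq n m j k * f (k + 1)) := by
  have := lat_sum (fun _ _ => True) (n := n) hj f
  simpa using this

lemma latP_zero_sum (al : ℕ → ℕ → Prop) {n m : ℕ} (hnm : n ≤ m) (f : ℕ → ℝ) :
    ∑ k ∈ Finset.range (n + 1), latP al n m 0 k * f k = f 0 := by
  rw [Finset.sum_range_succ']
  have : (m.choose n : ℝ) ≠ 0 := by exact_mod_cast (Nat.choose_pos hnm).ne'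
  simp [latP, latA, this]

lemma latP_true_mass {n m j : ℕ} (hnm : n ≤ m) (hj : j ≤ m) :
    ∑ k ∈ Finset.range (n + 1), latP (fun _ _ => True) n m j k = 1 := by
  induction j with
  | zero => simpa using latP_zero_sum (fun _ _ => True) hnm (fun _ => 1)
  | succ j ih =>
    have := lat_sum_true (n := n) (m := m) (j := j) (by omega) (fun _ => 1)
    simp only [mul_one, sub_add_cancel] at this
    rw [this, ih (by omega)]

lemma latP_true_mean {n m j : ℕ} (hnm : n ≤ m) (hj : j < m) :
    ∑ k ∈ Finset.range (n + 1), latP (fun _ _ => True) n m j k * ((k : ℝ) - n * j / m) = 0 := by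
  induction j with
  | zero =>
    have := latP_zero_sum (fun _ _ => True) hnm (fun k => (k : ℝ) - n * (0 : ℕ) / m)
    rw [this]; simp
  | succ j ih =>
    rw [lat_sum_true (by omega)]
    have hm : (m : ℝ) ≠ 0 := by
      have : 0 < m := by omega
      positivity
    have hmj : (m : ℝ) - j ≠ 0 := by
      have : (j : ℝ) < m := by exact_mod_cast (by omega : j < m)
      linarith
    have : ∀ k : ℕ, (1 - latq n m j k) * ((k : ℝ) - n * ((j + 1 : ℕ) : ℝ) / m) +
        latq n m j k * (((k + 1 : ℕ) : ℝ) - n * ((j + 1 : ℕ) : ℝ) / m) =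
        (1 - 1 / ((m : ℝ) - j)) * ((k : ℝ) - n * j / m) := by
      intro k
      unfold latq; push_cast; field_simp; ring
    simp only [this]
    have h2 := ih (by omega)
    calc _ = (1 - 1 / ((m : ℝ) - j)) * ∑ k ∈ Finset.range (n + 1),
          latP (fun _ _ => True) n m j k * ((k : ℝ) - n * j / m) := by
          rw [Finset.mul_sum]; refine Finset.sum_congr rfl fun k _ => by ring
      _ = 0 := by rw [h2, mul_zero]

lemma latP_true_var {n m j : ℕ} (hnm : n ≤ m) (hj : j < m) (hm1 : 2 ≤ m) :
    ∑ k ∈ Finset.range (n + 1), latP (fun _ _ => True) n m j k * ((k : ℝ) - n * j / m) ^ 2 =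
      (n / m : ℝ) * (1 - n / m) * (j * (m - j) / (m - 1)) := by
  have hm : (m : ℝ) ≠ 0 := by positivity
  have hm1' : (m : ℝ) - 1 ≠ 0 := by
    have : (2 : ℝ) ≤ m := by exact_mod_cast hm1
    linarith
  induction j with
  | zero =>
    have := latP_zero_sum (fun _ _ => True) hnm (fun k => ((k : ℝ) - n * (0 : ℕ) / m) ^ 2)
    rw [this]; simp
  | succ j ih =>
    rw [lat_sum_true (by omega)]
    have hmj : (m : ℝ) - j ≠ 0 := by
      have : (j : ℝ) < m := by exact_mod_cast (by omega : j < m)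
      linarith
    have : ∀ k : ℕ, (1 - latq n m j k) * ((k : ℝ) - n * ((j + 1 : ℕ) : ℝ) / m) ^ 2 +
        latq n m j k * (((k + 1 : ℕ) : ℝ) - n * ((j + 1 : ℕ) : ℝ) / m) ^ 2 =
        (1 - 2 / ((m : ℝ) - j)) * ((k : ℝ) - n * j / m) ^ 2 + (n / m : ℝ) * (1 - n / m) +
          (2 * n / (m * (m - j)) - 1 / ((m : ℝ) - j)) * ((k : ℝ) - n * j / m) := by
      intro k
      unfold latq; push_cast; field_simp; ring
    simp only [this]
    have h2 := ih (by omega)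
    have h1 := latP_true_mean hnm (show j < m by omega)
    have h0 := latP_true_mass hnm (show j ≤ m by omega)
    calc _ = (1 - 2 / ((m : ℝ) - j)) * ∑ k ∈ Finset.range (n + 1),
          latP (fun _ _ => True) n m j k * ((k : ℝ) - n * j / m) ^ 2 +
          (n / m : ℝ) * (1 - n / m) * ∑ k ∈ Finset.range (n + 1), latP (fun _ _ => True) n m j k +
          (2 * n / (m * (m - j)) - 1 / ((m : ℝ) - j)) * ∑ k ∈ Finset.range (n + 1),
          latP (fun _ _ => True) n m j k * ((k : ℝ) - n * j / m) := by
          rw [Finset.mul_sum, Finset.mul_sum, Finset.mul_sum, ← Finset.sum_add_distrib,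
            ← Finset.sum_add_distrib]
          refine Finset.sum_congr rfl fun k _ => by ring
      _ = _ := by
          rw [h2, h1, h0]; push_cast; field_simp; ring

/-- Chebyshev for the unkilled chain. -/
lemma latP_true_cheb {n m j : ℕ} (hn : 1 ≤ n) (hnm : n ≤ m) (hj0 : 0 < j) (hj : j < m) {w : ℝ}
    (hw : 0 < w) :
    ∑ k ∈ (Finset.range (n + 1)).filter
      (fun k : ℕ => ¬ |(k : ℝ) - n * j / m| ≤ w * Real.sqrt (n * (j / m) * (1 - j / m))),
      latP (fun _ _ => True) n m j k ≤ 1 / w ^ 2 := by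
  have hm1 : 2 ≤ m := by omega
  have hvar := latP_true_var hnm hj hm1
  have hmR : (2 : ℝ) ≤ m := by exact_mod_cast hm1
  have hjR : (j : ℝ) < m := by exact_mod_cast hj
  have hj0R : (0 : ℝ) < j := by exact_mod_cast hj0
  have hnR : (1 : ℝ) ≤ n := by exact_mod_cast hn
  have hnmR : (n : ℝ) ≤ m := by exact_mod_cast hnm
  set V : ℝ := n * (j / m) * (1 - j / m) with hV
  have hVpos : 0 < V := by
    have : (j : ℝ) / m < 1 := by rw [div_lt_one (by linarith)]; exact hjR
    have : 0 < (j : ℝ) / m := by positivity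
    rw [hV]; apply mul_pos (by positivity); linarith
  have hle : (n / m : ℝ) * (1 - n / m) * (j * (m - j) / (m - 1)) ≤ V := by
    have e : (n / m : ℝ) * (1 - n / m) * (j * (m - j) / (m - 1)) = V * ((m - n) / (m - 1)) := by
      rw [hV]
      have : (m : ℝ) - 1 ≠ 0 := by linarith
      have : (m : ℝ) ≠ 0 := by linarith
      field_simp
    rw [e]
    apply mul_le_of_le_one_right hVpos.le
    rw [div_le_one (by linarith)]; linarith
  set s := (Finset.range (n + 1)).filter
      (fun k : ℕ => ¬ |(k : ℝ) - n * j / m| ≤ w * Real.sqrt V) with hs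
  have h1 : ∑ k ∈ s,
      latP (fun _ _ => True) n m j k * (w ^ 2 * V) ≤ V := by
    calc _ ≤ ∑ k ∈ s,
        latP (fun _ _ => True) n m j k * ((k : ℝ) - n * j / m) ^ 2 := by
          refine Finset.sum_le_sum fun k hk => ?_
          rw [hs, Finset.mem_filter] at hk
          have h2 := not_le.1 hk.2
          have h3 : w ^ 2 * V ≤ ((k : ℝ) - n * j / m) ^ 2 := by
            rw [← sq_abs ((k : ℝ) - n * j / m)]
            calc w ^ 2 * V = (w * Real.sqrt V) ^ 2 := by rw [mul_pow, Real.sq_sqrt hVpos.le]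
              _ ≤ _ := by gcongr
          have := latP_nonneg (fun _ _ => True) n m j k
          gcongr
      _ ≤ ∑ k ∈ Finset.range (n + 1),
        latP (fun _ _ => True) n m j k * ((k : ℝ) - n * j / m) ^ 2 := by
          apply Finset.sum_le_sum_of_subset_of_nonneg (Finset.filter_subset _ _)
          intro k _ _
          have := latP_nonneg (fun _ _ => True) n m j k
          positivity
      _ ≤ V := by rw [hvar]; exact hle
  rw [← Finset.sum_mul] at h1
  rw [le_div_iff₀ (by positivity)]
  have := (mul_le_iff_le_one_left hVpos).1 (show _ * V ≤ V by rw [← mul_assoc] at h1; exact h1)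
  exact this

end

open MeasureTheory Filter Topology ProbabilityTheory

noncomputable section

/-! ### One step expansion -/

lemma y_expand {T T' y : ℝ} (hT : 0 < T) (hT' : 0 < T') (hy : 0 < y) (hy2 : y ^ 2 = T / T')
    (hle : |T' - T| ≤ T / 2) :
    |y - 1 + (T' - T) / T / 2| ≤ ((T' - T) / T) ^ 2 ∧ y ≤ 3 / 2 ∧ |y ^ 2 - 1| ≤ 2 * (|T' - T| / T)
      ∧ |y - 1| ≤ 2 * (|T' - T| / T) := by
  have h1 := abs_le.1 hle
  have hx : (T' - T) / T = 1 / y ^ 2 - 1 := by rw [hy2]; field_simp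
  have hy2' : y ^ 2 ≤ 2 := by rw [hy2, div_le_iff₀ hT']; linarith
  have hy3 : y ≤ 3 / 2 := by nlinarith
  have e4 : |y ^ 2 - 1| ≤ 2 * (|T' - T| / T) := by
    have : y ^ 2 - 1 = -((T' - T) / T) * y ^ 2 := by
      rw [hx]; field_simp; ring
    rw [this, abs_mul, abs_neg, abs_div, abs_of_pos hT, abs_of_pos (by positivity : 0 < y ^ 2)]
    have : 0 ≤ |T' - T| / T := by positivity
    nlinarith
  refine ⟨?_, hy3, e4, ?_⟩
  · rw [hx]
    have e1 : y - 1 + (1 / y ^ 2 - 1) / 2 = (y - 1) ^ 2 * (2 * y + 1) / (2 * y ^ 2) := by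
      field_simp; ring
    have e2 : (1 / y ^ 2 - 1) ^ 2 = (y - 1) ^ 2 * (1 + y) ^ 2 / y ^ 4 := by
      field_simp; ring
    rw [e1, e2, abs_of_nonneg (by positivity), div_le_div_iff₀ (by positivity) (by positivity)]
    have : (2 * y + 1) * y ^ 4 ≤ (1 + y) ^ 2 * (2 * y ^ 2) := by
      have : (2 * y + 1) * y ^ 2 ≤ (1 + y) ^ 2 * 2 := by nlinarith
      nlinarith [sq_nonneg y]
    nlinarith [sq_nonneg (y - 1)]
  · have : |y ^ 2 - 1| = |y - 1| * (y + 1) := by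
      rw [← abs_of_pos (by linarith : 0 < y + 1), ← abs_mul]; congr 1; ring
    nlinarith [abs_nonneg (y - 1)]

set_option maxHeartbeats 1600000 in
/-- algebra of the one-step increments -/
lemma step_alg {n Δ t W N u : ℝ} (hn : 0 < n) (hΔ : 0 < Δ) (ht : 0 < t) (ht1 : t < 1)
    (hT : Δ ≤ t * (1 - t) / 2) (hTN : 1 / (t * (1 - t)) ≤ N) (hnN : n ≤ N) (huN : u ≤ N)
    (hu : 1 ≤ u) (hN : 1 ≤ N)
    (hW : |W| ≤ u * √(n * (t * (1 - t)))) (hv : 1 ≤ √(n * (t * (1 - t))))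
    {v v' q Z Z0 : ℝ} (hvdef : v = √(n * (t * (1 - t))))
    (hv'def : v' = √(n * ((t + Δ) * (1 - (t + Δ)))))
    (hq : q = Δ * (n - W / (1 - t))) (hZ : Z = W / v) (hZ0 : Z0 = (W - n * Δ) / v') (hq0 : 0 ≤ q) :
    0 < v' ∧ |Z| ≤ u ∧ |Z0 - Z| ≤ 4 * N ^ 2 * Δ ∧ 1 / v' ≤ 3 / 2 / v ∧ q ≤ 2 * N ^ 2 * Δ ∧
    |Z0 + q / v' - Z + Z * Δ / (2 * (t * (1 - t)))| ≤ 2 * N ^ 3 * Δ ^ 2 ∧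
    |q / v' ^ 2 - Δ / (t * (1 - t))| ≤ Δ / (t * (1 - t)) * (9 / 4 * u / v) + 2 * N ^ 2 * Δ ^ 2 ∧
    q / v' ^ 3 ≤ Δ / (t * (1 - t)) * (27 / 4 * u / v) := by
  set T := t * (1 - t) with hTdef
  have hTpos : 0 < T := mul_pos ht (by linarith)
  set T' := (t + Δ) * (1 - (t + Δ)) with hT'def
  have hdiff : T' - T = Δ * (1 - 2 * t - Δ) := by rw [hT'def, hTdef]; ring
  have hTle : T ≤ 1 - t := by rw [hTdef]; nlinarith
  have hΔt : Δ ≤ 1 - t := by linarith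
  have hΔt2 : Δ ≤ (1 - t) / 2 := by linarith
  have habs : |1 - 2 * t - Δ| ≤ 1 := by
    rw [abs_le]; constructor <;> linarith
  have hdabs : |T' - T| ≤ Δ := by
    rw [hdiff, abs_mul, abs_of_pos hΔ]; exact mul_le_of_le_one_right hΔ.le habs
  have hle : |T' - T| ≤ T / 2 := hdabs.trans hT
  have hT'pos : 0 < T' := by have := (abs_le.1 hle).1; linarith
  have hvpos : 0 < v := by rw [hvdef]; linarith
  have hv'pos : 0 < v' := by rw [hv'def]; exact Real.sqrt_pos.2 (by positivity)
  have hv2 : v ^ 2 = n * T := by rw [hvdef]; exact Real.sq_sqrt (by positivity)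
  have hv'2 : v' ^ 2 = n * T' := by rw [hv'def]; exact Real.sq_sqrt (by positivity)
  have hv1 : 1 ≤ v := by rw [hvdef]; exact hv
  set y := v / v' with hy
  have hypos : 0 < y := div_pos hvpos hv'pos
  have hyy : y ^ 2 = T / T' := by
    rw [hy, div_pow, hv2, hv'2]; field_simp
  obtain ⟨hy1, hy2, hy3, hy4⟩ := y_expand hTpos hT'pos hypos hyy hle
  have hinv : 1 / v' = y / v := by rw [hy]; field_simp
  have hT1 : 1 / T ≤ N := hTN
  have hΔT : Δ / T ≤ N * Δ := by
    calc Δ / T = 1 / T * Δ := by ring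
      _ ≤ _ := by gcongr
  have hdT : |T' - T| / T ≤ N * Δ := le_trans (by gcongr) hΔT
  have hZu : |Z| ≤ u := by
    rw [hZ, abs_div, abs_of_pos hvpos, div_le_iff₀ hvpos, hvdef]; exact hW
  have hWZ : W = Z * v := by rw [hZ]; field_simp
  have h1t : 0 < 1 - t := by linarith
  have hT1t : 1 / (1 - t) ≤ N := le_trans (by gcongr) hT1
  have hNpos : 0 < N := by linarith
  have hNN : N * N = N ^ 2 := by ring
  -- W/(n(1-t)) = Z t / v
  have hWn : W / (1 - t) = n * (Z * t / v) := by
    rw [hWZ]; field_simp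
    rw [hv2, hTdef]; ring
  have hZt : |Z * t / v| ≤ u / v := by
    rw [abs_div, abs_of_pos hvpos, abs_mul, abs_of_pos ht]
    gcongr; exact (mul_le_of_le_one_right (abs_nonneg Z) ht1.le).trans hZu
  have huv : u / v ≤ u := div_le_self (by linarith) hv1
  have hy0 : y / v ≤ 3 / 2 / v := by gcongr
  have hZ0e : Z0 = Z * y - n * Δ * (y / v) := by
    rw [hZ0, hZ, hy]; field_simp
  have hqe : q = Δ * n * (1 - Z * t / v) := by rw [hq, hWn]; ring
  have hq2 : q / v' ^ 2 = Δ / T * ((1 - Z * t / v) * y ^ 2) := by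
    rw [hqe, hv'2, hyy]; field_simp
  have h1Z : |1 - Z * t / v| ≤ 1 + u / v := by
    calc |1 - Z * t / v| ≤ |1| + |Z * t / v| := abs_sub _ _
      _ ≤ _ := by rw [abs_one]; linarith
  have h1Z' : |1 - Z * t / v| ≤ 2 * u := by linarith
  have hΔTpos : 0 < Δ / T := by positivity
  have hy94 : y ^ 2 ≤ 9 / 4 := (pow_le_pow_left₀ hypos.le hy2 2).trans (by norm_num)
  have a3 : N * Δ ≤ N * N * Δ :=
    mul_le_mul_of_nonneg_right (le_mul_of_one_le_left hNpos.le hN) hΔ.le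
  refine ⟨hv'pos, hZu, ?_, ?_, ?_, ?_, ?_, ?_⟩
  · have : Z0 - Z = Z * (y - 1) - n * Δ * (y / v) := by rw [hZ0e]; ring
    rw [this]
    have a1 : |Z * (y - 1)| ≤ N * (2 * (N * Δ)) := by
      rw [abs_mul]; gcongr
      · linarith
      · linarith
    have a2 : |n * Δ * (y / v)| ≤ N * Δ * (3 / 2) := by
      have h0 : y / v ≤ 3 / 2 := hy0.trans (div_le_self (by norm_num) hv1)
      rw [abs_of_pos (by positivity)]
      exact mul_le_mul (mul_le_mul_of_nonneg_right hnN hΔ.le) h0 (by positivity) (by positivity)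
    calc _ ≤ |Z * (y - 1)| + |n * Δ * (y / v)| := abs_sub _ _
      _ ≤ 4 * N ^ 2 * Δ := by linarith
  · rw [hinv]; exact hy0
  · have : q ≤ Δ * (n + |W| / (1 - t)) := by
      rw [hq]; gcongr
      have := neg_abs_le (W / (1 - t))
      rw [abs_div, abs_of_pos h1t] at this; linarith
    have hw1 : |W| / (1 - t) ≤ N * N := by
      have h0 : |W| / (1 - t) = |W / (1 - t)| := by rw [abs_div, abs_of_pos h1t]
      rw [h0, hWn, abs_mul, abs_of_pos hn]
      gcongr
      linarith
    have := mul_le_mul_of_nonneg_left (add_le_add hnN hw1) hΔ.le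
    linarith
  · set e := (T' - T) / T with he
    have hee : e = Δ * (1 - 2 * t) / T - Δ ^ 2 / T := by rw [he, hdiff]; ring
    set ρ := y - 1 + e / 2 with hρ
    have hyρ : y = 1 - e / 2 + ρ := by rw [hρ]; ring
    have hqv : q / v' = Δ * n * (1 - Z * t / v) * (y / v) := by
      rw [div_eq_mul_one_div, hinv, hqe]
    have key : Z0 + q / v' - Z + Z * Δ / (2 * T) =
        Z * (Δ ^ 2 / (2 * T) + Δ * e / (2 * (1 - t)) + ρ * (1 - Δ / (1 - t))) := by
      have s1 : Z0 + q / v' = Z * ((1 - Δ / (1 - t)) * y) := by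
        have h9 : n * t / v ^ 2 = 1 / (1 - t) := by rw [hv2, hTdef]; field_simp
        rw [hqv, hZ0e]
        have : Δ * n * (1 - Z * t / v) * (y / v) = Δ * n * (y / v) - Z * Δ * y * (n * t / v ^ 2) := by
          field_simp
        rw [this, h9]; ring
      have hyy2 : (1 - Δ / (1 - t)) * y = 1 - e / 2 - Δ / (1 - t) + Δ * e / (2 * (1 - t))
          + ρ * (1 - Δ / (1 - t)) := by rw [hyρ]; field_simp; ring
      have s2 : e / 2 + Δ / (1 - t) = Δ / (2 * T) - Δ ^ 2 / (2 * T) := by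
        rw [hee, hTdef]; field_simp; ring
      rw [s1, hyy2]
      linear_combination (-Z) * s2
    rw [key, abs_mul]
    have heabs : |e| ≤ N * Δ := by rw [he, abs_div, abs_of_pos hTpos]; exact hdT
    have b1 : |Δ ^ 2 / (2 * T)| ≤ N ^ 2 * Δ ^ 2 / 2 := by
      rw [abs_of_pos (by positivity)]
      calc Δ ^ 2 / (2 * T) = (Δ / T) * Δ / 2 := by field_simp
        _ ≤ (N * Δ) * Δ / 2 := by gcongr
        _ ≤ _ := by
          have := mul_nonneg (mul_nonneg hNpos.le (sub_nonneg.2 hN)) (sq_nonneg Δ)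
          linarith only [this]
    have b2 : |Δ * e / (2 * (1 - t))| ≤ N ^ 2 * Δ ^ 2 / 2 := by
      rw [abs_div, abs_mul, abs_of_pos hΔ, abs_of_pos (by positivity : 0 < 2 * (1 - t))]
      calc Δ * |e| / (2 * (1 - t)) = Δ * |e| * (1 / (1 - t)) / 2 := by field_simp
        _ ≤ Δ * (N * Δ) * N / 2 := by gcongr
        _ = _ := by ring
    have b3 : |ρ * (1 - Δ / (1 - t))| ≤ N ^ 2 * Δ ^ 2 := by
      have c1 : |1 - Δ / (1 - t)| ≤ 1 := by
        have : Δ / (1 - t) ≤ 1 := by rw [div_le_one h1t]; exact hΔt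
        have : 0 < Δ / (1 - t) := by positivity
        rw [abs_le]; constructor <;> linarith
      rw [abs_mul]
      calc _ ≤ (e ^ 2) * 1 := by gcongr
        _ = |e| ^ 2 := by rw [mul_one, sq_abs]
        _ ≤ (N * Δ) ^ 2 := by gcongr
        _ = _ := by ring
    calc |Z| * _ ≤ N * (N ^ 2 * Δ ^ 2 / 2 + N ^ 2 * Δ ^ 2 / 2 + N ^ 2 * Δ ^ 2) := by
          gcongr
          · linarith
          · exact (abs_add_le _ _).trans (add_le_add ((abs_add_le _ _).trans (add_le_add b1 b2)) b3)
      _ = _ := by ring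
  · rw [hq2]
    have : Δ / T * ((1 - Z * t / v) * y ^ 2) - Δ / T =
        Δ / T * (-(Z * t / v) * y ^ 2 + (y ^ 2 - 1)) := by ring
    rw [this, abs_mul, abs_of_pos hΔTpos]
    have c1 : |-(Z * t / v) * y ^ 2| ≤ u / v * (9 / 4) := by
      rw [abs_mul, abs_neg, abs_of_pos (by positivity : 0 < y ^ 2)]; gcongr
    have c2 : |y ^ 2 - 1| ≤ 2 * (N * Δ) := by linarith
    calc _ ≤ Δ / T * (u / v * (9 / 4) + 2 * (N * Δ)) := by
          gcongr; exact (abs_add_le _ _).trans (add_le_add c1 c2)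
      _ = Δ / T * (9 / 4 * u / v) + Δ / T * (2 * (N * Δ)) := by ring
      _ ≤ Δ / T * (9 / 4 * u / v) + N * Δ * (2 * (N * Δ)) := by gcongr
      _ = _ := by ring
  · have : q / v' ^ 3 = q / v' ^ 2 * (1 / v') := by field_simp
    rw [this, hinv, hq2]
    have c1 : (1 - Z * t / v) * y ^ 2 ≤ 2 * u * (9 / 4) := by
      calc _ ≤ |1 - Z * t / v| * y ^ 2 := by gcongr; exact le_abs_self _
        _ ≤ _ := by gcongr
    calc _ ≤ Δ / T * (2 * u * (9 / 4)) * (3 / 2 / v) := by gcongr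
      _ = _ := by ring

set_option maxHeartbeats 1600000 in
lemma one_step {h h1 h2 h3 : ℝ → ℝ} (d1 : ∀ z, HasDerivAt h (h1 z) z)
    (d2 : ∀ z, HasDerivAt h1 (h2 z) z) (d3 : ∀ z, HasDerivAt h2 (h3 z) z) {M R lam : ℝ}
    (hM : 0 ≤ M)
    (hM1 : ∀ z, |z| ≤ R → |h1 z| ≤ M) (hM2 : ∀ z, |z| ≤ R → |h2 z| ≤ M)
    (hM3 : ∀ z, |z| ≤ R → |h3 z| ≤ M) (hode : ∀ z, h2 z - z * h1 z = -2 * lam)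
    {n Δ t W N u : ℝ} (hn : 0 < n) (hΔ : 0 < Δ) (ht : 0 < t) (ht1 : t < 1)
    (hT : Δ ≤ t * (1 - t) / 2) (hTN : 1 / (t * (1 - t)) ≤ N) (hnN : n ≤ N) (huN : u ≤ N)
    (hu : 1 ≤ u) (hN : 1 ≤ N)
    (hW : |W| ≤ u * √(n * (t * (1 - t)))) (hv : 1 ≤ √(n * (t * (1 - t))))
    {v v' q : ℝ} (hvdef : v = √(n * (t * (1 - t))))
    (hv'def : v' = √(n * ((t + Δ) * (1 - (t + Δ)))))
    (hq : q = Δ * (n - W / (1 - t))) (hq0 : 0 ≤ q)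
    (hR : u + 4 * N ^ 2 * Δ + 2 / v ≤ R) :
    |(1 - q) * h ((W - n * Δ) / v') + q * h ((W + 1 - n * Δ) / v') - h (W / v)
      + lam * Δ / (t * (1 - t))| ≤ M * (Δ / (t * (1 - t)) * (9 * u / v) + 40 * N ^ 4 * Δ ^ 2) ∧
    |(W - n * Δ) / v'| ≤ u + 4 * N ^ 2 * Δ + 2 / v ∧
    |(W + 1 - n * Δ) / v'| ≤ u + 4 * N ^ 2 * Δ + 2 / v ∧ q ≤ 2 * N ^ 2 * Δ := by
  obtain ⟨hv'pos, hZu, hdZ, hη, hqN, hA, hB, hC⟩ := step_alg hn hΔ ht ht1 hT hTN hnN huN hu hN hW hv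
    hvdef hv'def hq (Z := W / v) rfl (Z0 := (W - n * Δ) / v') rfl hq0
  have hTpos : 0 < t * (1 - t) := mul_pos ht (by linarith)
  set T := t * (1 - t) with hTdef
  set Z := W / v with hZ
  set Z0 := (W - n * Δ) / v' with hZ0
  have hZ1 : (W + 1 - n * Δ) / v' = Z0 + 1 / v' := by rw [hZ0]; ring
  rw [hZ1]
  set η := 1 / v' with hηdef
  have hηpos : 0 < η := by positivity
  have hvpos : 0 < v := by rw [hvdef]; linarith
  have hv1 : 1 ≤ v := by rw [hvdef]; exact hv
  have h32 : 3 / 2 / v ≤ 2 / v := by gcongr; norm_num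
  have hη2 : η ≤ 3 / 2 := hη.trans (div_le_self (by norm_num) hv1)
  have hb0 : |Z0| ≤ u + 4 * N ^ 2 * Δ := by
    have := abs_sub_abs_le_abs_sub Z0 Z; linarith
  have h2v : 0 < 2 / v := by positivity
  have hb0' : |Z0| ≤ u + 4 * N ^ 2 * Δ + 2 / v := by linarith
  have hb1 : |Z0 + η| ≤ u + 4 * N ^ 2 * Δ + 2 / v := by
    have := abs_add_le Z0 η; rw [abs_of_pos hηpos] at this; linarith
  refine ⟨?_, hb0', hb1, hqN⟩
  have rZ : |Z| ≤ R := by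
    have : 0 ≤ 4 * N ^ 2 * Δ := by positivity
    linarith
  have rZ0 : |Z0| ≤ R := hb0'.trans hR
  have rZ1 : |Z0 + η| ≤ R := hb1.trans hR
  have t1 := tay2 d1 d2 hM2 rZ rZ0
  have t2 := tay3 d1 d2 d3 hM3 rZ0 rZ1
  have t3 := tay1 d2 hM2 rZ rZ0
  have t4 := tay1 d3 hM3 rZ rZ0
  rw [show Z0 + η - Z0 = η by ring, abs_of_pos hηpos] at t2
  have hqη : q / v' = q * η := by rw [hηdef]; ring
  have hqη2 : q / v' ^ 2 = q * η ^ 2 := by rw [hηdef]; field_simp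
  have hqη3 : q / v' ^ 3 = q * η ^ 3 := by rw [hηdef]; field_simp
  rw [hqη] at hA
  rw [hqη2] at hB
  rw [hqη3] at hC
  have hode' := hode Z
  set r1 := h Z0 - h Z - h1 Z * (Z0 - Z) with hr1
  set r2 := h (Z0 + η) - h Z0 - h1 Z0 * η - h2 Z0 * η ^ 2 / 2 with hr2
  set r3 := h1 Z0 - h1 Z with hr3
  set r4 := h2 Z0 - h2 Z with hr4
  set r5 := Z0 + q * η - Z + Z * Δ / (2 * T) with hr5
  set r6 := q * η ^ 2 - Δ / T with hr6
  have key : (1 - q) * h Z0 + q * h (Z0 + η) - h Z + lam * Δ / T =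
      r1 + q * r2 + q * η * r3 + q * η ^ 2 / 2 * r4 + h1 Z * r5 + h2 Z * r6 / 2 := by
    have hl : lam = -(h2 Z - Z * h1 Z) / 2 := by linarith
    rw [hr1, hr2, hr3, hr4, hr5, hr6, hl]
    field_simp
    ring
  rw [key]
  have D0 : 0 ≤ 4 * N ^ 2 * Δ := by positivity
  have s1 : |r1| ≤ M * (4 * N ^ 2 * Δ) ^ 2 := t1.trans (by gcongr)
  have s2 : |q * r2| ≤ M * (Δ / T * (27 / 4 * u / v)) := by
    rw [abs_mul, abs_of_nonneg hq0]
    calc q * |r2| ≤ q * (M * η ^ 3) := by gcongr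
      _ = M * (q * η ^ 3) := by ring
      _ ≤ _ := by gcongr
  have s3 : |q * η * r3| ≤ M * (2 * N ^ 2 * Δ * (3 / 2) * (4 * N ^ 2 * Δ)) := by
    rw [abs_mul, abs_of_nonneg (by positivity)]
    calc q * η * |r3| ≤ (2 * N ^ 2 * Δ) * (3 / 2) * (M * (4 * N ^ 2 * Δ)) := by
          gcongr
          exact t3.trans (by gcongr)
      _ = _ := by ring
  have s4 : |q * η ^ 2 / 2 * r4| ≤ M * (2 * N ^ 2 * Δ * (3 / 2) ^ 2 / 2 * (4 * N ^ 2 * Δ)) := by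
    rw [abs_mul, abs_of_nonneg (by positivity)]
    calc q * η ^ 2 / 2 * |r4| ≤ (2 * N ^ 2 * Δ) * (3 / 2) ^ 2 / 2 * (M * (4 * N ^ 2 * Δ)) := by
          gcongr
          exact t4.trans (by gcongr)
      _ = _ := by ring
  have s5 : |h1 Z * r5| ≤ M * (2 * N ^ 3 * Δ ^ 2) := by
    rw [abs_mul]; gcongr; exact hM1 Z rZ
  have s6 : |h2 Z * r6 / 2| ≤ M * ((Δ / T * (9 / 4 * u / v) + 2 * N ^ 2 * Δ ^ 2) / 2) := by
    rw [abs_div, abs_mul, abs_two, mul_div_assoc]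
    gcongr
    exact hM2 Z rZ
  have tot : |r1 + q * r2 + q * η * r3 + q * η ^ 2 / 2 * r4 + h1 Z * r5 + h2 Z * r6 / 2| ≤
      |r1| + |q * r2| + |q * η * r3| + |q * η ^ 2 / 2 * r4| + |h1 Z * r5| + |h2 Z * r6 / 2| := by
    refine (abs_add_le _ _).trans (add_le_add ?_ le_rfl)
    refine (abs_add_le _ _).trans (add_le_add ?_ le_rfl)
    refine (abs_add_le _ _).trans (add_le_add ?_ le_rfl)
    refine (abs_add_le _ _).trans (add_le_add ?_ le_rfl)
    exact abs_add_le _ _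
  refine tot.trans ?_
  have e0 : 0 ≤ Δ / T * (u / v) := by positivity
  have fin : (4 * N ^ 2 * Δ) ^ 2 + Δ / T * (27 / 4 * u / v) + 2 * N ^ 2 * Δ * (3 / 2) * (4 * N ^ 2 * Δ)
    + 2 * N ^ 2 * Δ * (3 / 2) ^ 2 / 2 * (4 * N ^ 2 * Δ) + 2 * N ^ 3 * Δ ^ 2
    + (Δ / T * (9 / 4 * u / v) + 2 * N ^ 2 * Δ ^ 2) / 2 ≤
    Δ / T * (9 * u / v) + 40 * N ^ 4 * Δ ^ 2 := by
    have n3 : N ^ 3 ≤ N ^ 4 := pow_le_pow_right₀ hN (by norm_num)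
    have n2 : N ^ 2 ≤ N ^ 4 := pow_le_pow_right₀ hN (by norm_num)
    have d2 : 0 ≤ Δ ^ 2 := sq_nonneg _
    have m3 := mul_le_mul_of_nonneg_right n3 d2
    have m2 := mul_le_mul_of_nonneg_right n2 d2
    have e1 : Δ / T * (27 / 4 * u / v) = 27 / 4 * (Δ / T * (u / v)) := by ring
    have e2 : Δ / T * (9 / 4 * u / v) = 9 / 4 * (Δ / T * (u / v)) := by ring
    have e3 : Δ / T * (9 * u / v) = 9 * (Δ / T * (u / v)) := by ring
    rw [e1, e2, e3]
    ring_nf at m2 m3 e0 ⊢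
    linarith
  have := mul_le_mul_of_nonneg_left fin hM
  linarith

end

open MeasureTheory Filter Topology ProbabilityTheory

noncomputable section

/-! ### Discrete Gronwall -/

lemma one_sub_ge_exp {s : ℝ} (h0 : 0 ≤ s) (h1 : s ≤ 1 / 2) : Real.exp (-(s + s ^ 2)) ≤ 1 - s := by
  have := Real.quadratic_le_exp_of_nonneg (by positivity : 0 ≤ s + s ^ 2)
  rw [Real.exp_neg]
  rw [inv_le_comm₀ (Real.exp_pos _) (by linarith)]
  refine le_trans ?_ this
  rw [inv_le_iff_one_le_mul₀ (by linarith)]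
  have h2 : s ^ 2 ≤ 1 / 4 := by nlinarith
  have h3 : s ^ 3 ≤ 1 / 8 := by nlinarith
  nlinarith [mul_nonneg (sq_nonneg s) (by linarith : (0:ℝ) ≤ 1 - s - s ^ 2 - s ^ 3)]

lemma gron {mm aa s e : ℕ → ℝ} {K : ℕ} {ρ : ℝ}
    (h : ∀ i < K, mm (i + 1) = mm i - s i * aa i + e i)
    (h1 : ∀ i ≤ K, mm i ≤ aa i) (h2 : ∀ i ≤ K, aa i ≤ mm i + ρ)
    (h3 : ∀ i < K, 0 ≤ s i) (h4 : ∀ i < K, s i ≤ 1 / 2) (h5 : aa 0 ≤ 1) (h6 : 0 ≤ aa 0) :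
    aa K ≤ Real.exp (-∑ i ∈ Finset.range K, s i) + ∑ i ∈ Finset.range K, |e i| + ρ ∧
    aa 0 * Real.exp (-∑ i ∈ Finset.range K, (s i + s i ^ 2)) - ∑ i ∈ Finset.range K, |e i| - ρ
      ≤ aa K := by
  have up : ∀ k ≤ K, mm k ≤ Real.exp (-∑ i ∈ Finset.range k, s i) +
      ∑ i ∈ Finset.range k, |e i| := by
    intro k
    induction k with
    | zero => intro _; simp; linarith [h1 0 (Nat.zero_le _)]
    | succ k ih =>
      intro hk
      have ih' := ih (by omega)
      rw [h k (by omega), Finset.sum_range_succ, Finset.sum_range_succ, neg_add, Real.exp_add]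
      have a1 := h1 k (by omega)
      have a2 := h3 k (by omega)
      have a3 := h4 k (by omega)
      have b1 : s k * mm k ≤ s k * aa k := mul_le_mul_of_nonneg_left a1 a2
      have b2 : (1 - s k) * mm k ≤ (1 - s k) * (Real.exp (-∑ i ∈ Finset.range k, s i) +
        ∑ i ∈ Finset.range k, |e i|) := mul_le_mul_of_nonneg_left ih' (by linarith)
      have b3 : 1 - s k ≤ Real.exp (-s k) := by linarith [Real.add_one_le_exp (-s k)]
      have b4 : (1 - s k) * Real.exp (-∑ i ∈ Finset.range k, s i) ≤
          Real.exp (-s k) * Real.exp (-∑ i ∈ Finset.range k, s i) :=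
        mul_le_mul_of_nonneg_right b3 (Real.exp_pos _).le
      have b5 : (1 - s k) * ∑ i ∈ Finset.range k, |e i| ≤ ∑ i ∈ Finset.range k, |e i| :=
        mul_le_of_le_one_left (Finset.sum_nonneg fun _ _ => abs_nonneg _) (by linarith)
      have b6 := le_abs_self (e k)
      linarith
  have lo : ∀ k ≤ K, aa 0 * Real.exp (-∑ i ∈ Finset.range k, (s i + s i ^ 2)) -
      ∑ i ∈ Finset.range k, |e i| ≤ mm k + ρ := by
    intro k
    induction k with
    | zero => intro _; simp; linarith [h2 0 (Nat.zero_le _)]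
    | succ k ih =>
      intro hk
      have ih' := ih (by omega)
      rw [h k (by omega), Finset.sum_range_succ, Finset.sum_range_succ, neg_add, Real.exp_add]
      have a1 := h2 k (by omega)
      have a2 := h3 k (by omega)
      have a3 := h4 k (by omega)
      have b1 : s k * aa k ≤ s k * (mm k + ρ) := mul_le_mul_of_nonneg_left a1 a2
      have b2 := mul_le_mul_of_nonneg_left ih' (by linarith : 0 ≤ 1 - s k)
      have b3 := one_sub_ge_exp a2 a3
      have b4 : (aa 0 * Real.exp (-∑ i ∈ Finset.range k, (s i + s i ^ 2))) *
          Real.exp (-(s k + s k ^ 2)) ≤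
          (aa 0 * Real.exp (-∑ i ∈ Finset.range k, (s i + s i ^ 2))) * (1 - s k) :=
        mul_le_mul_of_nonneg_left b3 (mul_nonneg h6 (Real.exp_pos _).le)
      have b5 : (1 - s k) * ∑ i ∈ Finset.range k, |e i| ≤ ∑ i ∈ Finset.range k, |e i| :=
        mul_le_of_le_one_left (Finset.sum_nonneg fun _ _ => abs_nonneg _) (by linarith)
      have b6 := neg_abs_le (e k)
      linarith
  constructor
  · linarith [up K le_rfl, h2 K le_rfl]
  · linarith [lo K le_rfl, h1 K le_rfl]

/-! ### The alive predicate -/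

/-- alive predicate -/
def alv (n m J0 J1 : ℕ) (u : ℝ) (j k : ℕ) : Prop :=
  J0 ≤ j → j ≤ J1 → |(k : ℝ) - n * j / m| ≤ u * √(n * (j / m) * (1 - j / m))

/-- total alive mass -/
def aS (n m J0 J1 : ℕ) (u : ℝ) (j : ℕ) : ℝ :=
  ∑ k ∈ Finset.range (n + 1), latP (alv n m J0 J1 u) n m j k

lemma latA_dead {al : ℕ → ℕ → Prop} {j k : ℕ} (hj : 1 ≤ j) (h : ¬ al j k) : latA al j k = 0 := by
  obtain ⟨i, rfl⟩ : ∃ i, j = i + 1 := ⟨j - 1, by omega⟩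
  cases k <;> simp [latA, h]

lemma latA_before {n m J0 J1 : ℕ} {u : ℝ} {j : ℕ} (hj : j < J0) (k : ℕ) :
    latA (alv n m J0 J1 u) j k = latA (fun _ _ => True) j k := by
  induction j generalizing k with
  | zero => cases k <;> rfl
  | succ j ih =>
    have : ∀ k, alv n m J0 J1 u (j + 1) k := fun k h => by omega
    cases k <;> simp [latA, this, ih (by omega)]

open Classical in
lemma latA_at {n m J0 J1 : ℕ} {u : ℝ} (hJ : 1 ≤ J0) (k : ℕ) :
    latA (alv n m J0 J1 u) J0 k =
      if alv n m J0 J1 u J0 k then latA (fun _ _ => True) J0 k else 0 := by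
  obtain ⟨j, rfl⟩ : ∃ i, J0 = i + 1 := ⟨J0 - 1, by omega⟩
  cases k <;> simp [latA, latA_before (Nat.lt_succ_self j)]

lemma aS_after {n m J0 J1 : ℕ} {u : ℝ} {j : ℕ} (hj : J1 ≤ j) (hjm : j ≤ m) :
    aS n m J0 J1 u j = aS n m J0 J1 u J1 := by
  induction j, hj using Nat.le_induction with
  | base => rfl
  | succ j hj ih =>
    rw [← ih (by omega)]
    have := lat_sum (alv n m J0 J1 u) (n := n) (m := m) (j := j) (by omega) (fun _ => 1)
    have ht : ∀ k, alv n m J0 J1 u (j + 1) k := fun k _ h => by omega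
    simp only [ht, if_true, mul_one, sub_add_cancel] at this
    exact this

lemma aS_end {n m J0 J1 : ℕ} {u : ℝ} (hJ1 : J1 ≤ m) :
    (latA (alv n m J0 J1 u) m n : ℝ) / (m.choose n : ℝ) = aS n m J0 J1 u J1 := by
  rw [← aS_after hJ1 le_rfl, aS, Finset.sum_range_succ, Finset.sum_eq_zero]
  · simp [latP]
  · intro k hk
    have : 0 < n - k := by rw [Finset.mem_range] at hk; omega
    simp [latP, Nat.choose_eq_zero_of_lt this]

lemma aS_nonneg {n m J0 J1 : ℕ} {u : ℝ} (j : ℕ) : 0 ≤ aS n m J0 J1 u j :=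
  Finset.sum_nonneg fun _ _ => latP_nonneg _ _ _ _ _

lemma aS_le_one {n m J0 J1 : ℕ} {u : ℝ} {j : ℕ} (hnm : n ≤ m) (hj : j ≤ m) :
    aS n m J0 J1 u j ≤ 1 := by
  rw [← latP_true_mass hnm hj]
  exact Finset.sum_le_sum fun k _ => latP_le _ _ _ _ _

lemma aS_start {n m J0 J1 : ℕ} {u : ℝ} (hn : 1 ≤ n) (hnm : n ≤ m) (hJ0 : 1 ≤ J0) (hJ : J0 ≤ J1)
    (hJ0m : J0 < m) (hu : 0 < u) : 1 - 1 / u ^ 2 ≤ aS n m J0 J1 u J0 := by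
  classical
  have hc := latP_true_cheb hn hnm hJ0 hJ0m hu
  have hm := latP_true_mass hnm hJ0m.le
  rw [← Finset.sum_filter_add_sum_filter_not (Finset.range (n + 1))
    (fun k : ℕ => |(k : ℝ) - n * J0 / m| ≤ u * √(n * (J0 / m) * (1 - J0 / m)))] at hm
  have : ∑ k ∈ (Finset.range (n + 1)).filter
      (fun k : ℕ => |(k : ℝ) - n * J0 / m| ≤ u * √(n * (J0 / m) * (1 - J0 / m))),
      latP (fun _ _ => True) n m J0 k ≤ aS n m J0 J1 u J0 := by
    rw [aS, Finset.sum_filter]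
    refine Finset.sum_le_sum fun k _ => ?_
    split_ifs with h
    · have ha : alv n m J0 J1 u J0 k := fun _ _ => h
      rw [latP, latP, latA_at hJ0, if_pos ha]
    · exact latP_nonneg _ _ _ _ _
  linarith

/-- the mass where `gg` is not small -/
lemma aS_sub_le {n m J0 J1 j : ℕ} {u : ℝ} (hn : 1 ≤ n) (hnm : n ≤ m) (hJ0 : 1 ≤ J0)
    (hj0 : J0 ≤ j) (hj1 : j ≤ J1) (hjm : j < m) (hu : 0 < u) {f : ℕ → ℝ} {c : ℝ} (hc : 0 ≤ c)
    (hf : ∀ k : ℕ, |(k : ℝ) - n * j / m| ≤ u * √(n * (j / m) * (1 - j / m)) → f k ≤ 1)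
    (hf2 : ∀ k : ℕ, |(k : ℝ) - n * j / m| ≤ u / 2 * √(n * (j / m) * (1 - j / m)) → f k ≤ c) :
    ∑ k ∈ Finset.range (n + 1), latP (alv n m J0 J1 u) n m j k * f k ≤ c + 4 / u ^ 2 := by
  classical
  have hcb := latP_true_cheb hn hnm (by omega : 0 < j) hjm (half_pos hu)
  rw [Finset.sum_filter] at hcb
  have e : 1 / (u / 2) ^ 2 = 4 / u ^ 2 := by field_simp; norm_num
  rw [e] at hcb
  have hle : ∀ k ∈ Finset.range (n + 1), latP (alv n m J0 J1 u) n m j k * f k ≤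
      latP (alv n m J0 J1 u) n m j k * c +
      (if ¬ |(k : ℝ) - n * j / m| ≤ u / 2 * √(n * (j / m) * (1 - j / m)) then
        latP (fun _ _ => True) n m j k else 0) := by
    intro k _
    have p0 := latP_nonneg (alv n m J0 J1 u) n m j k
    split_ifs with h
    · rw [add_zero]
      exact mul_le_mul_of_nonneg_left (hf2 k h) p0
    · by_cases ha : |(k : ℝ) - n * j / m| ≤ u * √(n * (j / m) * (1 - j / m))
      · have := mul_le_mul_of_nonneg_left (hf k ha) p0
        have := latP_le (alv n m J0 J1 u) n m j k
        have := mul_nonneg p0 hc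
        linarith
      · have : latP (alv n m J0 J1 u) n m j k = 0 := by
          rw [latP, latA_dead (by omega) (fun h' => ha (h' hj0 hj1))]; simp
        rw [this]
        have := latP_nonneg (fun _ _ => True) n m j k
        simpa using this
  refine (Finset.sum_le_sum hle).trans ?_
  rw [Finset.sum_add_distrib, ← Finset.sum_mul]
  have h1 : (∑ k ∈ Finset.range (n + 1), latP (alv n m J0 J1 u) n m j k) * c ≤ 1 * c :=
    mul_le_mul_of_nonneg_right (aS_le_one hnm hjm.le) hc
  linarith

end

open MeasureTheory Filter Topology ProbabilityTheory

noncomputable section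

/-- expectation of `h` of the standardized position over the alive mass -/
def mS (h : ℝ → ℝ) (n m J0 J1 : ℕ) (u : ℝ) (j : ℕ) : ℝ :=
  ∑ k ∈ Finset.range (n + 1), latP (alv n m J0 J1 u) n m j k *
    h (((k : ℝ) - n * j / m) / √(n * (j / m) * (1 - j / m)))

set_option maxHeartbeats 1000000 in
lemma chain_step {h h1 h2 h3 : ℝ → ℝ} (d1 : ∀ z, HasDerivAt h (h1 z) z)
    (d2 : ∀ z, HasDerivAt h1 (h2 z) z) (d3 : ∀ z, HasDerivAt h2 (h3 z) z) {M R lam : ℝ}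
    (hM : 0 ≤ M)
    (hM1 : ∀ z, |z| ≤ R → |h1 z| ≤ M) (hM2 : ∀ z, |z| ≤ R → |h2 z| ≤ M)
    (hM3 : ∀ z, |z| ≤ R → |h3 z| ≤ M) (hode : ∀ z, h2 z - z * h1 z = -2 * lam)
    {n m J0 J1 j : ℕ} {N u v0 ω : ℝ} (hn : 1 ≤ n) (hnm : n ≤ m) (hJ0 : 1 ≤ J0) (hj0 : J0 ≤ j)
    (hj1 : j < J1) (hJ1 : J1 < m)
    (hTN : 1 / ((j / m : ℝ) * (1 - j / m)) ≤ N) (hnN : (n : ℝ) ≤ N) (huN : u ≤ N)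
    (hu : 1 ≤ u) (hN : 1 ≤ N) (hv0 : 1 ≤ v0) (hv : v0 ≤ √(n * (j / m) * (1 - j / m)))
    (hNm : 2 * N ^ 2 * (1 / m) ≤ 1)
    (hR : u + 4 * N ^ 2 * (1 / m) + 2 / v0 ≤ R)
    (hkill : ∀ z, u < |z| → |z| ≤ u + 4 * N ^ 2 * (1 / m) + 2 / v0 → |h z| ≤ ω) :
    |mS h n m J0 J1 u (j + 1) - mS h n m J0 J1 u j +
      lam * ((1 / m) / ((j / m : ℝ) * (1 - j / m))) * aS n m J0 J1 u j| ≤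
    M * ((1 / m) / ((j / m : ℝ) * (1 - j / m)) * (9 * u / √(n * (j / m) * (1 - j / m)))
      + 40 * N ^ 4 * (1 / m) ^ 2) + ω * (aS n m J0 J1 u j - aS n m J0 J1 u (j + 1)) := by
  classical
  have hmpos : (0 : ℝ) < m := by exact_mod_cast (by omega : 0 < m)
  have hnpos : (0 : ℝ) < n := by exact_mod_cast (by omega : 0 < n)
  have hjpos : (0 : ℝ) < j := by exact_mod_cast (by omega : 0 < j)
  have hjm : (j : ℝ) < m := by exact_mod_cast (by omega : j < m)
  set Δ : ℝ := 1 / m with hΔ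
  have hΔpos : 0 < Δ := by positivity
  set t : ℝ := j / m with ht
  have htpos : 0 < t := by positivity
  have ht1 : t < 1 := by rw [ht, div_lt_one hmpos]; exact hjm
  set v := √(n * t * (1 - t)) with hvd
  have hvd' : v = √(n * (t * (1 - t))) := by rw [hvd, mul_assoc]
  have hTpos : 0 < t * (1 - t) := mul_pos htpos (by linarith)
  have hv1 : 1 ≤ v := hv0.trans hv
  have hΔT : Δ ≤ t * (1 - t) / 2 := by
    rw [div_le_iff₀ hTpos] at hTN
    have : 2 * N * Δ ≤ 1 := by
      have : 2 * N * Δ ≤ 2 * N ^ 2 * Δ := by gcongr; nlinarith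
      linarith
    nlinarith [mul_pos hΔpos hTpos]
  have hR' : u + 4 * N ^ 2 * Δ + 2 / v ≤ u + 4 * N ^ 2 * Δ + 2 / v0 := by
    have : 2 / v ≤ 2 / v0 := by gcongr
    linarith
  have ht' : ((j + 1 : ℕ) : ℝ) / m = t + Δ := by rw [ht, hΔ]; push_cast; ring
  set v' := √(n * ((t + Δ) * (1 - (t + Δ)))) with hv'd
  have hal' : ∀ k : ℕ, alv n m J0 J1 u (j + 1) k ↔
      |(k : ℝ) - n * ((j + 1 : ℕ) : ℝ) / m| ≤ u * v' := by
    intro k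
    have e : √(n * (((j + 1 : ℕ) : ℝ) / m) * (1 - ((j + 1 : ℕ) : ℝ) / m)) = v' := by
      rw [ht', hv'd, mul_assoc]
    unfold alv; rw [e]
    constructor
    · intro h; exact h (by omega) (by omega)
    · intro h _ _; exact h
  have hW0 : ∀ k : ℕ, (k : ℝ) - n * ((j + 1 : ℕ) : ℝ) / m = (k : ℝ) - n * j / m - n * Δ := by
    intro k; rw [hΔ]; push_cast; ring
  have hW1 : ∀ k : ℕ, ((k + 1 : ℕ) : ℝ) - n * ((j + 1 : ℕ) : ℝ) / m =
      (k : ℝ) - n * j / m + 1 - n * Δ := by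
    intro k; rw [hΔ]; push_cast; ring
  have hqe : ∀ k : ℕ, latq n m j k = Δ * (n - ((k : ℝ) - n * j / m) / (1 - t)) := by
    intro k
    have : (m : ℝ) - j ≠ 0 := by linarith
    have : 1 - t = (m - j) / m := by rw [ht]; field_simp
    rw [this, latq, hΔ]; field_simp; ring
  set hh : ℕ → ℝ := fun k => h (((k : ℝ) - n * ((j + 1 : ℕ) : ℝ) / m) /
    √(n * (((j + 1 : ℕ) : ℝ) / m) * (1 - ((j + 1 : ℕ) : ℝ) / m))) with hhd
  have hhv : ∀ k, hh k = h (((k : ℝ) - n * ((j + 1 : ℕ) : ℝ) / m) / v') := by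
    intro k
    simp only [hhd]
    rw [ht', hv'd, mul_assoc]
  set al := alv n m J0 J1 u with hald
  set κ : ℕ → ℝ := fun k => (1 - latq n m j k) * (if al (j + 1) k then 0 else 1) +
    latq n m j k * (if al (j + 1) (k + 1) then 0 else 1) with hκ
  have e1 : mS h n m J0 J1 u (j + 1) = ∑ k ∈ Finset.range (n + 1), latP al n m j k *
      ((1 - latq n m j k) * (if al (j + 1) k then hh k else 0) +
        latq n m j k * (if al (j + 1) (k + 1) then hh (k + 1) else 0)) :=
    lat_sum al (by omega) hh
  have e2 : aS n m J0 J1 u j - aS n m J0 J1 u (j + 1) = ∑ k ∈ Finset.range (n + 1),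
      latP al n m j k * κ k := by
    have := lat_sum al (n := n) (m := m) (j := j) (by omega) (fun _ => 1)
    simp only [mul_one] at this
    rw [aS, aS, this, ← Finset.sum_sub_distrib]
    refine Finset.sum_congr rfl fun k _ => ?_
    simp only [hκ]
    split_ifs <;> ring
  set B := M * (Δ / (t * (1 - t)) * (9 * u / v) + 40 * N ^ 4 * Δ ^ 2) with hB
  have hBnn : 0 ≤ B := by positivity
  have main : ∀ k ∈ Finset.range (n + 1), |latP al n m j k *
      ((1 - latq n m j k) * (if al (j + 1) k then hh k else 0) +
        latq n m j k * (if al (j + 1) (k + 1) then hh (k + 1) else 0)) -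
      latP al n m j k * h (((k : ℝ) - n * j / m) / v) + lam * (Δ / (t * (1 - t))) * latP al n m j k|
      ≤ latP al n m j k * B + ω * (latP al n m j k * κ k) := by
    intro k hk
    have hk' : k ≤ n := by rw [Finset.mem_range] at hk; omega
    by_cases hW : |(k : ℝ) - n * j / m| ≤ u * v
    swap
    · have : latP al n m j k = 0 := by
        rw [latP, latA_dead (by omega) (fun h' => hW (h' hj0 hj1.le))]; simp
      rw [this]; simp
    have hq0 : 0 ≤ latq n m j k := by
      rw [latq]
      have : (k : ℝ) ≤ n := by exact_mod_cast hk'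
      exact div_nonneg (by linarith) (by linarith)
    obtain ⟨f1, f2, f3, f4⟩ := one_step d1 d2 d3 hM hM1 hM2 hM3 hode hnpos hΔpos htpos ht1 hΔT hTN hnN
      huN hu hN (hvd' ▸ hW) (hvd' ▸ hv1) hvd' hv'd (hqe k) hq0 (hR'.trans hR)
    set q := latq n m j k with hqd
    have hq1 : q ≤ 1 := f4.trans hNm
    rw [← hW0, ← hhv] at f1
    rw [← hW1, ← hhv] at f1
    rw [← hW0] at f2
    rw [← hW1] at f3
    have hv'pos : 0 < v' := Real.sqrt_pos.2 (by
      have : t + Δ < 1 := by nlinarith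
      exact mul_pos hnpos (mul_pos (by linarith) (by linarith)))
    have kil : ∀ k' : ℕ, |((k' : ℝ) - n * ((j + 1 : ℕ) : ℝ) / m) / v'| ≤ u + 4 * N ^ 2 * Δ + 2 / v →
        |(if al (j + 1) k' then hh k' else 0) - hh k'| ≤ ω * (if al (j + 1) k' then 0 else 1) := by
      intro k' hb
      split_ifs with ha
      · simp
      · rw [hhv, zero_sub, abs_neg, mul_one]
        refine hkill _ ?_ (hb.trans hR')
        rw [hal'] at ha
        rw [abs_div, abs_of_pos hv'pos, lt_div_iff₀ hv'pos]
        exact not_le.1 ha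
    have k0 := kil k f2
    have k1 := kil (k + 1) f3
    have p0 := latP_nonneg al n m j k
    set x0 := (if al (j + 1) k then hh k else 0) with hx0
    set x1 := (if al (j + 1) (k + 1) then hh (k + 1) else 0) with hx1
    have tot : |(1 - q) * x0 + q * x1 - h (((k : ℝ) - n * j / m) / v) + lam * (Δ / (t * (1 - t)))| ≤
        B + ω * κ k := by
      have s0 : |(1 - q) * (x0 - hh k)| ≤ (1 - q) * (ω * (if al (j + 1) k then 0 else 1)) := by
        rw [abs_mul, abs_of_nonneg (by linarith : 0 ≤ 1 - q)]
        exact mul_le_mul_of_nonneg_left k0 (by linarith)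
      have s1 : |q * (x1 - hh (k + 1))| ≤ q * (ω * (if al (j + 1) (k + 1) then 0 else 1)) := by
        rw [abs_mul, abs_of_nonneg hq0]
        exact mul_le_mul_of_nonneg_left k1 hq0
      have eq : (1 - q) * x0 + q * x1 - h (((k : ℝ) - n * j / m) / v) + lam * (Δ / (t * (1 - t))) =
        (1 - q) * (x0 - hh k) + q * (x1 - hh (k + 1)) + ((1 - q) * hh k + q * hh (k + 1) -
          h (((k : ℝ) - n * j / m) / v) + lam * Δ / (t * (1 - t))) := by ring
      have eκ : ω * κ k = (1 - q) * (ω * (if al (j + 1) k then 0 else 1)) +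
          q * (ω * (if al (j + 1) (k + 1) then 0 else 1)) := by simp only [hκ]; ring
      rw [eq, eκ]
      refine (abs_add_le _ _).trans ?_
      have := abs_add_le ((1 - q) * (x0 - hh k)) (q * (x1 - hh (k + 1)))
      linarith
    have eq2 : latP al n m j k * ((1 - q) * x0 + q * x1) -
        latP al n m j k * h (((k : ℝ) - n * j / m) / v) + lam * (Δ / (t * (1 - t))) * latP al n m j k =
        latP al n m j k * ((1 - q) * x0 + q * x1 - h (((k : ℝ) - n * j / m) / v)
          + lam * (Δ / (t * (1 - t)))) := by ring
    rw [eq2, abs_mul, abs_of_nonneg p0]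
    calc _ ≤ latP al n m j k * (B + ω * κ k) := mul_le_mul_of_nonneg_left tot p0
      _ = _ := by ring
  rw [e1, e2, mS, aS, Finset.mul_sum, ← Finset.sum_sub_distrib, ← Finset.sum_add_distrib]
  refine (Finset.abs_sum_le_sum_abs _ _).trans ((Finset.sum_le_sum main).trans ?_)
  rw [Finset.sum_add_distrib, ← Finset.sum_mul, ← Finset.mul_sum]
  have : (∑ k ∈ Finset.range (n + 1), latP al n m j k) * B ≤ B :=
    mul_le_of_le_one_left hBnn (aS_le_one hnm (by omega))
  linarith

end

open MeasureTheory Filter Topology ProbabilityTheory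

noncomputable section

lemma T_near {t Δ s : ℝ} (ht : 0 < t) (ht1 : t < 1) (hT : Δ ≤ t * (1 - t) / 2)
    (hs : s ∈ Set.Icc t (t + Δ)) : |s * (1 - s) - t * (1 - t)| ≤ Δ ∧ 0 < s ∧ s < 1 := by
  have h1 : t * (1 - t) < 1 - t := by nlinarith
  have hs1 : s < 1 := by linarith [hs.2]
  refine ⟨?_, by linarith [hs.1], hs1⟩
  have : s * (1 - s) - t * (1 - t) = (s - t) * (1 - s - t) := by ring
  rw [this, abs_mul, abs_of_nonneg (by linarith [hs.1])]
  have h2 : |1 - s - t| ≤ 1 := by rw [abs_le]; constructor <;> linarith [hs.1]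
  calc _ ≤ (s - t) * 1 := mul_le_mul_of_nonneg_left h2 (by linarith [hs.1])
    _ ≤ Δ := by linarith [hs.2]

/-- antiderivative of `T^{-3/2}/2` -/
def Ffun (s : ℝ) : ℝ := (2 * s - 1) / √(s * (1 - s))

lemma Ffun_deriv {s : ℝ} (h0 : 0 < s) (h1 : s < 1) :
    HasDerivAt Ffun (1 / (2 * ((s * (1 - s)) * √(s * (1 - s))))) s := by
  have hT : 0 < s * (1 - s) := mul_pos h0 (by linarith)
  have hr : 0 < √(s * (1 - s)) := Real.sqrt_pos.2 hT
  have d0 : HasDerivAt (fun s : ℝ => s * (1 - s)) (1 * (1 - s) + s * (0 - 1)) s :=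
    (hasDerivAt_id s).mul ((hasDerivAt_const s (1 : ℝ)).sub (hasDerivAt_id s))
  have d1 := d0.sqrt hT.ne'
  have d2 : HasDerivAt (fun s : ℝ => 2 * s - 1) (2 * 1) s :=
    ((hasDerivAt_id s).const_mul 2).sub_const 1
  refine (d2.div d1 hr.ne').congr_deriv ?_
  have hsq : √(s * (1 - s)) ^ 2 = s * (1 - s) := Real.sq_sqrt hT.le
  set r := √(s * (1 - s)) with hrd
  rw [← hsq]
  field_simp
  rw [hsq]; ring

lemma Ffun_step {t Δ : ℝ} (hΔ : 0 < Δ) (ht : 0 < t) (ht1 : t < 1) (hT : Δ ≤ t * (1 - t) / 2) :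
    Δ / (t * (1 - t)) / √(t * (1 - t)) ≤ 4 * (Ffun (t + Δ) - Ffun t) := by
  obtain ⟨s, hs, he⟩ := exists_hasDerivAt_eq_slope Ffun
    (fun s => 1 / (2 * ((s * (1 - s)) * √(s * (1 - s))))) (by linarith : t < t + Δ)
    (fun s hs => (Ffun_deriv (T_near ht ht1 hT hs).2.1
      (T_near ht ht1 hT hs).2.2).continuousAt.continuousWithinAt)
    (fun s hs => (Ffun_deriv (T_near ht ht1 hT (Set.Ioo_subset_Icc_self hs)).2.1
      (T_near ht ht1 hT (Set.Ioo_subset_Icc_self hs)).2.2))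
  obtain ⟨n1, n2, n3⟩ := T_near ht ht1 hT (Set.Ioo_subset_Icc_self hs)
  have hTp : 0 < t * (1 - t) := mul_pos ht (by linarith)
  have hSp : 0 < s * (1 - s) := mul_pos n2 (by linarith)
  set T := t * (1 - t)
  set S := s * (1 - s)
  have hST : S ≤ 3 / 2 * T := by linarith [(abs_le.1 n1).2]
  have e : Ffun (t + Δ) - Ffun t = Δ * (1 / (2 * (S * √S))) := by
    rw [he, add_sub_cancel_left]; field_simp
  rw [e]
  have hsT : 0 < √T := Real.sqrt_pos.2 hTp
  have hsS : 0 < √S := Real.sqrt_pos.2 hSp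
  have hsq : √S ≤ 4 / 3 * √T := by
    rw [Real.sqrt_le_left (by positivity), mul_pow, Real.sq_sqrt hTp.le]
    linarith
  have h2 : S * √S ≤ 2 * (T * √T) := by
    calc S * √S ≤ (3 / 2 * T) * (4 / 3 * √T) := by gcongr
      _ = _ := by ring
  rw [div_div, show 4 * (Δ * (1 / (2 * (S * √S)))) = Δ * 2 / (S * √S) by field_simp; norm_num]
  rw [div_le_div_iff₀ (by positivity) (by positivity)]
  nlinarith

lemma Ffun_abs {t : ℝ} (ht : 0 < t) (ht1 : t < 1) : |Ffun t| ≤ 1 / √(t * (1 - t)) := by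
  have hTp : 0 < t * (1 - t) := mul_pos ht (by linarith)
  rw [Ffun, abs_div, abs_of_pos (Real.sqrt_pos.2 hTp)]
  gcongr
  rw [abs_le]; constructor <;> linarith

/-- logit -/
def logit (s : ℝ) : ℝ := Real.log s - Real.log (1 - s)

lemma logit_step {t Δ : ℝ} (hΔ : 0 < Δ) (ht : 0 < t) (ht1 : t < 1) (hT : Δ ≤ t * (1 - t) / 2) :
    |logit (t + Δ) - logit t - Δ / (t * (1 - t))| ≤ 2 * (Δ / (t * (1 - t))) ^ 2 := by
  have hd : ∀ s, 0 < s → s < 1 → HasDerivAt logit (1 / (s * (1 - s))) s := by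
    intro s h0 h1
    have d1 := Real.hasDerivAt_log h0.ne'
    have d2 : HasDerivAt (fun s : ℝ => Real.log (1 - s)) ((0 - 1) / (1 - s)) s :=
      ((hasDerivAt_const s (1 : ℝ)).sub (hasDerivAt_id s)).log (by simp; linarith)
    refine (d1.sub d2).congr_deriv ?_
    have : 1 - s ≠ 0 := by linarith
    field_simp; ring
  obtain ⟨s, hs, he⟩ := exists_hasDerivAt_eq_slope logit
    (fun s => 1 / (s * (1 - s))) (by linarith : t < t + Δ)
    (fun s hs => (hd s (T_near ht ht1 hT hs).2.1
      (T_near ht ht1 hT hs).2.2).continuousAt.continuousWithinAt)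
    (fun s hs => (hd s (T_near ht ht1 hT (Set.Ioo_subset_Icc_self hs)).2.1
      (T_near ht ht1 hT (Set.Ioo_subset_Icc_self hs)).2.2))
  obtain ⟨n1, n2, n3⟩ := T_near ht ht1 hT (Set.Ioo_subset_Icc_self hs)
  have hTp : 0 < t * (1 - t) := mul_pos ht (by linarith)
  have hSp : 0 < s * (1 - s) := mul_pos n2 (by linarith)
  set T := t * (1 - t)
  set S := s * (1 - s)
  have hST : T / 2 ≤ S := by linarith [(abs_le.1 n1).1]
  have e : logit (t + Δ) - logit t = Δ * (1 / S) := by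
    rw [he, add_sub_cancel_left]; field_simp
  have e2 : Δ * (1 / S) - Δ / T = Δ / T * ((T - S) / S) := by field_simp
  rw [e, e2, abs_mul, abs_of_pos (by positivity : 0 < Δ / T), abs_div, abs_of_pos hSp]
  have : |T - S| / S ≤ 2 * (Δ / T) := by
    rw [abs_sub_comm]
    calc |S - T| / S ≤ Δ / (T / 2) := by gcongr
      _ = _ := by field_simp
  calc Δ / T * (|T - S| / S) ≤ Δ / T * (2 * (Δ / T)) := by gcongr
    _ = _ := by ring

/-- the intensity sum -/
def sigS (m J0 J1 : ℕ) : ℝ := ∑ i ∈ Finset.range (J1 - J0),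
  (1 / m : ℝ) / ((((J0 + i : ℕ) : ℝ) / m) * (1 - ((J0 + i : ℕ) : ℝ) / m))

lemma sigS_logit {m J0 J1 : ℕ} {N : ℝ} (hJ0 : 1 ≤ J0) (hJ : J0 ≤ J1) (hJ1 : J1 < m)
    (hN : 1 ≤ N) (hNm : 2 * N ^ 2 * (1 / m) ≤ 1)
    (hTN : ∀ j : ℕ, J0 ≤ j → j ≤ J1 → 1 / ((j / m : ℝ) * (1 - j / m)) ≤ N) :
    |logit (J1 / m) - logit (J0 / m) - sigS m J0 J1| ≤ 2 * N ^ 2 * (1 / m) := by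
  have hmpos : (0 : ℝ) < m := by exact_mod_cast (by omega : 0 < m)
  set Δ : ℝ := 1 / m with hΔ
  have hΔpos : 0 < Δ := by positivity
  have tel : logit (J1 / m) - logit (J0 / m) = ∑ i ∈ Finset.range (J1 - J0),
      (logit (((J0 + i + 1 : ℕ) : ℝ) / m) - logit (((J0 + i : ℕ) : ℝ) / m)) := by
    have := Finset.sum_range_sub (fun i => logit (((J0 + i : ℕ) : ℝ) / m)) (J1 - J0)
    simp only [Nat.add_sub_cancel' hJ, add_zero] at this
    rw [← this]; rfl
  rw [tel, sigS, ← Finset.sum_sub_distrib]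
  have hb : ∀ i ∈ Finset.range (J1 - J0), |(logit (((J0 + i + 1 : ℕ) : ℝ) / m) -
      logit (((J0 + i : ℕ) : ℝ) / m)) -
      Δ / ((((J0 + i : ℕ) : ℝ) / m) * (1 - ((J0 + i : ℕ) : ℝ) / m))| ≤ 2 * (N * Δ) ^ 2 := by
    intro i hi
    rw [Finset.mem_range] at hi
    have hTN' := hTN (J0 + i) (by omega) (by omega)
    have ht : (0 : ℝ) < ((J0 + i : ℕ) : ℝ) / m := by
      have : (0 : ℝ) < ((J0 + i : ℕ) : ℝ) := by exact_mod_cast (by omega : 0 < J0 + i)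
      positivity
    have ht1 : ((J0 + i : ℕ) : ℝ) / m < 1 := by
      rw [div_lt_one hmpos]; exact_mod_cast (by omega : J0 + i < m)
    have e : ((J0 + i + 1 : ℕ) : ℝ) / m = ((J0 + i : ℕ) : ℝ) / m + Δ := by
      rw [hΔ]; push_cast; ring
    rw [e]
    set t := ((J0 + i : ℕ) : ℝ) / m
    have hTpos : 0 < t * (1 - t) := mul_pos ht (by linarith)
    have hΔT' : Δ / (t * (1 - t)) ≤ N * Δ := by
      calc Δ / (t * (1 - t)) = 1 / (t * (1 - t)) * Δ := by ring
        _ ≤ _ := by gcongr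
    have hΔT : Δ ≤ t * (1 - t) / 2 := by
      have h1 : N * Δ ≤ 1 / 2 := by
        have : N * Δ ≤ N ^ 2 * Δ := by gcongr; nlinarith
        linarith
      have := hΔT'.trans h1
      rw [div_le_iff₀ hTpos] at this; linarith
    refine (logit_step hΔpos ht ht1 hΔT).trans ?_
    gcongr
  refine (Finset.abs_sum_le_sum_abs _ _).trans ((Finset.sum_le_sum hb).trans ?_)
  rw [Finset.sum_const, Finset.card_range, nsmul_eq_mul]
  have : ((J1 - J0 : ℕ) : ℝ) * Δ ≤ 1 := by
    rw [hΔ, mul_one_div, div_le_one hmpos]; exact_mod_cast (by omega : J1 - J0 ≤ m)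
  calc ((J1 - J0 : ℕ) : ℝ) * (2 * (N * Δ) ^ 2) = (((J1 - J0 : ℕ) : ℝ) * Δ) * (2 * N ^ 2 * Δ) := by ring
    _ ≤ 1 * (2 * N ^ 2 * Δ) := by gcongr
    _ = _ := by ring

end

open MeasureTheory Filter Topology ProbabilityTheory

noncomputable section

lemma sum_F {n m J0 J1 : ℕ} {N v0 : ℝ} (hn : 1 ≤ n) (hJ0 : 1 ≤ J0) (hJ : J0 ≤ J1) (hJ1 : J1 < m)
    (hN : 1 ≤ N) (hNm : 2 * N ^ 2 * (1 / m) ≤ 1) (hv0 : 1 ≤ v0)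
    (hTN : ∀ j : ℕ, J0 ≤ j → j ≤ J1 → 1 / ((j / m : ℝ) * (1 - j / m)) ≤ N)
    (hv : ∀ j : ℕ, J0 ≤ j → j ≤ J1 → v0 ≤ √(n * (j / m) * (1 - j / m))) :
    ∑ i ∈ Finset.range (J1 - J0), (1 / m : ℝ) / ((((J0 + i : ℕ) : ℝ) / m) *
      (1 - ((J0 + i : ℕ) : ℝ) / m)) / √(n * (((J0 + i : ℕ) : ℝ) / m) * (1 - ((J0 + i : ℕ) : ℝ) / m))
      ≤ 8 / v0 := by
  have hmpos : (0 : ℝ) < m := by exact_mod_cast (by omega : 0 < m)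
  have hnpos : (0 : ℝ) < n := by exact_mod_cast (by omega : 0 < n)
  set Δ : ℝ := 1 / m with hΔ
  have hΔpos : 0 < Δ := by positivity
  have hsn : 0 < √(n : ℝ) := Real.sqrt_pos.2 hnpos
  have pos : ∀ j : ℕ, J0 ≤ j → j ≤ J1 → (0 : ℝ) < j / m ∧ (j / m : ℝ) < 1 := by
    intro j h0 h1
    have : (0 : ℝ) < j := by exact_mod_cast (by omega : 0 < j)
    refine ⟨by positivity, ?_⟩
    rw [div_lt_one hmpos]; exact_mod_cast (by omega : j < m)
  have hFb : ∀ j : ℕ, J0 ≤ j → j ≤ J1 → |Ffun (j / m)| ≤ √(n : ℝ) / v0 := by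
    intro j h0 h1
    obtain ⟨p0, p1⟩ := pos j h0 h1
    have hTpos : 0 < (j / m : ℝ) * (1 - j / m) := mul_pos p0 (by linarith)
    refine (Ffun_abs p0 p1).trans ?_
    have := hv j h0 h1
    rw [mul_assoc, Real.sqrt_mul hnpos.le] at this
    rw [div_le_div_iff₀ (Real.sqrt_pos.2 hTpos) (by linarith)]
    linarith
  have hb : ∀ i ∈ Finset.range (J1 - J0), Δ / ((((J0 + i : ℕ) : ℝ) / m) *
      (1 - ((J0 + i : ℕ) : ℝ) / m)) / √(n * (((J0 + i : ℕ) : ℝ) / m) * (1 - ((J0 + i : ℕ) : ℝ) / m))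
      ≤ 4 / √(n : ℝ) * (Ffun (((J0 + (i + 1) : ℕ) : ℝ) / m) - Ffun (((J0 + i : ℕ) : ℝ) / m)) := by
    intro i hi
    rw [Finset.mem_range] at hi
    have hTN' := hTN (J0 + i) (by omega) (by omega)
    obtain ⟨ht, ht1⟩ := pos (J0 + i) (by omega) (by omega)
    have e : ((J0 + (i + 1) : ℕ) : ℝ) / m = ((J0 + i : ℕ) : ℝ) / m + Δ := by
      rw [hΔ]; push_cast; ring
    rw [e]
    set t := ((J0 + i : ℕ) : ℝ) / m
    have hTpos : 0 < t * (1 - t) := mul_pos ht (by linarith)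
    have hΔT' : Δ / (t * (1 - t)) ≤ N * Δ := by
      calc Δ / (t * (1 - t)) = 1 / (t * (1 - t)) * Δ := by ring
        _ ≤ _ := by gcongr
    have hΔT : Δ ≤ t * (1 - t) / 2 := by
      have h1 : N * Δ ≤ 1 / 2 := by
        have : N * Δ ≤ N ^ 2 * Δ := by gcongr; nlinarith
        linarith
      have := hΔT'.trans h1
      rw [div_le_iff₀ hTpos] at this; linarith
    have := Ffun_step hΔpos ht ht1 hΔT
    rw [mul_assoc, Real.sqrt_mul hnpos.le, mul_comm √(n : ℝ), ← div_div, div_le_iff₀ hsn]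
    refine this.trans (le_of_eq ?_)
    field_simp
  refine (Finset.sum_le_sum hb).trans ?_
  rw [← Finset.mul_sum, Finset.sum_range_sub (fun i => Ffun (((J0 + i : ℕ) : ℝ) / m))]
  simp only [Nat.add_sub_cancel' hJ, add_zero]
  have b1 := (abs_le.1 (hFb J1 hJ le_rfl)).2
  have b0 := (abs_le.1 (hFb J0 le_rfl hJ)).1
  calc 4 / √(n : ℝ) * (Ffun (J1 / m) - Ffun (J0 / m)) ≤ 4 / √(n : ℝ) * (2 * (√(n : ℝ) / v0)) := by
        gcongr; linarith
    _ = _ := by field_simp; norm_num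

set_option maxHeartbeats 1000000 in
lemma null_finite {n m J0 J1 : ℕ} {M N u v0 : ℝ} (hgu : 1 ≤ gg u) (hM : 0 ≤ M)
    (hb : ∀ z, |z| ≤ u + 1 / u → |gw z| ≤ M * gg u ∧ |1 + z * gw z| ≤ M * gg u ∧
      |gw z + z * (1 + z * gw z)| ≤ M * gg u)
    (hn : 1 ≤ n) (hnm : n ≤ m) (hJ0 : 1 ≤ J0) (hJ : J0 ≤ J1) (hJ1 : J1 < m)
    (hnN : (n : ℝ) ≤ N) (huN : u ≤ N)
    (hu : 1 ≤ u) (hN : 1 ≤ N) (hv0 : 1 ≤ v0) 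
    (hNm : 2 * N ^ 2 * (1 / m) ≤ 1)
    (hR : 4 * N ^ 2 * (1 / m) + 2 / v0 ≤ 1 / u)
    (hTN : ∀ j : ℕ, J0 ≤ j → j ≤ J1 → 1 / ((j / m : ℝ) * (1 - j / m)) ≤ N)
    (hv : ∀ j : ℕ, J0 ≤ j → j ≤ J1 → v0 ≤ √(n * (j / m) * (1 - j / m))) :
    (latA (alv n m J0 J1 u) m n : ℝ) / (m.choose n : ℝ) ≤
      Real.exp (-(1 / (2 * gg u) * sigS m J0 J1)) + (72 * M * u / v0 + 40 * M * N ^ 4 * (1 / m)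
        + M * (4 * N ^ 2 * (1 / m) + 2 / v0)) + (gg (u / 2) / gg u + 4 / u ^ 2) ∧
    (1 - 1 / u ^ 2) * Real.exp (-(1 / (2 * gg u) * sigS m J0 J1 * (1 + N * (1 / m))))
      - (72 * M * u / v0 + 40 * M * N ^ 4 * (1 / m)
        + M * (4 * N ^ 2 * (1 / m) + 2 / v0)) - (gg (u / 2) / gg u + 4 / u ^ 2) ≤
      (latA (alv n m J0 J1 u) m n : ℝ) / (m.choose n : ℝ) := by
  rw [aS_end hJ1.le]
  have hgpos : 0 < gg u := by linarith
  set h : ℝ → ℝ := fun z => 1 - gg z / gg u with hh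
  set lam : ℝ := 1 / (2 * gg u) with hlam
  have d1 : ∀ z, HasDerivAt h (-(gw z) / gg u) z := fun z =>
    (((hasDerivAt_const z (1 : ℝ)).sub ((gg_deriv z).div_const (gg u)))).congr_deriv (by ring)
  have d2 : ∀ z, HasDerivAt (fun z => -(gw z) / gg u) (-(1 + z * gw z) / gg u) z := fun z =>
    ((gw_deriv z).neg.div_const (gg u))
  have d3 : ∀ z, HasDerivAt (fun z => -(1 + z * gw z) / gg u)
      (-(gw z + z * (1 + z * gw z)) / gg u) z := fun z =>
    ((((hasDerivAt_id z).mul (gw_deriv z)).const_add 1).neg.div_const (gg u)).congr_deriv (by simp)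
  have bd : ∀ x : ℝ, |x| ≤ M * gg u → |-x / gg u| ≤ M := by
    intro x hx
    rw [abs_div, abs_neg, abs_of_pos hgpos, div_le_iff₀ hgpos]; exact hx
  have hM1 : ∀ z, |z| ≤ u + 1 / u → |-(gw z) / gg u| ≤ M := fun z hz => bd _ (hb z hz).1
  have hM2 : ∀ z, |z| ≤ u + 1 / u → |-(1 + z * gw z) / gg u| ≤ M := fun z hz => bd _ (hb z hz).2.1
  have hM3 : ∀ z, |z| ≤ u + 1 / u → |-(gw z + z * (1 + z * gw z)) / gg u| ≤ M :=
    fun z hz => bd _ (hb z hz).2.2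
  have hode : ∀ z, -(1 + z * gw z) / gg u - z * (-(gw z) / gg u) = -2 * lam := by
    intro z; rw [hlam]; field_simp; ring
  have hmpos : (0 : ℝ) < m := by exact_mod_cast (by omega : 0 < m)
  set Δ : ℝ := 1 / m with hΔ
  have hΔpos : 0 < Δ := by positivity
  have upos : 0 < u := by linarith
  set ω := M * (4 * N ^ 2 * Δ + 2 / v0) with hω
  have hωnn : 0 ≤ ω := by positivity
  have hu0 : |u| ≤ u + 1 / u := by
    rw [abs_of_pos upos]; have : 0 < 1 / u := by positivity
    linarith
  have habs : ∀ z, h |z| = h z := fun z => by simp only [hh, gg_abs]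
  have hkill : ∀ z, u < |z| → |z| ≤ u + 4 * N ^ 2 * Δ + 2 / v0 → |h z| ≤ ω := by
    intro z h1 h2
    have t1 := tay1 d1 hM1 hu0 (show |(|z|)| ≤ u + 1 / u by rw [abs_abs]; linarith)
    have : h u = 0 := by simp only [hh]; rw [div_self hgpos.ne']; ring
    rw [this, sub_zero, habs] at t1
    refine t1.trans (mul_le_mul_of_nonneg_left ?_ hM)
    rw [abs_of_pos (by linarith)]; linarith
  have hR' : u + 4 * N ^ 2 * Δ + 2 / v0 ≤ u + 1 / u := by linarith
  -- sequences
  set K := J1 - J0 with hK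
  set aa : ℕ → ℝ := fun i => aS n m J0 J1 u (J0 + i) with haa
  set mm : ℕ → ℝ := fun i => mS h n m J0 J1 u (J0 + i) with hmm
  set σ : ℕ → ℝ := fun i => Δ / ((((J0 + i : ℕ) : ℝ) / m) * (1 - ((J0 + i : ℕ) : ℝ) / m)) with hσ
  set e : ℕ → ℝ := fun i => mm (i + 1) - mm i + lam * σ i * aa i with he
  set ρ := gg (u / 2) / gg u + 4 / u ^ 2 with hρ
  have hlampos : 0 < lam := by positivity
  have hlam1 : lam ≤ 1 / 2 := by
    rw [hlam]; apply one_div_le_one_div_of_le <;> linarith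
  have hσpos : ∀ i < K, 0 < σ i := by
    intro i hi
    have h0 : (0 : ℝ) < ((J0 + i : ℕ) : ℝ) := by exact_mod_cast (by omega : 0 < J0 + i)
    have h1 : ((J0 + i : ℕ) : ℝ) / m < 1 := by
      rw [div_lt_one hmpos]; exact_mod_cast (by omega : J0 + i < m)
    simp only [hσ]
    exact div_pos hΔpos (mul_pos (by positivity) (by linarith))
  have hσN : ∀ i < K, σ i ≤ N * Δ := by
    intro i hi
    have := hTN (J0 + i) (by omega) (by omega)
    simp only [hσ]
    rw [div_eq_mul_one_div, mul_comm]
    gcongr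
  have hNΔ : N * Δ ≤ 1 / 2 := by
    have : N * Δ ≤ N ^ 2 * Δ := by gcongr; nlinarith
    linarith
  -- relation between `mS` and `aS`
  have zle : ∀ j, J0 ≤ j → j ≤ J1 → ∀ (k : ℕ) (w : ℝ),
      |(k : ℝ) - n * j / m| ≤ w * √(n * (j / m) * (1 - j / m)) →
      |((k : ℝ) - n * j / m) / √(n * (j / m) * (1 - j / m))| ≤ w := by
    intro j h0 h1 k w hw
    have : 0 < √(n * (j / m : ℝ) * (1 - j / m)) := by linarith [hv j h0 h1]
    rw [abs_div, abs_of_pos this, div_le_iff₀ this]; exact hw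
  have hsub : ∀ j, aS n m J0 J1 u j - mS h n m J0 J1 u j = ∑ k ∈ Finset.range (n + 1),
      latP (alv n m J0 J1 u) n m j k *
      (gg (((k : ℝ) - n * j / m) / √(n * (j / m) * (1 - j / m))) / gg u) := by
    intro j
    rw [aS, mS, ← Finset.sum_sub_distrib]
    refine Finset.sum_congr rfl fun k _ => ?_
    simp only [hh]; ring
  have hle : ∀ i ≤ K, mm i ≤ aa i := by
    intro i hi
    rw [← sub_nonneg]
    simp only [haa, hmm]
    rw [hsub]
    exact Finset.sum_nonneg fun k _ => mul_nonneg (latP_nonneg _ _ _ _ _)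
      (div_nonneg (gg_nonneg _) hgpos.le)
  have hge : ∀ i ≤ K, aa i ≤ mm i + ρ := by
    intro i hi
    rw [← sub_le_iff_le_add']
    simp only [haa, hmm]
    rw [hsub]
    refine aS_sub_le hn hnm hJ0 (by omega) (by omega) (by omega) upos
      (div_nonneg (gg_nonneg _) hgpos.le) ?_ ?_
    · intro k hk
      rw [div_le_one hgpos]
      exact gg_le_of_abs_le (zle _ (by omega) (by omega) k u hk)
    · intro k hk
      exact div_le_div_of_nonneg_right
        (gg_le_of_abs_le (zle _ (by omega) (by omega) k _ hk)) hgpos.le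
  have hrec : ∀ i < K, mm (i + 1) = mm i - (lam * σ i) * aa i + e i := by
    intro i _; simp only [he]; ring
  have heb : ∀ i < K, |e i| ≤ M * (σ i * (9 * u / √(n * (((J0 + i : ℕ) : ℝ) / m) *
      (1 - ((J0 + i : ℕ) : ℝ) / m))) + 40 * N ^ 4 * Δ ^ 2) + ω * (aa i - aa (i + 1)) := by
    intro i hi
    have a1 : J0 ≤ J0 + i := Nat.le_add_right _ _
    have a2 : J0 + i < J1 := by omega
    have := chain_step (j := J0 + i) d1 d2 d3 hM hM1 hM2 hM3 hode hn hnm hJ0 a1 a2 hJ1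
      (hTN (J0 + i) a1 a2.le) hnN huN hu hN hv0 (hv (J0 + i) a1 a2.le) hNm hR' hkill
    exact this
  have hG := gron (mm := mm) (aa := aa) (s := fun i => lam * σ i) (e := e) (K := K) (ρ := ρ) hrec hle hge
    (fun i hi => (mul_pos hlampos (hσpos i hi)).le)
    (fun i hi => by
      have := hσN i hi
      have := hσpos i hi
      nlinarith)
    (aS_le_one hnm (by omega)) (aS_nonneg _)
  have hE : ∑ i ∈ Finset.range K, |e i| ≤ 72 * M * u / v0 + 40 * M * N ^ 4 * Δ + ω := by
    refine (Finset.sum_le_sum fun i hi => heb i (Finset.mem_range.1 hi)).trans ?_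
    rw [Finset.sum_add_distrib, ← Finset.mul_sum, ← Finset.mul_sum, Finset.sum_add_distrib,
      Finset.sum_range_sub', Finset.sum_const, Finset.card_range, nsmul_eq_mul]
    have s1 : ∑ i ∈ Finset.range K, σ i * (9 * u / √(n * (((J0 + i : ℕ) : ℝ) / m) *
      (1 - ((J0 + i : ℕ) : ℝ) / m))) ≤ 9 * u * (8 / v0) := by
      have := sum_F hn hJ0 hJ hJ1 hN hNm hv0 hTN hv
      calc _ = 9 * u * ∑ i ∈ Finset.range (J1 - J0), (1 / m : ℝ) / ((((J0 + i : ℕ) : ℝ) / m) *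
            (1 - ((J0 + i : ℕ) : ℝ) / m)) /
            √(n * (((J0 + i : ℕ) : ℝ) / m) * (1 - ((J0 + i : ℕ) : ℝ) / m)) := by
            rw [Finset.mul_sum]
            refine Finset.sum_congr rfl fun i _ => ?_
            simp only [hσ]; ring
        _ ≤ _ := by gcongr
    have s2 : (K : ℝ) * (40 * N ^ 4 * Δ ^ 2) ≤ 40 * N ^ 4 * Δ := by
      have : (K : ℝ) * Δ ≤ 1 := by
        rw [hΔ, mul_one_div, div_le_one hmpos]; exact_mod_cast (by omega : K ≤ m)
      calc (K : ℝ) * (40 * N ^ 4 * Δ ^ 2) = ((K : ℝ) * Δ) * (40 * N ^ 4 * Δ) := by ring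
        _ ≤ 1 * (40 * N ^ 4 * Δ) := by gcongr
        _ = _ := by ring
    have s3 : aa 0 - aa K ≤ 1 := by
      have h1 : aa 0 ≤ 1 := aS_le_one hnm (by omega)
      have h2 : 0 ≤ aa K := aS_nonneg _
      linarith
    have s4 := mul_le_mul_of_nonneg_left s3 hωnn
    have s5 := mul_le_mul_of_nonneg_left (add_le_add s1 s2) hM
    refine (add_le_add s5 s4).trans (le_of_eq ?_)
    ring
  have hS : ∑ i ∈ Finset.range K, lam * σ i = lam * sigS m J0 J1 := by
    rw [← Finset.mul_sum]; rfl
  have hS2 : ∑ i ∈ Finset.range K, (lam * σ i + (lam * σ i) ^ 2) ≤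
      lam * sigS m J0 J1 * (1 + N * Δ) := by
    rw [← hS, Finset.sum_mul]
    refine Finset.sum_le_sum fun i hi => ?_
    have h1 := hσN i (Finset.mem_range.1 hi)
    have h2 := hσpos i (Finset.mem_range.1 hi)
    have h3 : lam * σ i ≤ N * Δ := by nlinarith
    have h4 : 0 ≤ lam * σ i := by positivity
    nlinarith
  have haK : aa K = aS n m J0 J1 u J1 := by simp only [haa, hK]; rw [Nat.add_sub_cancel' hJ]
  rw [haK] at hG
  constructor
  · have := hG.1
    rw [hS] at this
    linarith
  · have h1 := hG.2
    have h2 : 1 - 1 / u ^ 2 ≤ aa 0 := aS_start hn hnm hJ0 hJ (by omega) upos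
    have h3 : Real.exp (-(lam * sigS m J0 J1 * (1 + N * Δ))) ≤
        Real.exp (-∑ i ∈ Finset.range K, (lam * σ i + (lam * σ i) ^ 2)) :=
      Real.exp_le_exp.2 (by linarith)
    have h4 : (1 - 1 / u ^ 2) * Real.exp (-(lam * sigS m J0 J1 * (1 + N * Δ))) ≤
        aa 0 * Real.exp (-∑ i ∈ Finset.range K, (lam * σ i + (lam * σ i) ^ 2)) := by
      refine mul_le_mul h2 h3 (Real.exp_pos _).le (aS_nonneg _)
    linarith

end

open MeasureTheory Filter Topology ProbabilityTheory

noncomputable section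

/-- iterated logarithm -/
def LL (n : ℕ) : ℝ := Real.log (Real.log n)
/-- critical value -/
def uu (x : ℝ) (n : ℕ) : ℝ := (bHC n + x) / aHC n
/-- fourth root of the iterated logarithm -/
def ss (n : ℕ) : ℝ := √√(LL n)
/-- the cut-off level -/
def S0 (n : ℕ) : ℝ := Real.exp (ss n)
/-- grid size -/
def mg (n : ℕ) : ℕ := n ^ 30
/-- first grid index -/
def JJ (n : ℕ) : ℕ := ⌈(mg n : ℝ) * S0 n / n⌉₊

lemma LL_tendsto : Tendsto LL atTop atTop :=
  Real.tendsto_log_atTop.comp (Real.tendsto_log_atTop.comp tendsto_natCast_atTop_atTop)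

lemma uu_eq (x : ℝ) (n : ℕ) : uu x n =
    (2 * LL n + ((1 / 2) * Real.log (LL n) - (1 / 2) * Real.log Real.pi + x)) / √(2 * LL n) := by
  rw [uu, bHC, aHC, LL]; ring

lemma log_div_sqrt (k : ℝ) : Tendsto (fun L : ℝ => ((1 / 2) * Real.log L + k) / √L) atTop (𝓝 0) := by
  have h1 : Tendsto (fun L : ℝ => Real.log L / √L) atTop (𝓝 0) := by
    have := (isLittleO_log_rpow_atTop (r := 1 / 2) (by norm_num)).tendsto_div_nhds_zero
    refine this.congr fun L => ?_
    rw [Real.sqrt_eq_rpow]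
  have h2 : Tendsto (fun L : ℝ => k / √L) atTop (𝓝 0) :=
    tendsto_const_nhds.div_atTop Real.tendsto_sqrt_atTop
  have := (h1.const_mul (1 / 2)).add h2
  simp only [mul_zero, add_zero] at this
  refine this.congr fun L => ?_
  ring

lemma uL_lim (x : ℝ) : Tendsto (fun L : ℝ =>
    ((2 * L + ((1 / 2) * Real.log L - (1 / 2) * Real.log Real.pi + x)) / √(2 * L)) *
    Real.exp (-(((2 * L + ((1 / 2) * Real.log L - (1 / 2) * Real.log Real.pi + x)) / √(2 * L)) ^ 2 / 2))
      * Real.exp L) atTop (𝓝 (√(2 * Real.pi) * Real.exp (-x))) := by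
  have hk := log_div_sqrt (-((1 / 2) * Real.log Real.pi) + x)
  have h1 : Tendsto (fun L : ℝ => (1 + ((1 / 2) * Real.log L + (-((1 / 2) * Real.log Real.pi) + x)) / √L
      * (1 / √L) / 2) * Real.exp (-((((1 / 2) * Real.log L + (-((1 / 2) * Real.log Real.pi) + x)) / √L) ^ 2 / 4))
      * (√(2 * Real.pi) * Real.exp (-x))) atTop
      (𝓝 ((1 + 0 * 0 / 2) * Real.exp (-(0 ^ 2 / 4)) * (√(2 * Real.pi) * Real.exp (-x)))) := by
    refine Tendsto.mul (Tendsto.mul (Tendsto.const_add _ ((hk.mul ?_).div_const _)) ?_) tendsto_const_nhds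
    · exact tendsto_const_nhds.div_atTop Real.tendsto_sqrt_atTop
    · exact (Real.continuous_exp.tendsto _).comp (((hk.pow 2).div_const 4).neg)
  have h2 : (1 + 0 * 0 / 2) * Real.exp (-(0 ^ 2 / 4)) * (√(2 * Real.pi) * Real.exp (-x)) =
    √(2 * Real.pi) * Real.exp (-x) := by norm_num
  rw [h2] at h1
  refine h1.congr' ?_
  filter_upwards [eventually_ge_atTop 1] with L hL
  have hL0 : 0 < L := by linarith
  have hs : 0 < √L := Real.sqrt_pos.2 hL0
  have hs2 : √L ^ 2 = L := Real.sq_sqrt hL0.le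
  set c := (1 / 2) * Real.log L - (1 / 2) * Real.log Real.pi + x with hc
  have hc' : (1 / 2) * Real.log L + (-((1 / 2) * Real.log Real.pi) + x) = c := by rw [hc]; ring
  rw [hc']
  have e1 : ((2 * L + c) / √(2 * L)) ^ 2 / 2 = L + c + (c / √L) ^ 2 / 4 := by
    rw [div_pow, div_pow, Real.sq_sqrt (by linarith), Real.sq_sqrt hL0.le]
    field_simp; ring
  rw [e1]
  have e2 : Real.exp (-(L + c + (c / √L) ^ 2 / 4)) * Real.exp L =
      Real.exp (-((c / √L) ^ 2 / 4)) * (Real.exp (-x) * (√Real.pi / √L)) := by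
    have p1 : √Real.pi / √L = Real.exp ((1 / 2) * Real.log Real.pi - (1 / 2) * Real.log L) := by
      rw [Real.exp_sub, Real.sqrt_eq_rpow, Real.sqrt_eq_rpow, Real.rpow_def_of_pos Real.pi_pos,
        Real.rpow_def_of_pos hL0, mul_comm (1 / 2 : ℝ), mul_comm (1 / 2 : ℝ)]
    rw [p1, ← Real.exp_add, ← Real.exp_add, ← Real.exp_add]
    congr 1
    rw [hc]; ring
  rw [mul_assoc, mul_assoc, e2, Real.sqrt_mul (by norm_num), Real.sqrt_mul (by norm_num)]
  have hs2' : (0:ℝ) < √2 := Real.sqrt_pos.2 (by norm_num)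
  have h22 : √2 ^ 2 = (2:ℝ) := Real.sq_sqrt (by norm_num)
  have e3 : (1 + c / √L * (1 / √L) / 2) = (2 * L + c) / (2 * L) := by
    rw [div_mul_div_comm, ← sq, hs2]; field_simp
  rw [e3]
  have e4 : (2 * L + c) / (2 * L) * √2 = (2 * L + c) / (√2 * √L) / √L := by
    rw [div_div, mul_assoc, ← sq, hs2]
    field_simp
    linear_combination (2 * L + c) * h22
  calc _ = ((2 * L + c) / (2 * L) * √2) * √Real.pi * Real.exp (-(c / √L) ^ 2 / 4) * Real.exp (-x) := by
        rw [show -((c / √L) ^ 2 / 4) = -(c / √L) ^ 2 / 4 by ring]; ring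
    _ = _ := by
        rw [e4, show -((c / √L) ^ 2 / 4) = -(c / √L) ^ 2 / 4 by ring]; ring

lemma log_tendsto : Tendsto (fun n : ℕ => Real.log n) atTop atTop :=
  Real.tendsto_log_atTop.comp tendsto_natCast_atTop_atTop

lemma uu_lim (x : ℝ) : Tendsto (fun n => uu x n * Real.exp (-(uu x n ^ 2 / 2)) * Real.log n) atTop
    (𝓝 (√(2 * Real.pi) * Real.exp (-x))) := by
  refine ((uL_lim x).comp LL_tendsto).congr' ?_
  filter_upwards [log_tendsto.eventually_gt_atTop 0] with n hn
  simp only [Function.comp_apply]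
  rw [← uu_eq, LL, Real.exp_log hn]

lemma uu_bd (x : ℝ) : ∀ᶠ n : ℕ in atTop, √(LL n) ≤ uu x n ∧ uu x n ≤ 3 * √(LL n) := by
  have hk := log_div_sqrt (-((1 / 2) * Real.log Real.pi) + x)
  have h1 := (hk.comp LL_tendsto).eventually (Metric.ball_mem_nhds 0 (show (0:ℝ) < 1/4 by norm_num))
  filter_upwards [h1, LL_tendsto.eventually_ge_atTop 1] with n h1 hL
  rw [uu_eq]
  simp only [Function.comp_apply] at h1
  rw [Real.dist_eq, sub_zero] at h1
  set L := LL n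
  have hL0 : 0 < L := by linarith
  have hs : 0 < √L := Real.sqrt_pos.2 hL0
  have hs1 : 1 ≤ √L := by rw [Real.one_le_sqrt]; exact hL
  have hs2 : √L * √L = L := Real.mul_self_sqrt hL0.le
  set c := (1 / 2) * Real.log L - (1 / 2) * Real.log Real.pi + x with hc
  have hc' : (1 / 2) * Real.log L + (-((1 / 2) * Real.log Real.pi) + x) = c := by rw [hc]; ring
  rw [hc', abs_div, abs_of_pos hs, div_lt_iff₀ hs] at h1
  have h3 := abs_lt.1 h1
  have h4 : √L ≤ L := by nlinarith
  have hq0 : (0:ℝ) < √2 := by positivity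
  have hq1 : √2 ≤ (3/2:ℝ) := by rw [Real.sqrt_le_left (by norm_num)]; norm_num
  have hq2 : (1:ℝ) ≤ √2 := by rw [Real.one_le_sqrt]; norm_num
  rw [Real.sqrt_mul (by norm_num)]
  constructor
  · rw [le_div_iff₀ (by positivity)]
    calc √L * (√2 * √L) = √2 * L := by linear_combination √2 * hs2
      _ ≤ 3/2 * L := by gcongr
      _ ≤ _ := by linarith
  · rw [div_le_iff₀ (by positivity)]
    calc 2 * L + c ≤ 3 * 1 * L := by linarith
      _ ≤ 3 * √2 * L := by gcongr
      _ = _ := by linear_combination (-3) * √2 * hs2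

lemma uu_tendsto (x : ℝ) : Tendsto (uu x) atTop atTop := by
  refine tendsto_atTop_mono' _ ((uu_bd x).mono fun n h => h.1) ?_
  exact Real.tendsto_sqrt_atTop.comp LL_tendsto

lemma ss_tendsto : Tendsto ss atTop atTop :=
  Real.tendsto_sqrt_atTop.comp (Real.tendsto_sqrt_atTop.comp LL_tendsto)

lemma lam_lim (x : ℝ) : Tendsto (fun n => 1 / (2 * gg (uu x n)) * (2 * Real.log n)) atTop
    (𝓝 (2 * Real.exp (-x))) := by
  have hc : 0 < √(Real.pi / 2) := Real.sqrt_pos.2 (by positivity)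
  have h := (uu_lim x).div (gg_asymp.comp (uu_tendsto x)) hc.ne'
  have e : √(2 * Real.pi) * Real.exp (-x) / √(Real.pi / 2) = 2 * Real.exp (-x) := by
    have : √(2 * Real.pi) = 2 * √(Real.pi / 2) := by
      rw [show 2 * Real.pi = 2 ^ 2 * (Real.pi / 2) by ring, Real.sqrt_mul (by norm_num),
        Real.sqrt_sq (by norm_num)]
    rw [this]; field_simp
  rw [e] at h
  refine h.congr' ?_
  filter_upwards [(uu_tendsto x).eventually_ge_atTop 1,
    (gg_tendsto.comp (uu_tendsto x)).eventually_ge_atTop 1] with n hu hg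
  simp only [Pi.div_apply, Function.comp_apply] at *
  have : Real.exp (-(uu x n ^ 2 / 2)) ≠ 0 := (Real.exp_pos _).ne'
  have h1 : gg (uu x n) ≠ 0 := by linarith
  have h2 : uu x n ≠ 0 := by linarith
  field_simp

/-- powers of `u` are negligible against `exp (s/2)` -/
lemma uu_pow_small (x : ℝ) (k : ℕ) (c : ℝ) (hc : 0 < c) :
    Tendsto (fun n => uu x n ^ k * Real.exp (-(c * ss n))) atTop (𝓝 0) := by
  have h1 : Tendsto (fun s : ℝ => (3 ^ k / c ^ (2 * k)) * ((c * s) ^ (2 * k) * Real.exp (-(c * s))))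
      atTop (𝓝 0) := by
    have := (Real.tendsto_pow_mul_exp_neg_atTop_nhds_zero (2 * k)).comp
      (Tendsto.const_mul_atTop hc tendsto_id)
    simpa using this.const_mul (3 ^ k / c ^ (2 * k))
  refine squeeze_zero' ?_ ?_ (h1.comp ss_tendsto)
  · filter_upwards [(uu_tendsto x).eventually_ge_atTop 1] with n hu
    positivity
  · filter_upwards [uu_bd x, (uu_tendsto x).eventually_ge_atTop 1] with n hu hu1
    simp only [Function.comp_apply]
    have e : √(LL n) = ss n ^ 2 := by rw [ss, Real.sq_sqrt (Real.sqrt_nonneg _)]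
    have h2 : uu x n ^ k ≤ (3 * ss n ^ 2) ^ k := by
      rw [← e]; exact pow_le_pow_left₀ (by linarith) hu.2 k
    calc _ ≤ (3 * ss n ^ 2) ^ k * Real.exp (-(c * ss n)) := by gcongr
      _ = _ := by rw [mul_pow, mul_pow, ← pow_mul]; field_simp

end

open MeasureTheory Filter Topology ProbabilityTheory

noncomputable section

lemma S0_le_log : ∀ᶠ n : ℕ in atTop, 2 ≤ S0 n ∧ S0 n ≤ Real.log n ∧ ss n ≤ LL n := by
  filter_upwards [LL_tendsto.eventually_ge_atTop 1, log_tendsto.eventually_gt_atTop 0,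
    ss_tendsto.eventually_ge_atTop 1] with n h1 h2 h3
  have h4 : ss n ≤ LL n := by
    rw [ss, Real.sqrt_le_left (by linarith), Real.sqrt_le_left (by positivity)]
    nlinarith [pow_le_pow_left₀ (by norm_num) h1 3, pow_le_pow_left₀ (by norm_num) h1 4,
      pow_succ (LL n) 3, pow_mul (LL n) 2 2]
  refine ⟨?_, ?_, h4⟩
  · rw [S0]; linarith [Real.add_one_le_exp (ss n)]
  · rw [S0, ← Real.exp_log h2]; exact Real.exp_le_exp.2 h4

lemma log_div_n : Tendsto (fun n : ℕ => Real.log n / n) atTop (𝓝 0) := by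
  have := (Real.isLittleO_log_id_atTop.tendsto_div_nhds_zero).comp tendsto_natCast_atTop_atTop
  exact this

lemma log_le_n : ∀ᶠ n : ℕ in atTop, 8 * Real.log n ≤ n := by
  filter_upwards [log_div_n.eventually (gt_mem_nhds (show (0:ℝ) < 1/8 by norm_num)),
    eventually_ge_atTop 1] with n h hn
  have : (0:ℝ) < n := by exact_mod_cast hn
  rw [div_lt_iff₀ this] at h
  linarith

/-- basic facts about the grid -/
lemma grid_facts : ∀ᶠ n : ℕ in atTop, 2 ≤ n ∧ 2 ≤ S0 n ∧ S0 n ≤ n / 8 ∧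
    S0 n / n ≤ (JJ n : ℝ) / mg n ∧ (JJ n : ℝ) / mg n ≤ S0 n / n + 1 / mg n ∧
    (1 : ℝ) / mg n ≤ 1 / (n : ℝ) ^ 2 ∧ 1 ≤ JJ n ∧ 2 * JJ n < mg n ∧ n ≤ mg n ∧
    (JJ n : ℝ) / mg n ≤ 2 * S0 n / n := by
  filter_upwards [S0_le_log, log_le_n, eventually_ge_atTop 2] with n h1 h2 hn
  have hn2 : (2:ℝ) ≤ n := by exact_mod_cast hn
  have hn0 : (0:ℝ) < n := by linarith
  have hmp : 0 < mg n := by unfold mg; positivity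
  have hm0 : (0:ℝ) < mg n := by exact_mod_cast hmp
  have hS : 0 < S0 n := by linarith
  have hS8 : S0 n ≤ n / 8 := by linarith
  have hJ1 : (mg n : ℝ) * S0 n / n ≤ JJ n := Nat.le_ceil _
  have hJ2 : (JJ n : ℝ) < (mg n : ℝ) * S0 n / n + 1 := Nat.ceil_lt_add_one (by positivity)
  have e : (mg n : ℝ) * S0 n / n / mg n = S0 n / n := by field_simp
  have a1 : S0 n / n ≤ (JJ n : ℝ) / mg n := by
    rw [← e]; gcongr
  have a2 : (JJ n : ℝ) / mg n ≤ S0 n / n + 1 / mg n := by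
    rw [← e, ← add_div]; gcongr
  have a3 : (1 : ℝ) / mg n ≤ 1 / (n : ℝ) ^ 2 := by
    unfold mg; push_cast
    gcongr
    · linarith
    · norm_num
  have a3' : 1 / (n : ℝ) ^ 2 ≤ S0 n / n := by
    rw [div_le_div_iff₀ (by positivity) hn0]
    nlinarith
  have a4 : (JJ n : ℝ) / mg n ≤ 2 * S0 n / n := by rw [mul_div_assoc]; linarith
  have a5 : (JJ n : ℝ) / mg n ≤ 1 / 4 := by
    refine a4.trans ?_
    rw [div_le_iff₀ hn0]; linarith
  refine ⟨hn, h1.1, hS8, a1, a2, a3, ?_, ?_, ?_, a4⟩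
  · exact Nat.ceil_pos.2 (by positivity)
  · rw [div_le_iff₀ hm0] at a5
    have : (2 * JJ n : ℝ) < mg n := by linarith
    exact_mod_cast this
  · unfold mg; exact Nat.le_self_pow (by norm_num) n

lemma grid_t {n j : ℕ} (hn : 2 ≤ n) (hS : 0 < S0 n) (hJ : S0 n / n ≤ (JJ n : ℝ) / mg n)
    (hJ2 : 2 * JJ n < mg n) (h0 : JJ n ≤ j) (h1 : j ≤ mg n - JJ n) :
    S0 n / n ≤ (j : ℝ) / mg n ∧ (j : ℝ) / mg n ≤ 1 - S0 n / n ∧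
    S0 n / (2 * n) ≤ (j : ℝ) / mg n * (1 - (j : ℝ) / mg n) := by
  have hn0 : (0:ℝ) < n := by exact_mod_cast (by omega : 0 < n)
  have hm0 : (0:ℝ) < mg n := by exact_mod_cast (by omega : 0 < mg n)
  have h2 : (JJ n : ℝ) / mg n ≤ (j : ℝ) / mg n := by gcongr
  have h3 : (j : ℝ) / mg n ≤ 1 - (JJ n : ℝ) / mg n := by
    have : (j : ℝ) + JJ n ≤ mg n := by exact_mod_cast (by omega : j + JJ n ≤ mg n)
    rw [le_sub_iff_add_le, ← add_div, div_le_one hm0]; exact this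
  refine ⟨hJ.trans h2, by linarith, ?_⟩
  set t := (j : ℝ) / mg n
  have h4 : 0 < S0 n / n := by positivity
  have e : S0 n / (2 * n) = S0 n / n / 2 := by field_simp
  rw [e]
  rcases le_total t (1/2) with h | h
  · nlinarith
  · nlinarith

/-- everything polynomially small -/
lemma poly_small (x : ℝ) : ∀ᶠ n : ℕ in atTop, 1 ≤ uu x n ∧ uu x n ≤ n := by
  filter_upwards [(uu_tendsto x).eventually_ge_atTop 1, uu_bd x, S0_le_log, log_le_n,
    LL_tendsto.eventually_ge_atTop 1, log_tendsto.eventually_gt_atTop 0] with n h1 h2 h3 h4 h5 h6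
  refine ⟨h1, h2.2.trans ?_⟩
  have h7 : √(LL n) ≤ LL n := by
    rw [Real.sqrt_le_left (by linarith)]; nlinarith
  have h8 : LL n ≤ Real.log n := by
    have := Real.log_le_sub_one_of_pos h6
    rw [LL]; linarith
  linarith

lemma half_lim : Tendsto (fun n : ℕ => ss n / Real.log n) atTop (𝓝 0) := by
  have h1 : Tendsto (fun n : ℕ => LL n / Real.log n) atTop (𝓝 0) :=
    (Real.isLittleO_log_id_atTop.tendsto_div_nhds_zero).comp log_tendsto
  refine squeeze_zero' ?_ ?_ h1
  · filter_upwards [ss_tendsto.eventually_ge_atTop 0, log_tendsto.eventually_gt_atTop 0] with n h h'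
    positivity
  · filter_upwards [S0_le_log, log_tendsto.eventually_gt_atTop 0] with n h h'
    exact div_le_div_of_nonneg_right h.2.2 h'.le

lemma hTN_grid : ∀ᶠ n : ℕ in atTop, ∀ j : ℕ, JJ n ≤ j → j ≤ mg n - JJ n →
    1 / ((j / mg n : ℝ) * (1 - j / mg n)) ≤ (n : ℝ) ^ 2 := by
  filter_upwards [grid_facts] with n h j h0 h1
  obtain ⟨hn, hS, -, hJ, -, -, -, hJ2, -, -⟩ := h
  have hn0 : (0:ℝ) < n := by exact_mod_cast (by omega : 0 < n)
  have hn2 : (2:ℝ) ≤ n := by exact_mod_cast hn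
  have h3 := (grid_t hn (by linarith) hJ hJ2 h0 h1).2.2
  have h4 : 1 / (n : ℝ) ≤ S0 n / (2 * n) := by
    rw [div_le_div_iff₀ hn0 (by positivity)]; nlinarith
  have h5 : 0 < 1 / (n:ℝ) := by positivity
  calc _ ≤ 1 / (1 / (n : ℝ)) := by gcongr; linarith
    _ = n := by field_simp
    _ ≤ _ := by nlinarith

lemma hNm_grid : ∀ᶠ n : ℕ in atTop, ∀ k ≤ 20, (n:ℝ) ^ k * (1 / mg n) ≤ 1 / n ^ 10 ∧
    100 * ((n:ℝ) ^ k * (1 / mg n)) ≤ 1 / n ^ 9 := by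
  filter_upwards [eventually_ge_atTop 100] with n hn k hk
  have hn2 : (100:ℝ) ≤ n := by exact_mod_cast hn
  have hn0 : (0:ℝ) < n := by linarith
  have h1 : (n:ℝ) ^ k * (1 / mg n) ≤ 1 / n ^ 10 := by
    unfold mg; push_cast
    rw [mul_one_div, div_le_div_iff₀ (by positivity) (by positivity), ← pow_add, one_mul]
    exact pow_le_pow_right₀ (by linarith) (by omega)
  refine ⟨h1, ?_⟩
  calc _ ≤ (n:ℝ) * (1 / n ^ 10) := by gcongr
    _ = _ := by field_simp

lemma sig_lim : Tendsto (fun n : ℕ => sigS (mg n) (JJ n) (mg n - JJ n) / (2 * Real.log n)) atTop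
    (𝓝 1) := by
  have hz : Tendsto (fun n : ℕ => (ss n + 4) / Real.log n) atTop (𝓝 0) := by
    have := half_lim.add ((tendsto_const_nhds (x := (4:ℝ))).div_atTop log_tendsto)
    rw [add_zero] at this
    exact this.congr fun n => by simp only [add_div]
  rw [tendsto_iff_dist_tendsto_zero]
  refine squeeze_zero' (Eventually.of_forall fun n => dist_nonneg) ?_ hz
  filter_upwards [grid_facts, hTN_grid, hNm_grid, log_tendsto.eventually_gt_atTop 0,
    ss_tendsto.eventually_ge_atTop 0] with n h hT hN hlog hss
  obtain ⟨hn, hS, hS8, hJ, -, -, hJ1, hJ2, -, hJ4⟩ := h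
  have hn2 : (2:ℝ) ≤ n := by exact_mod_cast hn
  have hn0 : (0:ℝ) < n := by linarith
  have hm0 : (0:ℝ) < mg n := by exact_mod_cast (by omega : 0 < mg n)
  have hle1 : 2 * ((n:ℝ)^2)^2 * (1 / mg n) ≤ 1 := by
    have := (hN 4 (by norm_num)).2
    have h10 : (1:ℝ) / n ^ 9 ≤ 1 := by
      rw [div_le_one (by positivity)]; exact one_le_pow₀ (by linarith)
    rw [← pow_mul]
    have : 0 ≤ (n:ℝ) ^ 4 * (1 / mg n) := by positivity
    norm_num at *
    linarith
  have hs := sigS_logit (N := (n:ℝ)^2) hJ1 (by omega : JJ n ≤ mg n - JJ n) (by omega)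
    (one_le_pow₀ (by linarith)) hle1 hT
  set t := (JJ n : ℝ) / mg n with ht
  have e1 : ((mg n - JJ n : ℕ) : ℝ) / mg n = 1 - t := by
    rw [Nat.cast_sub (by omega), sub_div, div_self hm0.ne']
  rw [e1] at hs
  have hS0 : 0 < S0 n / n := by positivity
  have ht0 : 0 < t := by linarith
  have ht1 : t ≤ 1/4 := hJ4.trans (by rw [div_le_iff₀ hn0]; linarith)
  have e2 : logit (1 - t) - logit t = 2 * (Real.log (1 - t) - Real.log t) := by
    unfold logit; rw [sub_sub_cancel]; ring
  rw [e2] at hs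
  have b1 : Real.log (1 - t) ≤ 0 := Real.log_nonpos (by linarith) (by linarith)
  have b2 : -1 ≤ Real.log (1 - t) := by
    have := Real.one_sub_inv_le_log_of_pos (show 0 < 1 - t by linarith)
    have h3 : (1 - t)⁻¹ ≤ 2 := by
      rw [inv_le_comm₀ (by linarith) (by norm_num)]; linarith
    linarith
  have b3 : Real.log t ≤ 1 + ss n - Real.log n := by
    calc Real.log t ≤ Real.log (2 * S0 n / n) := Real.log_le_log ht0 hJ4
      _ = Real.log 2 + ss n - Real.log n := by
        rw [Real.log_div (by positivity) (by positivity), Real.log_mul (by norm_num) (by positivity),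
          S0, Real.log_exp]
      _ ≤ _ := by linarith [Real.log_two_lt_d9]
  have b4 : ss n - Real.log n ≤ Real.log t := by
    calc ss n - Real.log n = Real.log (S0 n / n) := by
          rw [Real.log_div (by positivity) (by positivity), S0, Real.log_exp]
      _ ≤ _ := Real.log_le_log hS0 hJ
  rw [Real.dist_eq, div_sub_one (by positivity), abs_div, abs_of_pos (show 0 < 2 * Real.log n by positivity),
    div_le_div_iff₀ (by positivity) hlog]
  have h5 := abs_le.1 hs
  have h6 : |sigS (mg n) (JJ n) (mg n - JJ n) - 2 * Real.log n| ≤ 2 * (ss n + 4) := by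
    rw [abs_le]; constructor <;> linarith [h5.1, h5.2]
  nlinarith

/-- **The null limit on the grid.** -/
theorem null_lim (x : ℝ) : Tendsto (fun n : ℕ =>
    (latA (alv n (mg n) (JJ n) (mg n - JJ n) (uu x n)) (mg n) n : ℝ) / ((mg n).choose n : ℝ)) atTop
    (𝓝 (Real.exp (-2 * Real.exp (-x)))) := by
  obtain ⟨K, hK, u0, hu0, hb⟩ := gg_bounds
  have hut := uu_tendsto x
  have hgt := gg_tendsto.comp hut
  -- main exponent
  have hmain : Tendsto (fun n : ℕ => 1 / (2 * gg (uu x n)) * sigS (mg n) (JJ n) (mg n - JJ n)) atTop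
      (𝓝 (2 * Real.exp (-x))) := by
    have := (lam_lim x).mul sig_lim
    rw [mul_one] at this
    refine this.congr' ?_
    filter_upwards [log_tendsto.eventually_gt_atTop 0] with n h
    field_simp
  have hNm0 : Tendsto (fun n : ℕ => (1:ℝ) / n) atTop (𝓝 0) := tendsto_one_div_atTop_nhds_zero_nat
  -- `v0`
  set v0 : ℕ → ℝ := fun n => √(S0 n / 2) with hv0
  have v0e : ∀ n, 1 / v0 n = √2 * Real.exp (-((1/2) * ss n)) := by
    intro n
    simp only [hv0]
    have h1 : √(Real.exp (ss n)) = Real.exp ((1/2) * ss n) := by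
      rw [show Real.exp (ss n) = Real.exp ((1/2) * ss n) * Real.exp ((1/2) * ss n) by
        rw [← Real.exp_add]; congr 1; ring, Real.sqrt_mul_self (Real.exp_pos _).le]
    rw [S0, Real.sqrt_div (Real.exp_pos _).le, h1, one_div_div, div_eq_mul_inv, Real.exp_neg]
  have hE1 : ∀ k, Tendsto (fun n => uu x n ^ k / v0 n) atTop (𝓝 0) := by
    intro k
    have := (uu_pow_small x k (1/2) (by norm_num)).const_mul (√2)
    rw [mul_zero] at this
    refine this.congr fun n => ?_
    rw [div_eq_mul_one_div (uu x n ^ k), v0e]; ring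
  have hE2 : Tendsto (fun n : ℕ => K * uu x n ^ 3 * ((n:ℝ) ^ 8 * (1 / mg n))) atTop (𝓝 0) := by
    have h1 : Tendsto (fun n : ℕ => K * ((1:ℝ) / n)) atTop (𝓝 0) := by simpa using hNm0.const_mul K
    refine squeeze_zero' ?_ ?_ h1
    · filter_upwards [hut.eventually_ge_atTop 1] with n hn
      positivity
    · filter_upwards [poly_small x, hNm_grid, eventually_ge_atTop 1] with n h1 h2 hn
      have hn1 : (1:ℝ) ≤ n := by exact_mod_cast hn
      have h3 := (h2 8 (by norm_num)).1
      have h4 : uu x n ^ 3 ≤ (n:ℝ) ^ 3 := pow_le_pow_left₀ (by linarith) h1.2 3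
      calc _ ≤ K * (n:ℝ)^3 * (1 / n ^ 10) := by gcongr
        _ = K * (1 / n ^ 7) := by field_simp
        _ ≤ K * (1 / n) := by
          gcongr
          exact le_self_pow₀ hn1 (by norm_num)
  set Er : ℕ → ℝ := fun n => 72 * (K * uu x n ^ 3) * uu x n / v0 n +
    40 * (K * uu x n ^ 3) * ((n:ℝ) ^ 2) ^ 4 * (1 / mg n)
        + (K * uu x n ^ 3) * (4 * ((n:ℝ) ^ 2) ^ 2 * (1 / mg n) + 2 / v0 n) with hEr
  have hErl : Tendsto Er atTop (𝓝 0) := by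
    have hE3 : Tendsto (fun n : ℕ => K * uu x n ^ 3 * ((n:ℝ) ^ 4 * (1 / mg n))) atTop (𝓝 0) := by
      refine squeeze_zero' ?_ ?_ hE2
      · filter_upwards [hut.eventually_ge_atTop 1] with n hn
        positivity
      · filter_upwards [hut.eventually_ge_atTop 1, eventually_ge_atTop 1] with n hu hn
        have hn1 : (1:ℝ) ≤ n := by exact_mod_cast hn
        gcongr
        norm_num
    have := (((hE1 4).const_mul (72 * K)).add (hE2.const_mul 40)).add
      ((hE3.const_mul 4).add ((hE1 3).const_mul (2 * K)))
    simp only [mul_zero, add_zero] at this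
    refine this.congr fun n => ?_
    simp only [hEr]
    ring
  have hrho : Tendsto (fun n => gg (uu x n / 2) / gg (uu x n) + 4 / uu x n ^ 2) atTop (𝓝 0) := by
    have h1 := gg_half.comp hut
    have h2 : Tendsto (fun n => 4 / uu x n ^ 2) atTop (𝓝 0) :=
      tendsto_const_nhds.div_atTop ((tendsto_pow_atTop (by norm_num)).comp hut)
    simpa using h1.add h2
  have hN1 : Tendsto (fun n : ℕ => 1 + (n:ℝ) ^ 2 * (1 / mg n)) atTop (𝓝 1) := by
    have : Tendsto (fun n : ℕ => (n:ℝ) ^ 2 * (1 / mg n)) atTop (𝓝 0) := by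
      refine squeeze_zero' (Eventually.of_forall fun n => by positivity) ?_ hNm0
      filter_upwards [hNm_grid, eventually_ge_atTop 1] with n h hn
      have hn1 : (1:ℝ) ≤ n := by exact_mod_cast hn
      refine (h 2 (by norm_num)).1.trans ?_
      gcongr
      exact le_self_pow₀ hn1 (by norm_num)
    simpa using this.const_add 1
  have hfin : ∀ᶠ n : ℕ in atTop,
    (latA (alv n (mg n) (JJ n) (mg n - JJ n) (uu x n)) (mg n) n : ℝ) / ((mg n).choose n : ℝ) ≤
      Real.exp (-(1 / (2 * gg (uu x n)) * sigS (mg n) (JJ n) (mg n - JJ n))) + Er n +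
        (gg (uu x n / 2) / gg (uu x n) + 4 / uu x n ^ 2) ∧
    (1 - 1 / uu x n ^ 2) * Real.exp (-(1 / (2 * gg (uu x n)) * sigS (mg n) (JJ n) (mg n - JJ n)
        * (1 + (n:ℝ) ^ 2 * (1 / mg n))))
      - Er n - (gg (uu x n / 2) / gg (uu x n) + 4 / uu x n ^ 2) ≤
      (latA (alv n (mg n) (JJ n) (mg n - JJ n) (uu x n)) (mg n) n : ℝ) / ((mg n).choose n : ℝ) := by
    filter_upwards [grid_facts, hTN_grid, hNm_grid, poly_small x, hut.eventually_ge_atTop u0,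
      hgt.eventually_ge_atTop 1, (hE1 1).eventually (gt_mem_nhds (show (0:ℝ) < 1/8 by norm_num)),
      eventually_ge_atTop 100]
      with n h hT hN hu hu0' hg hv hn100
    obtain ⟨hn, hS, hS8, hJ, -, -, hJ1, hJ2, hnm, hJ4⟩ := h
    have hn2 : (100:ℝ) ≤ n := by exact_mod_cast hn100
    have hn0 : (0:ℝ) < n := by linarith
    have hm0 : (0:ℝ) < mg n := by exact_mod_cast (by omega : 0 < mg n)
    have hn9 : (1:ℝ) / n ^ 9 ≤ 1 / n := by
      gcongr; exact le_self_pow₀ (by linarith) (by norm_num)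
    have hn9' : (1:ℝ) / n ≤ 1 := by rw [div_le_one hn0]; linarith
    have h4 := (hN 4 (by norm_num)).2
    have h4p : 0 ≤ (n:ℝ) ^ 4 * (1 / mg n) := by positivity
    have e4 : ((n:ℝ) ^ 2) ^ 2 = (n:ℝ) ^ 4 := by ring
    have hv1 : 1 ≤ v0 n := by
      simp only [hv0]; rw [Real.one_le_sqrt]; linarith
    refine null_finite (M := K * uu x n ^ 3) (N := (n:ℝ) ^ 2) (v0 := v0 n) hg
      (by have := hu.1; positivity) (hb _ hu0').2 (by omega) hnm hJ1 (by omega) (by omega)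
      (le_self_pow₀ (by linarith) (by norm_num))
      (hu.2.trans (le_self_pow₀ (by linarith) (by norm_num))) hu.1 (one_le_pow₀ (by linarith)) hv1
      ?_ ?_ hT ?_
    · rw [e4]; linarith
    · rw [e4]
      have hup : 0 < uu x n := by linarith [hu.1]
      have h6 : 1 / (n:ℝ) ≤ 1 / uu x n := one_div_le_one_div_of_le hup hu.2
      have h7 : 2 / v0 n ≤ 1 / uu x n / 4 := by
        rw [pow_one, div_lt_iff₀ (by linarith)] at hv
        rw [div_le_iff₀ (by linarith)]
        have : 1 / uu x n / 4 * v0 n = v0 n / (4 * uu x n) := by field_simp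
        rw [this, le_div_iff₀ (by linarith)]
        linarith
      have h8 : 0 < 1 / uu x n := by positivity
      linarith
    · intro j h0 h1
      simp only [hv0]
      refine Real.sqrt_le_sqrt ?_
      have h3 := (grid_t hn (by linarith) hJ hJ2 h0 h1).2.2
      have := mul_le_mul_of_nonneg_left h3 hn0.le
      rw [mul_assoc]
      refine le_trans (le_of_eq ?_) this
      field_simp
  have hU : Tendsto (fun n : ℕ => Real.exp (-(1 / (2 * gg (uu x n)) * sigS (mg n) (JJ n) (mg n - JJ n)))
      + Er n + (gg (uu x n / 2) / gg (uu x n) + 4 / uu x n ^ 2)) atTop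
      (𝓝 (Real.exp (-(2 * Real.exp (-x))) + 0 + 0)) :=
    (((Real.continuous_exp.tendsto _).comp hmain.neg).add hErl).add hrho
  have hLo : Tendsto (fun n : ℕ => (1 - 1 / uu x n ^ 2) * Real.exp (-(1 / (2 * gg (uu x n)) *
      sigS (mg n) (JJ n) (mg n - JJ n) * (1 + (n:ℝ) ^ 2 * (1 / mg n))))
      - Er n - (gg (uu x n / 2) / gg (uu x n) + 4 / uu x n ^ 2)) atTop
      (𝓝 ((1 - 0) * Real.exp (-(2 * Real.exp (-x) * 1)) - 0 - 0)) := by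
    refine (((Tendsto.const_sub 1 ?_).mul ((Real.continuous_exp.tendsto _).comp
      (hmain.mul hN1).neg)).sub hErl).sub hrho
    exact tendsto_const_nhds.div_atTop ((tendsto_pow_atTop (by norm_num)).comp hut)
  have e1 : Real.exp (-(2 * Real.exp (-x))) + 0 + 0 = Real.exp (-2 * Real.exp (-x)) := by
    rw [neg_mul]; ring
  have e2 : (1 - 0) * Real.exp (-(2 * Real.exp (-x) * 1)) - 0 - 0 = Real.exp (-2 * Real.exp (-x)) := by
    rw [neg_mul, mul_one]; ring
  rw [e1] at hU
  rw [e2] at hLo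
  exact tendsto_of_tendsto_of_tendsto_of_le_of_le' hLo hU (hfin.mono fun n h => h.2)
    (hfin.mono fun n h => h.1)

end

open MeasureTheory Filter Topology ProbabilityTheory

noncomputable section

lemma desc_bound {n m : ℕ} (hnm : n ≤ m) (hm : 0 < m) :
    1 - (n:ℝ) ^ 2 / m ≤ (m.descFactorial n : ℝ) / (m:ℝ) ^ n := by
  have hm0 : (0:ℝ) < m := by exact_mod_cast hm
  have h1 : ((m + 1 - n : ℕ) : ℝ) ^ n ≤ m.descFactorial n := by
    exact_mod_cast Nat.pow_sub_le_descFactorial m n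
  have h2 : (1:ℝ) - n / m ≤ ((m + 1 - n : ℕ) : ℝ) / m := by
    rw [one_sub_div hm0.ne']
    gcongr
    rw [Nat.cast_sub (by omega)]; push_cast; linarith
  have h0 : (n:ℝ) / m ≤ 1 := by rw [div_le_one hm0]; exact_mod_cast hnm
  have h3 := one_add_mul_le_pow (a := -((n:ℝ)/m)) (by linarith) n
  calc 1 - (n:ℝ) ^ 2 / m = 1 + n * (-((n:ℝ)/m)) := by ring
    _ ≤ (1 + -((n:ℝ)/m)) ^ n := h3
    _ ≤ (((m + 1 - n : ℕ) : ℝ) / m) ^ n := by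
        refine pow_le_pow_left₀ (by linarith) (by linarith) n
    _ = ((m + 1 - n : ℕ) : ℝ) ^ n / (m:ℝ) ^ n := by rw [div_pow]
    _ ≤ _ := by gcongr

open Classical in
/-- the image of a labelling -/
def imgF {n m : ℕ} (f : Fin n → Fin m) : Finset ℕ := Finset.univ.image fun i => (f i : ℕ)

open Classical in
lemma fiber_card {n m : ℕ} {S : Finset ℕ} (hS : S ∈ Finset.powersetCard n (Finset.range m)) :
    (Finset.univ.filter fun f : Fin n → Fin m => Function.Injective f ∧ imgF f = S).card = n.factorial := by
  rw [Finset.mem_powersetCard] at hS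
  have hc : Fintype.card (Fin n) = Fintype.card S := by simp [hS.2]
  have h1 : Fintype.card (Fin n ≃ S) = n.factorial := by
    rw [Fintype.card_equiv (Fintype.equivOfCardEq hc)]; simp
  rw [← h1, ← Fintype.card_subtype]
  refine Fintype.card_congr ⟨fun f => Equiv.ofBijective (fun i => ⟨(f.1 i : ℕ), ?_⟩) ⟨?_, ?_⟩,
    fun e => ⟨fun i => ⟨(e i : ℕ), ?_⟩, ?_, ?_⟩, ?_, ?_⟩
  · have := f.2.2
    have h2 : ((f.1 i : ℕ)) ∈ imgF f.1 := Finset.mem_image_of_mem (fun i => (f.1 i : ℕ)) (Finset.mem_univ i)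
    exact (Finset.ext_iff.1 this _).1 h2
  · intro i j hij
    exact f.2.1 (Fin.ext (by simpa using hij))
  · intro s
    have h2 : (s : ℕ) ∈ imgF f.1 := by rw [f.2.2]; exact s.2
    obtain ⟨i, -, hi⟩ := Finset.mem_image.1 h2
    exact ⟨i, Subtype.ext hi⟩
  · exact Finset.mem_range.1 (hS.1 (e i).2)
  · intro i j hij
    exact e.injective (Subtype.ext (by simpa using hij))
  · ext s
    simp only [imgF, Finset.mem_image, Finset.mem_univ, true_and]
    constructor
    · rintro ⟨i, rfl⟩; exact (e i).2
    · intro hs; exact ⟨e.symm ⟨s, hs⟩, by simp⟩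
  · intro f; ext; rfl
  · intro e; ext; rfl

open Classical in
/-- the number of labels below `j` -/
def cntF {n m : ℕ} (f : Fin n → Fin m) (j : ℕ) : ℕ := (Finset.univ.filter fun i => (f i : ℕ) < j).card

open Classical in
lemma cntF_img {n m : ℕ} {f : Fin n → Fin m} (hf : Function.Injective f) (j : ℕ) :
    ((imgF f).filter (· < j)).card = cntF f j := by
  rw [imgF, Finset.filter_image, Finset.card_image_of_injective, cntF]
  intro a b h
  exact hf (Fin.ext h)

open Classical in
lemma inj_alive_card {n m : ℕ} (al : ℕ → ℕ → Prop) :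
    (Finset.univ.filter fun f : Fin n → Fin m => Function.Injective f ∧
      ∀ j ∈ Finset.Icc 1 m, al j (cntF f j)).card = n.factorial * latA al m n := by
  rw [← goodS_card, mul_comm, ← smul_eq_mul, ← Finset.sum_const]
  rw [Finset.card_eq_sum_card_fiberwise (f := imgF) (t := goodS al m n)]
  · refine Finset.sum_congr rfl fun S hS => ?_
    rw [mem_goodS] at hS
    rw [← fiber_card hS.1, Finset.filter_filter]
    congr 1
    ext f
    simp only [Finset.mem_filter, Finset.mem_univ, true_and]
    constructor
    · rintro ⟨⟨h1, h2⟩, h3⟩; exact ⟨h1, h3⟩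
    · rintro ⟨h1, h2⟩
      refine ⟨⟨h1, fun j hj => ?_⟩, h2⟩
      have := hS.2 j hj
      rw [← h2] at this
      convert this using 1
      rw [← cntF_img h1]
  · intro f hf
    simp only [Finset.coe_filter, Finset.mem_univ, true_and, Set.mem_ofPred_eq] at hf
    rw [Finset.mem_coe, mem_goodS]
    refine ⟨?_, fun j hj => ?_⟩
    · rw [Finset.mem_powersetCard]
      refine ⟨?_, ?_⟩
      · intro s hs
        obtain ⟨i, -, hi⟩ := Finset.mem_image.1 hs
        rw [← hi]; exact Finset.mem_range.2 (f i).2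
      · rw [imgF, Finset.card_image_of_injective _ (fun a b h => hf.1 (Fin.ext h))]
        simp
    · have := hf.2 j hj
      rw [← cntF_img hf.1] at this
      convert this using 1
      

open Classical in
/-- **Link between the product measure and lattice paths.** -/
theorem link {n m : ℕ} (hnm : n ≤ m) (hm : 0 < m) (Q : Measure ℝ) [IsProbabilityMeasure Q]
    (c : ℝ → Fin m) (hc : Measurable c) (hQ : ∀ l, Q.real (c ⁻¹' {l}) = 1 / m) (al : ℕ → ℕ → Prop) :
    |(Measure.pi fun _ : Fin n => Q).real {Y | ∀ j ∈ Finset.Icc 1 m, al j (cntF (fun i => c (Y i)) j)}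
      - (latA al m n : ℝ) / (m.choose n : ℝ)| ≤ (n:ℝ) ^ 2 / m := by
  have hm0 : (0:ℝ) < m := by exact_mod_cast hm
  set F := Finset.univ.filter fun f : Fin n → Fin m => ∀ j ∈ Finset.Icc 1 m, al j (cntF f j) with hF
  have hset : {Y : Fin n → ℝ | ∀ j ∈ Finset.Icc 1 m, al j (cntF (fun i => c (Y i)) j)} =
      ⋃ f ∈ F, Set.pi Set.univ (fun i => c ⁻¹' {f i}) := by
    ext Y
    simp only [Set.mem_ofPred_eq, Set.mem_iUnion, Set.mem_pi, Set.mem_univ, Set.mem_preimage,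
      Set.mem_singleton_iff, true_imp_iff, exists_prop, hF, Finset.mem_filter, Finset.mem_univ, true_and]
    constructor
    · intro h; exact ⟨fun i => c (Y i), h, fun i => rfl⟩
    · rintro ⟨f, h1, h2⟩
      have : (fun i => c (Y i)) = f := funext h2
      rw [this]; exact h1
  have hcell : ∀ f : Fin n → Fin m, (Measure.pi fun _ : Fin n => Q).real
      (Set.pi Set.univ (fun i => c ⁻¹' {f i})) = (1 / m : ℝ) ^ n := by
    intro f
    rw [measureReal_def, Measure.pi_pi, ENNReal.toReal_prod]
    simp only [← measureReal_def, hQ]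
    simp
  have hp : (Measure.pi fun _ : Fin n => Q).real
      {Y | ∀ j ∈ Finset.Icc 1 m, al j (cntF (fun i => c (Y i)) j)} = F.card / (m:ℝ) ^ n := by
    rw [hset, measureReal_biUnion_finset]
    · rw [Finset.sum_congr rfl (fun f _ => hcell f), Finset.sum_const, nsmul_eq_mul, div_pow, one_pow]
      ring
    · intro f _ g _ hfg
      rw [Function.onFun, Set.disjoint_left]
      intro Y h1 h2
      apply hfg
      ext i
      have a := h1 i (Set.mem_univ i)
      have b := h2 i (Set.mem_univ i)
      simp only [Set.mem_preimage, Set.mem_singleton_iff] at a b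
      rw [← a, ← b]
    · intro f _
      exact MeasurableSet.univ_pi fun i => hc (measurableSet_singleton _)
  rw [hp]
  have hsplit := Finset.card_filter_add_card_filter_not (s := F) (fun f => Function.Injective f)
  have h1 : (F.filter fun f => Function.Injective f).card = n.factorial * latA al m n := by
    rw [← inj_alive_card, hF, Finset.filter_filter]
    congr 1; ext f; simp only [Finset.mem_filter, and_comm]
  have h2 : (F.filter fun f => ¬ Function.Injective f).card + m.descFactorial n ≤ m ^ n := by
    have h3 := Finset.card_filter_add_card_filter_not (s := (Finset.univ : Finset (Fin n → Fin m)))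
      (fun f => Function.Injective f)
    have h4 : (Finset.univ.filter fun f : Fin n → Fin m => Function.Injective f).card =
        m.descFactorial n := by
      rw [← Fintype.card_subtype, Fintype.card_congr (Equiv.subtypeInjectiveEquivEmbedding _ _),
        Fintype.card_embedding_eq]
      simp
    have h5 : (F.filter fun f => ¬ Function.Injective f).card ≤
        (Finset.univ.filter fun f : Fin n → Fin m => ¬ Function.Injective f).card :=
      Finset.card_le_card (Finset.filter_subset_filter _ (Finset.subset_univ _))
    rw [h4] at h3
    simp only [Finset.card_univ, Fintype.card_fun, Fintype.card_fin] at h3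
    omega
  have hchoose : (0:ℝ) < m.choose n := by exact_mod_cast Nat.choose_pos hnm
  have hd : (m.descFactorial n : ℝ) = n.factorial * m.choose n := by
    exact_mod_cast Nat.descFactorial_eq_factorial_mul_choose m n
  have hpow : (0:ℝ) < (m:ℝ) ^ n := by positivity
  set b := (F.filter fun f => ¬ Function.Injective f).card
  have hFc : (F.card : ℝ) = n.factorial * latA al m n + b := by
    rw [h1] at hsplit; exact_mod_cast hsplit.symm
  have h2' : (b : ℝ) + m.descFactorial n ≤ (m:ℝ) ^ n := by exact_mod_cast h2
  set p0 := (latA al m n : ℝ) / (m.choose n : ℝ) with hp0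
  have hp01 : p0 ≤ 1 := by
    rw [hp0, div_le_one hchoose, ← goodS_card]
    have : (goodS al m n) ⊆ Finset.powersetCard n (Finset.range m) := fun S hS => (mem_goodS.1 hS).1
    have := Finset.card_le_card this
    rw [Finset.card_powersetCard, Finset.card_range] at this
    exact_mod_cast this
  have hp00 : 0 ≤ p0 := by positivity
  set rr := (m.descFactorial n : ℝ) / (m:ℝ) ^ n with hrr
  have e1 : (F.card : ℝ) / (m:ℝ) ^ n = p0 * rr + b / (m:ℝ) ^ n := by
    rw [hFc, hp0, hrr, hd]; field_simp
  have hb : (b : ℝ) / (m:ℝ) ^ n ≤ 1 - rr := by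
    rw [hrr, one_sub_div hpow.ne']; gcongr; linarith
  have hb0 : 0 ≤ (b : ℝ) / (m:ℝ) ^ n := by positivity
  have hr := desc_bound hnm hm
  rw [e1, abs_le]
  have hrr0 : 0 ≤ 1 - rr := by linarith
  have h7 : p0 * (1 - rr) ≤ 1 * (1 - rr) := by gcongr
  have h8 : 0 ≤ p0 * (1 - rr) := by positivity
  constructor <;> nlinarith
end

open MeasureTheory Filter Topology ProbabilityTheory

noncomputable section

/-- survival function -/
def sv (Q : Measure ℝ) (y : ℝ) : ℝ := Q.real (Set.Ici y)

open Classical in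
/-- number of observations at least `y` -/
def Ncnt {n : ℕ} (Y : Fin n → ℝ) (y : ℝ) : ℕ := (Finset.univ.filter fun i => y ≤ Y i).card

lemma sv_nonneg (Q : Measure ℝ) (y : ℝ) : 0 ≤ sv Q y := measureReal_nonneg
lemma sv_le_one (Q : Measure ℝ) [IsProbabilityMeasure Q] (y : ℝ) : sv Q y ≤ 1 := measureReal_le_one

lemma sv_eq (Q : Measure ℝ) [IsProbabilityMeasure Q] [NullSingletonClass Q] (y : ℝ) : sv Q y = 1 - cdf Q y := by
  have h : Set.Ici y = (Set.Iio y)ᶜ := by simp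
  rw [sv, h, probReal_compl_eq_one_sub measurableSet_Iio, cdf_eq_real]
  congr 1
  exact measureReal_congr Iio_ae_eq_Iic

lemma cdf_cont (Q : Measure ℝ) [IsProbabilityMeasure Q] [NullSingletonClass Q] : Continuous (cdf Q) := by
  rw [continuous_iff_continuousAt]
  intro a
  rw [(monotone_cdf Q).continuousAt_iff_leftLim_eq_rightLim, StieltjesFunction.rightLim_eq]
  have h := StieltjesFunction.measure_singleton (cdf Q) a
  rw [measure_cdf, measure_singleton] at h
  have h2 := ENNReal.ofReal_eq_zero.1 h.symm
  have h3 := (monotone_cdf Q).leftLim_le (le_refl a)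
  linarith

lemma sv_cont (Q : Measure ℝ) [IsProbabilityMeasure Q] [NullSingletonClass Q] : Continuous (sv Q) := by
  have : sv Q = fun y => 1 - cdf Q y := funext (sv_eq Q)
  rw [this]
  exact continuous_const.sub (cdf_cont Q)

lemma sv_strictAnti (Q : Measure ℝ) [IsProbabilityMeasure Q] (hQ : volume ≪ Q) :
    StrictAnti (sv Q) := by
  intro a b hab
  have h : Set.Ici a = Set.Ici b ∪ Set.Ico a b := by
    ext z; simp only [Set.mem_Ici, Set.mem_union, Set.mem_Ico]
    constructor
    · intro h; rcases le_or_gt b z with h' | h'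
      · left; exact h'
      · right; exact ⟨h, h'⟩
    · rintro (h | h) <;> linarith [h]
      
  have hp : 0 < Q.real (Set.Ico a b) := by
    rw [measureReal_def, ENNReal.toReal_pos_iff]
    refine ⟨?_, measure_lt_top _ _⟩
    rw [pos_iff_ne_zero]
    intro h0
    have := hQ h0
    rw [Real.volume_Ico, ENNReal.ofReal_eq_zero] at this
    linarith
  rw [sv, sv, h, measureReal_union _ measurableSet_Ico]
  · linarith
  · rw [Set.disjoint_left]; intro z h1 h2; exact absurd h2.2 (not_lt.2 h1)

lemma sv_bot (Q : Measure ℝ) [IsProbabilityMeasure Q] [NullSingletonClass Q] : Tendsto (sv Q) atBot (𝓝 1) := by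
  have : sv Q = fun y => 1 - cdf Q y := funext (sv_eq Q)
  rw [this]
  simpa using (tendsto_cdf_atBot Q).const_sub 1

lemma sv_top (Q : Measure ℝ) [IsProbabilityMeasure Q] [NullSingletonClass Q] : Tendsto (sv Q) atTop (𝓝 0) := by
  have : sv Q = fun y => 1 - cdf Q y := funext (sv_eq Q)
  rw [this]
  simpa using (tendsto_cdf_atTop Q).const_sub 1

/-- The class of measures we work with. -/
structure Nice (Q : Measure ℝ) : Prop where
  prob : IsProbabilityMeasure Q
  noat : NullSingletonClass Q
  abc : volume ≪ Q

lemma Nice.cont {Q : Measure ℝ} (h : Nice Q) : Continuous (sv Q) := by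
  have := h.prob; have := h.noat; exact sv_cont Q

lemma Nice.anti {Q : Measure ℝ} (h : Nice Q) : StrictAnti (sv Q) := by
  have := h.prob; exact sv_strictAnti Q h.abc

lemma Nice.pos {Q : Measure ℝ} (h : Nice Q) (y : ℝ) : 0 < sv Q y :=
  lt_of_le_of_lt (sv_nonneg Q (y + 1)) (h.anti (by linarith))

lemma Nice.lt_one {Q : Measure ℝ} (h : Nice Q) (y : ℝ) : sv Q y < 1 := by
  have := h.prob
  exact lt_of_lt_of_le (h.anti (show y - 1 < y by linarith)) (sv_le_one Q _)

lemma Nice.surj {Q : Measure ℝ} (h : Nice Q) {t : ℝ} (h0 : 0 < t) (h1 : t < 1) : ∃ y, sv Q y = t := by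
  have := h.prob; have := h.noat
  obtain ⟨a, ha⟩ := ((sv_bot Q).eventually (lt_mem_nhds h1)).exists
  obtain ⟨b, hb⟩ := ((sv_top Q).eventually (gt_mem_nhds h0)).exists
  have hab : a ≤ b := by
    by_contra hc; push Not at hc
    have := h.anti hc; linarith
  obtain ⟨y, -, hy⟩ := intermediate_value_Icc' hab h.cont.continuousOn ⟨hb.le, ha.le⟩
  exact ⟨y, hy⟩

lemma Nice.level {Q : Measure ℝ} (h : Nice Q) {t : ℝ} (h0 : 0 ≤ t) (h1 : t ≤ 1) :
    Q.real {y | sv Q y ≤ t} = t := by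
  have := h.prob
  rcases h0.eq_or_lt with rfl | h0
  · have : {y | sv Q y ≤ 0} = ∅ := by
      ext y; simp only [Set.mem_ofPred_eq, Set.mem_empty_iff_false, iff_false, not_le]; exact h.pos y
    rw [this]; simp
  rcases h1.eq_or_lt with rfl | h1
  · have : {y | sv Q y ≤ 1} = Set.univ := by
      ext y; simp only [Set.mem_ofPred_eq, Set.mem_univ, iff_true]; exact (h.lt_one y).le
    rw [this]; simp
  obtain ⟨y, hy⟩ := h.surj h0 h1
  have : {z | sv Q z ≤ t} = Set.Ici y := by
    ext z; simp only [Set.mem_ofPred_eq, Set.mem_Ici]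
    rw [← hy]; exact h.anti.le_iff_ge
  rw [this]; exact hy

lemma lab_lt {Q : Measure ℝ} (h : Nice Q) {m : ℕ} (hm : 0 < m) (y : ℝ) : ⌈(m:ℝ) * sv Q y⌉₊ - 1 < m := by
  have h1 : ⌈(m:ℝ) * sv Q y⌉₊ ≤ m := by
    rw [Nat.ceil_le]
    have := h.lt_one y
    have : (m:ℝ) * sv Q y ≤ m * 1 := by gcongr
    linarith
  omega

/-- the label -/
def lab {Q : Measure ℝ} (h : Nice Q) {m : ℕ} (hm : 0 < m) (y : ℝ) : Fin m :=
  ⟨⌈(m:ℝ) * sv Q y⌉₊ - 1, lab_lt h hm y⟩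

lemma lab_iff {Q : Measure ℝ} (h : Nice Q) {m : ℕ} (hm : 0 < m) (y : ℝ) (j : ℕ) :
    (lab h hm y : ℕ) < j ↔ sv Q y ≤ (j:ℝ) / m := by
  have hm0 : (0:ℝ) < m := by exact_mod_cast hm
  have h0 : 0 < ⌈(m:ℝ) * sv Q y⌉₊ := Nat.ceil_pos.2 (mul_pos hm0 (h.pos y))
  have : (lab h hm y : ℕ) < j ↔ ⌈(m:ℝ) * sv Q y⌉₊ ≤ j := by
    simp only [lab]; omega
  rw [this, Nat.ceil_le, le_div_iff₀ hm0, mul_comm]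

lemma lab_meas {Q : Measure ℝ} (h : Nice Q) {m : ℕ} (hm : 0 < m) : Measurable (lab h hm) := by
  refine measurable_to_countable' fun l => ?_
  have : lab h hm ⁻¹' {l} = {y | sv Q y ≤ ((l + 1 : ℕ):ℝ) / m} \ {y | sv Q y ≤ ((l:ℕ):ℝ) / m} := by
    ext y
    simp only [Set.mem_preimage, Set.mem_singleton_iff, Set.mem_sdiff, Set.mem_ofPred_eq, ← lab_iff h hm,
      Fin.ext_iff]
    omega
  rw [this]
  exact (measurableSet_le h.cont.measurable measurable_const).diff
    (measurableSet_le h.cont.measurable measurable_const)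

lemma lab_cell {Q : Measure ℝ} (h : Nice Q) {m : ℕ} (hm : 0 < m) (l : Fin m) :
    Q.real (lab h hm ⁻¹' {l}) = 1 / m := by
  have := h.prob
  have hm0 : (0:ℝ) < m := by exact_mod_cast hm
  have : lab h hm ⁻¹' {l} = {y | sv Q y ≤ ((l + 1 : ℕ):ℝ) / m} \ {y | sv Q y ≤ ((l:ℕ):ℝ) / m} := by
    ext y
    simp only [Set.mem_preimage, Set.mem_singleton_iff, Set.mem_sdiff, Set.mem_ofPred_eq, ← lab_iff h hm,
      Fin.ext_iff]
    omega
  have hl : ((l + 1 : ℕ):ℝ) ≤ m := by exact_mod_cast l.2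
  rw [this, measureReal_sdiff _ (measurableSet_le h.cont.measurable measurable_const), h.level, h.level]
  · push_cast; field_simp; ring
  · positivity
  · rw [div_le_one hm0]; push_cast at hl; linarith
  · positivity
  · rw [div_le_one hm0]; exact hl
  · intro y hy
    simp only [Set.mem_ofPred_eq] at *
    refine hy.trans ?_
    gcongr; omega

/-- Event that the empirical process of `Y` stays inside the band on the grid. -/
def gridE (Q : Measure ℝ) (n m J0 J1 : ℕ) (u : ℝ) : Set (Fin n → ℝ) :=
  {Y | ∀ j, J0 ≤ j → j ≤ J1 → ∀ y, sv Q y = (j:ℝ) / m →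
    |(Ncnt Y y : ℝ) - n * sv Q y| ≤ u * √(n * sv Q y * (1 - sv Q y))}

lemma grid_prob {Q : Measure ℝ} (h : Nice Q) {n m J0 J1 : ℕ} {u : ℝ} (hnm : n ≤ m) (hJ0 : 1 ≤ J0)
    (hJ1 : J1 < m) :
    |(Measure.pi fun _ : Fin n => Q).real (gridE Q n m J0 J1 u) -
      (latA (alv n m J0 J1 u) m n : ℝ) / (m.choose n : ℝ)| ≤ (n:ℝ) ^ 2 / m := by
  have := h.prob
  have hm : 0 < m := by omega
  have hm0 : (0:ℝ) < m := by exact_mod_cast hm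
  have := link hnm hm Q (lab h hm) (lab_meas h hm) (lab_cell h hm) (alv n m J0 J1 u)
  convert this using 5
  ext Y
  have key : ∀ (j : ℕ) (y : ℝ), sv Q y = (j:ℝ) / m → cntF (fun i => lab h hm (Y i)) j = Ncnt Y y := by
    intro j y hy
    unfold cntF Ncnt
    congr 1
    ext i
    simp only [Finset.mem_filter, Finset.mem_univ, true_and]
    rw [lab_iff, ← hy]
    exact h.anti.le_iff_ge
  simp only [gridE, Set.mem_ofPred_eq, alv, Finset.mem_Icc]
  constructor
  · intro H j hj h0 h1
    have hj0 : (0:ℝ) < (j:ℝ) / m := by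
      have : (0:ℝ) < j := by exact_mod_cast (by omega : 0 < j)
      positivity
    have hj1 : (j:ℝ) / m < 1 := by
      rw [div_lt_one hm0]; exact_mod_cast (by omega : j < m)
    obtain ⟨y, hy⟩ := h.surj hj0 hj1
    have := H j h0 h1 y hy
    rw [key j y hy, ← mul_div_assoc'] 
    rw [hy] at this
    exact this
  · intro H j h0 h1 y hy
    have := H j ⟨by omega, by omega⟩ h0 h1
    rw [key j y hy, ← mul_div_assoc'] at this
    rw [hy]; exact this

end

open MeasureTheory Filter Topology ProbabilityTheory

noncomputable section

lemma nice_gauss (μ : ℝ) {v : NNReal} (hv : v ≠ 0) : Nice (gaussianReal μ v) where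
  prob := inferInstance
  noat := nullSingletonClass_gaussianReal hv
  abc := gaussianReal_absolutelyContinuous' μ hv

/-- standard normal survival function -/
def BB (y : ℝ) : ℝ := sv (gaussianReal 0 1) y

lemma niceB : Nice (gaussianReal 0 1) := nice_gauss 0 one_ne_zero

lemma one_sub_Phi (y : ℝ) : 1 - Phi y = BB y := by
  have := niceB.noat
  rw [BB, sv_eq, Phi, cdf_eq_real, measureReal_def]

lemma ind_bound {b t : ℝ} (hb0 : 0 < b) (hb1 : b < 1) (ht0 : 0 < t) (ht1 : t < 1) :
    |(if b ≤ t then (1:ℝ) else 0) - t| ≤ (1 / b + 1 / (1 - b)) * √(t * (1 - t)) := by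
  have hs : t * (1 - t) ≤ √(t * (1 - t)) := by
    refine Real.le_sqrt_of_sq_le ?_
    have : t * (1 - t) ≤ 1 := by nlinarith
    have h0 : 0 ≤ t * (1 - t) := mul_nonneg ht0.le (by linarith)
    nlinarith
  set s := √(t * (1 - t))
  have hs0 : 0 ≤ s := Real.sqrt_nonneg _
  have h1b : 0 < 1 - b := by linarith
  have p1 : 0 ≤ 1 / b * s := by positivity
  have p2 : 0 ≤ 1 / (1 - b) * s := by positivity
  rw [add_mul]
  split_ifs with h
  · rw [abs_of_pos (by linarith)]
    have : 1 - t ≤ 1 / b * s := by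
      rw [one_div, inv_mul_eq_div, le_div_iff₀ hb0]; nlinarith
    linarith
  · push Not at h
    rw [zero_sub, abs_neg, abs_of_pos ht0]
    have : t ≤ 1 / (1 - b) * s := by
      rw [one_div, inv_mul_eq_div, le_div_iff₀ h1b]; nlinarith
    linarith

lemma HC_bdd {n : ℕ} (hn : 1 ≤ n) (Y : Fin n → ℝ) : BddAbove (Set.range fun t : Set.Ioo (0 : ℝ) 1 =>
    |Real.sqrt n * (empCdfNormal n Y t.1 - t.1) / Real.sqrt (t.1 * (1 - t.1))|) := by
  have hn0 : (0:ℝ) < n := by exact_mod_cast hn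
  refine ⟨√n * ((∑ i, (1 / BB (Y i) + 1 / (1 - BB (Y i)))) / n), ?_⟩
  rintro _ ⟨⟨t, ht0, ht1⟩, rfl⟩
  have hs : 0 < √(t * (1 - t)) := Real.sqrt_pos.2 (mul_pos ht0 (by linarith))
  simp only
  rw [abs_div, abs_of_pos hs, div_le_iff₀ hs, abs_mul, abs_of_nonneg (Real.sqrt_nonneg _), mul_assoc]
  refine mul_le_mul_of_nonneg_left ?_ (Real.sqrt_nonneg _)
  have e : empCdfNormal n Y t - t = (∑ i : Fin n, ((if BB (Y i) ≤ t then (1 : ℝ) else 0) - t)) / n := by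
    rw [empCdfNormal, Finset.sum_sub_distrib]
    simp only [one_sub_Phi, Finset.sum_const, Finset.card_univ, Fintype.card_fin, nsmul_eq_mul]
    field_simp
  rw [e, abs_div, abs_of_pos hn0, div_mul_eq_mul_div]
  refine div_le_div_of_nonneg_right ?_ hn0.le
  rw [Finset.sum_mul]
  refine (Finset.abs_sum_le_sum_abs _ _).trans (Finset.sum_le_sum fun i _ => ?_)
  exact ind_bound (niceB.pos _) (niceB.lt_one _) ht0 ht1

/-- band event -/
def bandE (n : ℕ) (u : ℝ) : Set (Fin n → ℝ) :=
  {Y | ∀ y, |(Ncnt Y y : ℝ) - n * BB y| ≤ u * √(n * BB y * (1 - BB y))}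

lemma HC_event {n : ℕ} (hn : 1 ≤ n) (ha : 0 < aHC n) (x : ℝ) :
    {Y : Fin n → ℝ | aHC n * HCnormal n Y - bHC n ≤ x} = bandE n (uu x n) := by
  have hn0 : (0:ℝ) < n := by exact_mod_cast hn
  ext Y
  simp only [Set.mem_ofPred_eq, bandE]
  have h1 : aHC n * HCnormal n Y - bHC n ≤ x ↔ HCnormal n Y ≤ uu x n := by
    rw [uu, le_div_iff₀ ha]
    constructor <;> intro h <;> linarith
  have hne : Nonempty (Set.Ioo (0:ℝ) 1) := ⟨⟨1/2, by norm_num, by norm_num⟩⟩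
  rw [h1, HCnormal, ciSup_le_iff (HC_bdd hn Y)]
  have key : ∀ y, |Real.sqrt n * (empCdfNormal n Y (BB y) - BB y) / Real.sqrt (BB y * (1 - BB y))| ≤ uu x n ↔
      |(Ncnt Y y : ℝ) - n * BB y| ≤ uu x n * √(n * BB y * (1 - BB y)) := by
    intro y
    have hb0 : 0 < BB y := niceB.pos y
    have hb1 : BB y < 1 := niceB.lt_one y
    have hs : 0 < √(BB y * (1 - BB y)) := Real.sqrt_pos.2 (mul_pos hb0 (by linarith))
    have hsn : 0 < √(n:ℝ) := Real.sqrt_pos.2 hn0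
    have e : empCdfNormal n Y (BB y) = (Ncnt Y y : ℝ) / n := by
      rw [empCdfNormal, Ncnt, Finset.sum_boole]
      congr 3
      ext i
      simp only [Finset.mem_filter, Finset.mem_univ, true_and, one_sub_Phi]
      exact niceB.anti.le_iff_ge
    rw [e, abs_div, abs_of_pos hs, div_le_iff₀ hs, abs_mul, abs_of_pos hsn, mul_assoc (n:ℝ),
      Real.sqrt_mul hn0.le]
    have e2 : (Ncnt Y y : ℝ) / n - BB y = ((Ncnt Y y : ℝ) - n * BB y) / n := by field_simp
    rw [e2, abs_div, abs_of_pos hn0]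
    have e3 : √(n:ℝ) * (|(Ncnt Y y : ℝ) - n * BB y| / n) = |(Ncnt Y y : ℝ) - n * BB y| / √n := by
      have : √(n:ℝ) * √n = n := Real.mul_self_sqrt hn0.le
      field_simp
      linear_combination |(Ncnt Y y : ℝ) - n * BB y| * this
    rw [e3, div_le_iff₀ hsn]
    constructor <;> intro h <;> linarith
  constructor
  · intro h y
    rw [← key]
    exact h ⟨BB y, niceB.pos y, niceB.lt_one y⟩
  · rintro h ⟨t, ht0, ht1⟩
    obtain ⟨y, hy⟩ := niceB.surj ht0 ht1
    have := (key y).2 (h y)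
    have hy' : BB y = t := hy
    rw [hy'] at this
    exact this

end

open MeasureTheory Filter Topology ProbabilityTheory

noncomputable section

open Classical in
/-- number of observations in `A` -/
def cA {n : ℕ} (Y : Fin n → ℝ) (A : Set ℝ) : ℕ := (Finset.univ.filter fun i => Y i ∈ A).card

lemma cA_mono {n : ℕ} (Y : Fin n → ℝ) {A B : Set ℝ} (h : A ⊆ B) : cA Y A ≤ cA Y B := by
  unfold cA
  refine Finset.card_le_card fun i hi => ?_
  simp only [Finset.mem_filter, Finset.mem_univ, true_and] at *
  exact h hi

open Classical in
lemma cA_sum {n : ℕ} (Y : Fin n → ℝ) (A : Set ℝ) :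
    (cA Y A : ℝ) = ∑ i, A.indicator (fun _ => (1:ℝ)) (Y i) := by
  unfold cA
  rw [Finset.card_filter]
  push_cast
  refine Finset.sum_congr rfl fun i _ => ?_
  simp [Set.indicator_apply]

lemma cA_meas {n : ℕ} {A : Set ℝ} (hA : MeasurableSet A) :
    Measurable fun Y : Fin n → ℝ => (cA Y A : ℝ) := by
  simp only [cA_sum]
  refine Finset.measurable_sum _ fun i _ => ?_
  exact (measurable_const.indicator hA).comp (measurable_pi_apply i)

lemma bern_mgf {Q : Measure ℝ} [IsProbabilityMeasure Q] {A : Set ℝ} (hA : MeasurableSet A) {θ : ℝ}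
    (hθ : |θ| ≤ 1) :
    Integrable (fun y => Real.exp (θ * (A.indicator (fun _ => (1:ℝ)) y - Q.real A))) Q ∧
    ∫ y, Real.exp (θ * (A.indicator (fun _ => (1:ℝ)) y - Q.real A)) ∂Q ≤
      Real.exp (Q.real A * θ ^ 2) := by
  set q := Q.real A with hq
  have hq0 : 0 ≤ q := measureReal_nonneg
  have e : (fun y => Real.exp (θ * (A.indicator (fun _ => (1:ℝ)) y - q))) =
      fun y => Real.exp (-(θ * q)) + A.indicator (fun _ => Real.exp (-(θ * q)) * (Real.exp θ - 1)) y := by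
    funext y
    by_cases hy : y ∈ A
    · rw [Set.indicator_of_mem hy, Set.indicator_of_mem hy,
        show θ * (1 - q) = -(θ * q) + θ by ring, Real.exp_add]; ring
    · rw [Set.indicator_of_notMem hy, Set.indicator_of_notMem hy]; ring_nf
  have hi : Integrable (A.indicator (fun _ : ℝ => Real.exp (-(θ * q)) * (Real.exp θ - 1))) Q :=
    (integrable_const _).indicator hA
  rw [e]
  refine ⟨(integrable_const _).add hi, ?_⟩
  rw [integral_add (integrable_const _) hi, integral_indicator_const _ hA, integral_const]
  simp only [probReal_univ, one_smul, smul_eq_mul, ← hq]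
  have h1 : 1 + q * (Real.exp θ - 1) ≤ Real.exp (q * (Real.exp θ - 1)) := by
    have := Real.add_one_le_exp (q * (Real.exp θ - 1)); linarith
  have h2 : Real.exp θ - 1 - θ ≤ θ ^ 2 := (le_abs_self _).trans (Real.abs_exp_sub_one_sub_id_le hθ)
  calc _ = Real.exp (-(θ * q)) * (1 + q * (Real.exp θ - 1)) := by ring
    _ ≤ Real.exp (-(θ * q)) * Real.exp (q * (Real.exp θ - 1)) := by gcongr
    _ = Real.exp (q * (Real.exp θ - 1 - θ)) := by rw [← Real.exp_add]; ring_nf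
    _ ≤ _ := by gcongr

lemma chern1 {n : ℕ} {Q : Measure ℝ} [IsProbabilityMeasure Q] {A : Set ℝ} (hA : MeasurableSet A) {θ a : ℝ}
    (hθ : |θ| ≤ 1) :
    (Measure.pi fun _ : Fin n => Q).real {Y | a ≤ θ * ((cA Y A : ℝ) - n * Q.real A)} ≤
      Real.exp (n * Q.real A * θ ^ 2 - a) := by
  obtain ⟨hi, hb⟩ := bern_mgf (Q := Q) hA hθ
  set f : ℝ → ℝ := fun y => Real.exp (θ * (A.indicator (fun _ => (1:ℝ)) y - Q.real A)) with hf
  have hprod : ∀ Y : Fin n → ℝ, Real.exp (θ * ((cA Y A : ℝ) - n * Q.real A)) = ∏ i, f (Y i) := by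
    intro Y
    rw [← Real.exp_sum, ← Finset.mul_sum, Finset.sum_sub_distrib, cA_sum]
    simp
  have hI : Integrable (fun Y : Fin n → ℝ => ∏ i, f (Y i)) (Measure.pi fun _ : Fin n => Q) :=
    Integrable.fintype_prod (fun _ => hi)
  have hIntEq : ∫ Y : Fin n → ℝ, ∏ i, f (Y i) ∂(Measure.pi fun _ : Fin n => Q) ≤
      Real.exp (n * Q.real A * θ ^ 2) := by
    rw [integral_fintype_prod_eq_prod (fun _ => f)]
    simp only [Finset.prod_const, Finset.card_univ, Fintype.card_fin]
    calc _ ≤ (Real.exp (Q.real A * θ ^ 2)) ^ n :=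
          pow_le_pow_left₀ (integral_nonneg fun y => (Real.exp_pos _).le) hb n
      _ = _ := by rw [← Real.exp_nat_mul]; ring_nf
  have hM := mul_meas_ge_le_integral_of_nonneg (Eventually.of_forall fun Y =>
    Finset.prod_nonneg fun i _ => (Real.exp_pos _).le) hI (Real.exp a)
  have hset : {Y : Fin n → ℝ | a ≤ θ * ((cA Y A : ℝ) - n * Q.real A)} =
      {Y | Real.exp a ≤ ∏ i, f (Y i)} := by
    ext Y; simp only [Set.mem_ofPred_eq]; rw [← hprod, Real.exp_le_exp]
  rw [hset, Real.exp_sub, le_div_iff₀ (Real.exp_pos a), mul_comm]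
  exact hM.trans hIntEq

lemma chern {n : ℕ} {Q : Measure ℝ} [IsProbabilityMeasure Q] {A : Set ℝ} (hA : MeasurableSet A) {s c u : ℝ}
    (hs : 1 ≤ s) (hq : n * Q.real A ≤ c * s) :
    (Measure.pi fun _ : Fin n => Q).real {Y | u * √s < |(cA Y A : ℝ) - n * Q.real A|} ≤
      2 * Real.exp (c - u) := by
  have hr : 1 ≤ √s := by rw [Real.one_le_sqrt]; exact hs
  have hr0 : 0 < √s := by linarith
  have hθ : |1 / √s| ≤ 1 := by
    rw [abs_of_pos (by positivity), div_le_one hr0]; exact hr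
  have h2 : (1 / √s) ^ 2 = 1 / s := by rw [div_pow, one_pow, Real.sq_sqrt (by linarith)]
  have h3 : n * Q.real A * (1 / s) ≤ c := by
    rw [mul_one_div, div_le_iff₀ (by linarith)]; exact hq
  have h4 : n * Q.real A * (1 / √s) ^ 2 - u ≤ c - u := by rw [h2]; linarith
  have h4' : n * Q.real A * (-(1 / √s)) ^ 2 - u ≤ c - u := by rw [neg_sq, h2]; linarith
  have c1 := (chern1 (n := n) (Q := Q) hA (a := u) hθ).trans (Real.exp_le_exp.2 h4)
  have c2 := (chern1 (n := n) (Q := Q) hA (θ := -(1 / √s)) (a := u) (by rwa [abs_neg])).trans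
    (Real.exp_le_exp.2 h4')
  have hsub : {Y : Fin n → ℝ | u * √s < |(cA Y A : ℝ) - n * Q.real A|} ⊆
      {Y | u ≤ (1 / √s) * ((cA Y A : ℝ) - n * Q.real A)} ∪
      {Y | u ≤ (-(1 / √s)) * ((cA Y A : ℝ) - n * Q.real A)} := by
    intro Y hY
    simp only [Set.mem_ofPred_eq, Set.mem_union] at *
    rcases lt_abs.1 hY with h | h
    · left
      rw [one_div, inv_mul_eq_div, le_div_iff₀ hr0]; exact h.le
    · right
      rw [neg_mul, ← mul_neg, one_div, inv_mul_eq_div, le_div_iff₀ hr0]; exact h.le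
  refine (measureReal_mono hsub).trans ((measureReal_union_le _ _).trans ?_)
  linarith

lemma markovA {n : ℕ} {Q : Measure ℝ} [IsProbabilityMeasure Q] {A : Set ℝ} (hA : MeasurableSet A) {a : ℝ}
    (ha : 0 < a) :
    (Measure.pi fun _ : Fin n => Q).real {Y | a ≤ (cA Y A : ℝ)} ≤ n * Q.real A / a := by
  have hi : ∀ i : Fin n, Integrable (fun Y : Fin n → ℝ => A.indicator (fun _ => (1:ℝ)) (Y i))
      (Measure.pi fun _ : Fin n => Q) := by
    intro i
    have := (integrable_const (μ := Measure.pi fun _ : Fin n => Q) (1:ℝ)).indicator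
      (measurable_pi_apply i hA)
    refine this.congr (Eventually.of_forall fun Y => ?_)
    rfl
  have hI : Integrable (fun Y : Fin n → ℝ => (cA Y A : ℝ)) (Measure.pi fun _ : Fin n => Q) := by
    simp only [cA_sum]
    exact integrable_finsetSum _ fun i _ => hi i
  have hIntEq : ∫ Y : Fin n → ℝ, (cA Y A : ℝ) ∂(Measure.pi fun _ : Fin n => Q) = n * Q.real A := by
    simp only [cA_sum]
    rw [integral_finsetSum _ fun i _ => hi i]
    have : ∀ i : Fin n, ∫ Y : Fin n → ℝ, A.indicator (fun _ => (1:ℝ)) (Y i)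
        ∂(Measure.pi fun _ : Fin n => Q) = Q.real A := by
      intro i
      have h1 : ∫ y, A.indicator (fun _ => (1:ℝ)) y ∂Q = Q.real A := by
        rw [integral_indicator_const _ hA]; simp
      rw [← h1]
      have h2 := (measurePreserving_eval (fun _ : Fin n => Q) i).map_eq
      conv_rhs => rw [← h2]
      rw [integral_map (measurable_pi_apply i).aemeasurable
        (measurable_const.indicator hA).aestronglyMeasurable]
    simp [this]
  have := mul_meas_ge_le_integral_of_nonneg (Eventually.of_forall fun Y : Fin n → ℝ =>
    (Nat.cast_nonneg (α := ℝ) (cA Y A))) hI a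
  rw [hIntEq] at this
  rw [le_div_iff₀ ha, mul_comm]
  exact this

end

open MeasureTheory Filter Topology ProbabilityTheory

noncomputable section

lemma edge_finite {n : ℕ} {Q : Measure ℝ} [IsProbabilityMeasure Q] {A : ℝ → Set ℝ}
    (hA : ∀ s, MeasurableSet (A s)) (hmono : Monotone A) {s1 K1 u C2 η : ℝ} {S1 : ℕ}
    (hS : (S1 + 1 : ℝ) ≤ n / 2) (hs1 : 0 < s1) (hs1' : s1 ≤ 1)
    (h1 : n * Q.real (A s1) ≤ η) (hC0 : 0 ≤ C2)
    (hC : ∀ s : ℝ, 1 ≤ s → s ≤ S1 + 1 → |n * Q.real (A s) - s| ≤ C2 * √s)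
    (hK : 1 ≤ K1) (hKu : K1 ≤ u * √(s1 / 2)) (hu : 4 + 8 * C2 ≤ u) :
    (Measure.pi fun _ : Fin n => Q).real
      {Y | ∃ s : ℝ, 0 < s ∧ s ≤ S1 ∧ u * √(s * (1 - s / n)) < |(cA Y (A s) : ℝ) - s|} ≤
    η + (1 + C2) / K1 + (S1 + 1) * (2 * Real.exp (1 + C2 - u / 4)) := by
  have hn0 : (0:ℝ) < n := by
    have : (0:ℝ) ≤ S1 := Nat.cast_nonneg _
    linarith
  set μ := (Measure.pi fun _ : Fin n => Q) with hμ
  have hu4 : 4 ≤ u := by linarith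
  have hsub : {Y : Fin n → ℝ | ∃ s : ℝ, 0 < s ∧ s ≤ S1 ∧ u * √(s * (1 - s / n)) < |(cA Y (A s) : ℝ) - s|} ⊆
      ({Y | (1:ℝ) ≤ (cA Y (A s1) : ℝ)} ∪ {Y | K1 ≤ (cA Y (A 1) : ℝ)}) ∪
      ⋃ i ∈ Finset.range (S1 + 1), {Y | u / 4 * √((i + 1 : ℕ):ℝ) <
        |(cA Y (A ((i + 1 : ℕ):ℝ)) : ℝ) - n * Q.real (A ((i + 1 : ℕ):ℝ))|} := by
    rintro Y ⟨s, hs0, hs, hbad⟩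
    by_contra hcon
    simp only [Set.mem_union, Set.mem_iUnion, Set.mem_ofPred_eq, exists_prop, Finset.mem_range,
      not_or, not_exists, not_and, not_lt, not_le] at hcon
    obtain ⟨⟨g1, g2⟩, g3⟩ := hcon
    have hsn : 1 / 2 ≤ 1 - s / n := by
      have : s / n ≤ 1 / 2 := by rw [div_le_iff₀ hn0]; linarith
      linarith
    have hhalf : s / 2 ≤ s * (1 - s / n) := by nlinarith
    have hroot : √(s / 2) ≤ √(s * (1 - s / n)) := Real.sqrt_le_sqrt hhalf
    refine absurd hbad (not_lt.2 ?_)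
    refine le_trans ?_ (mul_le_mul_of_nonneg_left hroot (by linarith : 0 ≤ u))
    have hc0 : (0:ℝ) ≤ cA Y (A s) := Nat.cast_nonneg _
    rcases lt_or_ge s s1 with c1 | c1
    · have : (cA Y (A s) : ℝ) < 1 := lt_of_le_of_lt (by exact_mod_cast cA_mono Y (hmono c1.le)) g1
      have h0 : cA Y (A s) = 0 := by
        have : cA Y (A s) < 1 := by exact_mod_cast this
        omega
      rw [h0, Nat.cast_zero, zero_sub, abs_neg, abs_of_pos hs0]
      have : s / 4 ≤ √(s / 2) := Real.le_sqrt_of_sq_le (by nlinarith)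
      nlinarith
    rcases lt_or_ge s 1 with c2 | c2
    · have h3 : (cA Y (A s) : ℝ) < K1 := lt_of_le_of_lt (by exact_mod_cast cA_mono Y (hmono c2.le)) g2
      have h4 : |(cA Y (A s) : ℝ) - s| ≤ K1 := by rw [abs_le]; constructor <;> linarith
      have h5 : √(s1 / 2) ≤ √(s / 2) := Real.sqrt_le_sqrt (by linarith)
      exact h4.trans (hKu.trans (mul_le_mul_of_nonneg_left h5 (by linarith)))
    · set i := ⌊s⌋₊ with hi
      have hi1 : 1 ≤ i := Nat.le_floor (by exact_mod_cast c2)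
      have his : (i:ℝ) ≤ s := Nat.floor_le hs0.le
      have his' : s < i + 1 := Nat.lt_floor_add_one s
      have hiS : i ≤ S1 := by
        have : (i:ℝ) ≤ S1 := his.trans hs
        exact_mod_cast this
      have hiR : (1:ℝ) ≤ i := by exact_mod_cast hi1
      have hiSR : (i:ℝ) ≤ S1 := by exact_mod_cast hiS
      have u1 := g3 i (by omega)
      have u2 := g3 (i - 1) (by omega)
      rw [Nat.sub_add_cancel hi1] at u2
      have d1 := hC ((i + 1 : ℕ):ℝ) (by push_cast; linarith) (by push_cast; linarith)
      have d2 := hC (i:ℝ) hiR (by linarith)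
      have m1 : (cA Y (A s) : ℝ) ≤ cA Y (A ((i + 1 : ℕ):ℝ)) := by
        exact_mod_cast cA_mono Y (hmono (by push_cast; linarith))
      have m2 : (cA Y (A (i:ℝ)) : ℝ) ≤ cA Y (A s) := by exact_mod_cast cA_mono Y (hmono his)
      set r := √s with hr
      have hr1 : 1 ≤ r := by rw [hr, Real.one_le_sqrt]; exact c2
      have r1 : √((i + 1 : ℕ):ℝ) ≤ 1.42 * r := by
        rw [Real.sqrt_le_left (by linarith), mul_pow, hr, Real.sq_sqrt hs0.le]
        push_cast; norm_num; linarith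
      have r2 : √(i:ℝ) ≤ r := Real.sqrt_le_sqrt his
      have r3 : 0.7 * r ≤ √(s / 2) := by
        refine Real.le_sqrt_of_sq_le ?_
        rw [mul_pow, hr, Real.sq_sqrt hs0.le]; norm_num; linarith
      have hu1 := abs_le.1 u1
      have hu2 := abs_le.1 u2
      have hd1 := abs_le.1 d1
      have hd2 := abs_le.1 d2
      push_cast at hu1 hd1 r1 m1
      have k1 : (C2 + u / 4) * √((i:ℝ) + 1) ≤ (C2 + u / 4) * (1.42 * r) :=
        mul_le_mul_of_nonneg_left r1 (by linarith)
      have k2 : (C2 + u / 4) * √(i:ℝ) ≤ (C2 + u / 4) * r :=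
        mul_le_mul_of_nonneg_left r2 (by linarith)
      have k3 : u * (0.7 * r) ≤ u * √(s / 2) := mul_le_mul_of_nonneg_left r3 (by linarith)
      have k4 : (4 + 8 * C2) * r ≤ u * r := mul_le_mul_of_nonneg_right hu (by linarith)
      have k5 : 0 ≤ C2 * r := mul_nonneg hC0 (by linarith)
      rw [abs_le]
      constructor
      · linarith [hu2.1, hd2.1]
      · linarith [hu1.2, hd1.2]
  have b1 := markovA (n := n) (Q := Q) (hA s1) (a := 1) one_pos
  have b2 := markovA (n := n) (Q := Q) (hA 1) (a := K1) (by linarith)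
  have S1nn : (0:ℝ) ≤ S1 := Nat.cast_nonneg _
  have hq1 : n * Q.real (A 1) ≤ 1 + C2 := by
    have := (abs_le.1 (hC 1 le_rfl (by linarith))).2
    rw [Real.sqrt_one] at this; linarith
  have b3 : μ.real (⋃ i ∈ Finset.range (S1 + 1), {Y : Fin n → ℝ | u / 4 * √((i + 1 : ℕ):ℝ) <
        |(cA Y (A ((i + 1 : ℕ):ℝ)) : ℝ) - n * Q.real (A ((i + 1 : ℕ):ℝ))|}) ≤
      (S1 + 1) * (2 * Real.exp (1 + C2 - u / 4)) := by
    refine (measureReal_biUnion_finset_le _ _).trans ?_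
    have : ∀ i ∈ Finset.range (S1 + 1), μ.real {Y : Fin n → ℝ | u / 4 * √((i + 1 : ℕ):ℝ) <
        |(cA Y (A ((i + 1 : ℕ):ℝ)) : ℝ) - n * Q.real (A ((i + 1 : ℕ):ℝ))|} ≤
        2 * Real.exp (1 + C2 - u / 4) := by
      intro i hi
      rw [Finset.mem_range] at hi
      have hi' : (i:ℝ) ≤ S1 := by exact_mod_cast (by omega : i ≤ S1)
      have h1i : (1:ℝ) ≤ ((i + 1 : ℕ):ℝ) := by push_cast; linarith [Nat.cast_nonneg (α := ℝ) i]
      refine chern (hA _) h1i ?_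
      have h3 := (abs_le.1 (hC ((i + 1 : ℕ):ℝ) h1i (by push_cast; linarith))).2
      have h4 : √((i + 1 : ℕ):ℝ) ≤ ((i + 1 : ℕ):ℝ) := by
        rw [Real.sqrt_le_left (by linarith)]; nlinarith
      nlinarith
    refine (Finset.sum_le_sum this).trans ?_
    rw [Finset.sum_const, Finset.card_range, nsmul_eq_mul]; push_cast; exact le_rfl
  refine (measureReal_mono hsub).trans ?_
  refine (measureReal_union_le _ _).trans (add_le_add ((measureReal_union_le _ _).trans
    (add_le_add (b1.trans ?_) (b2.trans ?_))) b3)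
  · rw [div_one]; exact h1
  · gcongr

end

open MeasureTheory Filter Topology ProbabilityTheory

noncomputable section

lemma BB_int (y : ℝ) : BB y = ∫ t in Set.Ioi y, gaussianPDFReal 0 1 t := by
  rw [BB, sv, measureReal_def, gaussianReal_apply_eq_integral 0 one_ne_zero, ENNReal.toReal_ofReal
    (integral_nonneg fun t => gaussianPDFReal_nonneg _ _ _), integral_Ici_eq_integral_Ioi]

lemma pdf_eq (t : ℝ) : gaussianPDFReal 0 1 t = (√(2 * Real.pi))⁻¹ * Real.exp (-t ^ 2 / 2) := by
  simp [gaussianPDFReal]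

lemma sqrt2pi_ge : 1 ≤ √(2 * Real.pi) := by
  rw [Real.one_le_sqrt]; linarith [Real.pi_gt_three]

lemma sqrt2pi_le : √(2 * Real.pi) ≤ 3 := by
  rw [Real.sqrt_le_left (by norm_num)]; linarith [Real.pi_lt_four]

lemma BB_upper {y : ℝ} (hy : 0 < y) : BB y ≤ Real.exp (-y ^ 2 / 2) / y := by
  rw [BB_int]
  have hI : IntegrableOn (fun t => Real.exp (-y * t)) (Set.Ioi y) := by
    have := exp_neg_integrableOn_Ioi y hy
    exact this
  have hI2 : IntegrableOn (fun t => Real.exp (y ^ 2 / 2) * Real.exp (-y * t)) (Set.Ioi y) :=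
    hI.const_mul _
  have h1 : ∫ t in Set.Ioi y, gaussianPDFReal 0 1 t ≤
      ∫ t in Set.Ioi y, Real.exp (y ^ 2 / 2) * Real.exp (-y * t) := by
    refine setIntegral_mono (integrable_gaussianPDFReal 0 1).integrableOn hI2 fun t => ?_
    rw [pdf_eq, ← Real.exp_add]
    have h3 : (√(2 * Real.pi))⁻¹ ≤ 1 := inv_le_one_of_one_le₀ sqrt2pi_ge
    have h4 : Real.exp (-t ^ 2 / 2) ≤ Real.exp (y ^ 2 / 2 + -y * t) :=
      Real.exp_le_exp.2 (by nlinarith [sq_nonneg (t - y)])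
    nlinarith [Real.exp_pos (-t ^ 2 / 2)]
  refine h1.trans (le_of_eq ?_)
  rw [integral_const_mul, integral_exp_mul_Ioi (by linarith : -y < 0)]
  rw [show -y ^ 2 / 2 = y ^ 2 / 2 + -y * y by ring, Real.exp_add]
  field_simp

lemma BB_lower {y : ℝ} (hy : 0 ≤ y) : Real.exp (-y ^ 2 / 2 - 3) / (1 + y) ≤ BB y := by
  rw [BB_int]
  set d := 1 / (1 + y) with hd
  have hd0 : 0 < d := by positivity
  have hyd : y * d ≤ 1 := by
    rw [hd, mul_one_div, div_le_one (by positivity)]; linarith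
  have hd1 : d ≤ 1 := by
    rw [hd, div_le_one (by positivity)]; linarith
  have h1 : ∫ t in Set.Ioc y (y + d), gaussianPDFReal 0 1 t ≤ ∫ t in Set.Ioi y, gaussianPDFReal 0 1 t :=
    setIntegral_mono_set (integrable_gaussianPDFReal 0 1).integrableOn
      (Eventually.of_forall fun t => gaussianPDFReal_nonneg _ _ _)
      (Eventually.of_forall Set.Ioc_subset_Ioi_self)
  refine le_trans ?_ h1
  have h2 : ∫ t in Set.Ioc y (y + d), Real.exp (-y ^ 2 / 2 - 3) ≤ ∫ t in Set.Ioc y (y + d), gaussianPDFReal 0 1 t := by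
    refine setIntegral_mono_on (by simp) (integrable_gaussianPDFReal 0 1).integrableOn measurableSet_Ioc
      fun t ht => ?_
    rw [pdf_eq]
    have h3 : Real.exp (-y ^ 2 / 2 - 3 / 2) ≤ Real.exp (-t ^ 2 / 2) := by
      refine Real.exp_le_exp.2 ?_
      have : t ^ 2 ≤ (y + d) ^ 2 := by
        apply pow_le_pow_left₀ (by linarith [ht.1]) ht.2
      nlinarith
    have h4 : Real.exp (-(3:ℝ) / 2) ≤ (√(2 * Real.pi))⁻¹ := by
      rw [neg_div, Real.exp_neg]
      apply inv_anti₀ (by linarith [sqrt2pi_ge])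
      refine sqrt2pi_le.trans ?_
      have := Real.quadratic_le_exp_of_nonneg (show (0:ℝ) ≤ 3 / 2 by norm_num)
      norm_num at this ⊢
      linarith
    calc Real.exp (-y ^ 2 / 2 - 3) = Real.exp (-(3:ℝ)/2) * Real.exp (-y ^ 2 / 2 - 3 / 2) := by
          rw [← Real.exp_add]; congr 1; ring
      _ ≤ _ := mul_le_mul h4 h3 (Real.exp_pos _).le (by positivity)
  refine le_trans (le_of_eq ?_) h2
  rw [setIntegral_const, measureReal_def, Real.volume_Ioc, ENNReal.toReal_ofReal (by linarith)]
  simp only [smul_eq_mul, hd]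
  ring

lemma sv_gauss (θ : ℝ) {σ : ℝ} (hσ : 0 < σ) (y : ℝ) :
    sv (gaussianReal θ ⟨σ ^ 2, sq_nonneg σ⟩) y = BB ((y - θ) / σ) := by
  have e : gaussianReal θ ⟨σ ^ 2, sq_nonneg σ⟩ = (gaussianReal 0 1).map (fun z => σ * z + θ) := by
    have h1 := gaussianReal_map_const_mul (μ := 0) (v := 1) σ
    have h2 := gaussianReal_map_add_const (μ := σ * 0) (v := NNReal.mk (σ ^ 2) (sq_nonneg σ) * 1) θ
    rw [← h1, Measure.map_map (by fun_prop) (by fun_prop)] at h2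
    rw [show (fun z : ℝ => σ * z + θ) = (fun x => x + θ) ∘ (fun x => σ * x) from rfl, h2, mul_zero, zero_add, mul_one]
    rfl
  rw [sv, e, BB, sv, map_measureReal_apply (by fun_prop) measurableSet_Ici]
  congr 1
  ext z
  simp only [Set.mem_preimage, Set.mem_Ici]
  rw [div_le_iff₀ hσ]
  constructor <;> intro h <;> linarith

lemma BB_neg (y : ℝ) : BB (-y) = 1 - BB y := by
  have := niceB.noat
  have e : gaussianReal 0 1 = (gaussianReal 0 1).map (fun z => -z) := by
    rw [gaussianReal_map_neg]; simp
  have e2 : BB (-y) = (gaussianReal 0 1).real (Set.Iic y) := by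
    rw [BB, sv]
    conv_lhs => rw [e]
    rw [map_measureReal_apply (by fun_prop) measurableSet_Ici]
    congr 1
    ext z; simp
  rw [e2, BB, sv_eq, cdf_eq_real]; ring
lemma BB_anti {y z : ℝ} (h : y ≤ z) : BB z ≤ BB y := niceB.anti.antitone h
end

open MeasureTheory Filter Topology ProbabilityTheory

noncomputable section

lemma params {β σ : ℝ} (hβ : β ∈ Set.Ioo (1 / 2 : ℝ) 1) (hσ : 0 < σ) (hr : 0 < rhoNormal β σ) :
    ∃ κ : ℝ, 0 < κ ∧ κ < 1 / 2 ∧ rhoNormal β σ < 2 * β - 1 ∧ ∀ T ℓ y : ℝ,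
      ((1 - β) * (T ^ 2 / 2) + Eexp β σ * ℓ - ℓ / 2 - (y - √(rhoNormal β σ) * T) ^ 2 / (2 * σ ^ 2) ≤
        κ * (T ^ 2 / 2 - ℓ / 2 - y ^ 2 / 2) ∨
      (1 - β) * (T ^ 2 / 2) + Eexp β σ * ℓ - ℓ / 2 - (y - √(rhoNormal β σ) * T) ^ 2 / (2 * σ ^ 2) ≤
        -(ℓ / 4) + 1 / 2 * (T ^ 2 / 2 - ℓ / 2 - y ^ 2 / 2)) := by
  obtain ⟨hb1, hb2⟩ := hβ
  have hσ2 : 0 < σ ^ 2 := by positivity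
  by_cases hlin : σ < √2 ∧ β ≤ 1 - σ ^ 2 / 4
  · have hE : Eexp β σ = 0 := by rw [Eexp, if_pos hlin]
    have hR : rhoNormal β σ = (2 - σ ^ 2) * (β - 1 / 2) := by
      rw [rhoNormal, if_pos hlin.1, if_pos hlin.2]
    have hs2 : σ ^ 2 < 2 := by
      have := (Real.lt_sqrt hσ.le).1 hlin.1
      exact this
    refine ⟨1 / 4, by norm_num, by norm_num, by rw [hR]; nlinarith, fun T ℓ y => Or.inr ?_⟩
    rw [hE]
    set R := √(rhoNormal β σ) with hRd
    have hR2 : R ^ 2 = (2 - σ ^ 2) * (β - 1 / 2) := by rw [hRd, Real.sq_sqrt hr.le, hR]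
    have ha : 0 < 1 - σ ^ 2 / 2 := by linarith
    have ha2 : 2 - σ ^ 2 ≠ 0 := by linarith
    have key : -(σ ^ 2 * (β - 1 / 2) * T ^ 2) - (y - R * T) ^ 2 + σ ^ 2 * y ^ 2 / 2 =
        -(((1 - σ ^ 2 / 2) * y - R * T) ^ 2 / (1 - σ ^ 2 / 2)) := by
      have hb : β - 1 / 2 = R ^ 2 / (2 * (1 - σ ^ 2 / 2)) := by
        rw [hR2]; field_simp
      rw [hb]; field_simp; ring
    have key2 : 0 ≤ ((1 - σ ^ 2 / 2) * y - R * T) ^ 2 / (1 - σ ^ 2 / 2) := by positivity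
    have key3 : (y - R * T) ^ 2 / (2 * σ ^ 2) * (2 * σ ^ 2) = (y - R * T) ^ 2 := by field_simp
    have h5 : ((y - R * T) ^ 2 / (2 * σ ^ 2)) ≥ (1 / 2 - β) * (T ^ 2 / 2) + y ^ 2 / 4 := by
      by_contra hc
      push Not at hc
      have := mul_lt_mul_of_pos_right hc (show 0 < 2 * σ ^ 2 by positivity)
      rw [key3] at this
      nlinarith
    linarith
  · have hE : Eexp β σ = 1 / 2 - Real.sqrt (1 - β) / (2 * σ) := by rw [Eexp, if_neg hlin]
    set q := √(1 - β) with hq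
    have hq0 : 0 < q := Real.sqrt_pos.2 (by linarith)
    have hq2 : q ^ 2 = 1 - β := Real.sq_sqrt (by linarith)
    have hfact : rhoNormal β σ = (1 - σ * q) ^ 2 ∧ q / σ < 1 / 2 ∧ q * σ < 1 := by
      by_cases h1 : σ < √2
      · have h2 : ¬ β ≤ 1 - σ ^ 2 / 4 := fun h => hlin ⟨h1, h⟩
        have hs2 : σ ^ 2 < 2 := (Real.lt_sqrt hσ.le).1 h1
        have hqs : q < σ / 2 := by
          push Not at h2
          refine lt_of_pow_lt_pow_left₀ 2 (by positivity) ?_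
          rw [hq2]; linarith [show (σ / 2) ^ 2 = σ ^ 2 / 4 by ring]
        refine ⟨by rw [rhoNormal, if_pos h1, if_neg h2], ?_, by nlinarith⟩
        rw [div_lt_iff₀ hσ]; linarith
      · have hs2 : 2 ≤ σ ^ 2 := by
          push Not at h1
          exact (Real.sqrt_le_left hσ.le).1 h1
        have h2 : ¬ β ≤ 1 - 1 / σ ^ 2 := by
          intro h
          rw [rhoNormal, if_neg h1, if_pos h] at hr
          exact lt_irrefl _ hr
        push Not at h2
        have h3 : (q * σ) ^ 2 < 1 := by
          have : q ^ 2 < 1 / σ ^ 2 := by rw [hq2]; linarith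
          rw [lt_div_iff₀ hσ2] at this
          rw [mul_pow]; exact this
        have h4 : q * σ < 1 := by
          have : 0 < q * σ := by positivity
          nlinarith
        refine ⟨by rw [rhoNormal, if_neg h1, if_neg (not_le.2 h2)], ?_, h4⟩
        rw [div_lt_iff₀ hσ]
        nlinarith
    obtain ⟨hR, hk, hqs⟩ := hfact
    have hκ0 : 0 < q / σ := by positivity
    set κ := q / σ with hκ
    have hqκ : q = κ * σ := by rw [hκ]; field_simp
    have hRs : √(rhoNormal β σ) = 1 - σ ^ 2 * κ := by
      rw [hR, Real.sqrt_sq (by linarith), hqκ]; ring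
    have hbκ : 1 - β = σ ^ 2 * κ ^ 2 := by rw [← hq2, hqκ]; ring
    have hE' : Eexp β σ = 1 / 2 - κ / 2 := by
      rw [hE, hκ]; field_simp
    refine ⟨κ, hκ0, hk, ?_, fun T ℓ y => Or.inl ?_⟩
    · have h1 : 2 * q < σ := by
        rw [hqκ]; nlinarith
      have h2 : 1 - σ * q < 1 - 2 * q ^ 2 := by nlinarith
      rw [hR, show 2 * β - 1 = 1 - 2 * q ^ 2 by rw [hq2]; ring]
      nlinarith
    · rw [hRs, hbκ, hE']
      have e : σ ^ 2 * κ ^ 2 * (T ^ 2 / 2) + (1 / 2 - κ / 2) * ℓ - ℓ / 2 -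
          (y - (1 - σ ^ 2 * κ) * T) ^ 2 / (2 * σ ^ 2) - κ * (T ^ 2 / 2 - ℓ / 2 - y ^ 2 / 2) =
          -((1 - κ * σ ^ 2) * (y - T) ^ 2 / (2 * σ ^ 2)) := by
        field_simp; ring
      have h0 : 0 ≤ (1 - κ * σ ^ 2) * (y - T) ^ 2 / (2 * σ ^ 2) := by
        have : 0 ≤ 1 - κ * σ ^ 2 := by
          have : q * σ = κ * σ ^ 2 := by rw [hqκ]; ring
          linarith
        positivity
      linarith

end

open MeasureTheory Filter Topology ProbabilityTheory

noncomputable section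

lemma BB_pos (y : ℝ) : 0 < BB y := niceB.pos y
lemma BB_lt_one (y : ℝ) : BB y < 1 := niceB.lt_one y

lemma BB_low2 {L M y : ℝ} (hL : 1 ≤ L) (hM : 0 ≤ M) (hy : 0 ≤ y) (hyM : y ≤ M * √L) :
    Real.exp (-(y ^ 2 / 2) - Real.log L / 2 - (3 + Real.log (1 + M))) ≤ BB y := by
  refine le_trans ?_ (BB_lower hy)
  have h1 : Real.exp (Real.log L / 2) = √L := by
    rw [Real.sqrt_eq_rpow, Real.rpow_def_of_pos (by linarith)]; congr 1; ring
  have h2 : 1 ≤ √L := by rw [Real.one_le_sqrt]; exact hL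
  have h3 : 1 + y ≤ (1 + M) * √L := by linarith [mul_nonneg hM (Real.sqrt_nonneg L)]
  rw [le_div_iff₀ (by linarith)]
  calc _ ≤ Real.exp (-(y ^ 2 / 2) - Real.log L / 2 - (3 + Real.log (1 + M))) * ((1 + M) * √L) :=
        mul_le_mul_of_nonneg_left h3 (Real.exp_pos _).le
    _ = Real.exp (-(y ^ 2 / 2) - Real.log L / 2 - (3 + Real.log (1 + M))) *
        (Real.exp (Real.log (1 + M)) * Real.exp (Real.log L / 2)) := by
        rw [h1, Real.exp_log (by linarith)]
    _ = Real.exp (-y ^ 2 / 2 - 3) := by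
        rw [← Real.exp_add, ← Real.exp_add]; congr 1; ring
    _ ≤ _ := le_rfl

lemma LL_small (c k a : ℝ) (ha : 0 < a) : ∀ᶠ n : ℕ in atTop, c * LL n + k ≤ a * Real.log n := by
  have h1 : Tendsto (fun n : ℕ => LL n / Real.log n) atTop (𝓝 0) := by
    have := (Real.isLittleO_log_id_atTop.tendsto_div_nhds_zero).comp log_tendsto
    exact this
  have h2 : Tendsto (fun n : ℕ => k / Real.log n) atTop (𝓝 0) := log_tendsto.const_div_atTop k
  have h3 : Tendsto (fun n : ℕ => c * (LL n / Real.log n) + k / Real.log n) atTop (𝓝 0) := by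
    simpa using (h1.const_mul c).add h2
  filter_upwards [h3.eventually_lt_const ha, log_tendsto.eventually_gt_atTop 0] with n h hL
  have : c * LL n + k = (c * (LL n / Real.log n) + k / Real.log n) * Real.log n := by
    field_simp
  rw [this]
  exact mul_le_mul_of_nonneg_right h.le hL.le

set_option maxHeartbeats 1000000 in
lemma signal {β σ : ℝ} (hβ : β ∈ Set.Ioo (1 / 2 : ℝ) 1) (hσ : 0 < σ) (hr : 0 < rhoNormal β σ) :
    ∃ κ C : ℝ, 0 < κ ∧ κ < 1 / 2 ∧ 0 < C ∧ ∀ᶠ n : ℕ in atTop, ∀ y : ℝ, 1 ≤ n * (n * BB y) →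
      n * epsNormal β σ n * BB ((y - thetaNormal β σ n) / σ) ≤
        C * ((n * BB y) ^ κ + Real.exp (-(LL n / 4)) * √(n * BB y)) := by
  obtain ⟨κ, hκ0, hκ1, hrb, hpar⟩ := params hβ hσ hr
  set r := rhoNormal β σ with hrdef
  set R := √r with hR
  set E := Eexp β σ with hE
  have hR0 : 0 < R := Real.sqrt_pos.2 hr
  have hR2 : R ^ 2 = r := Real.sq_sqrt hr.le
  obtain ⟨z, hz1, hz2⟩ : ∃ z, 1 < z ∧ z ^ 2 * r < 2 * β - 1 := by
    have : 1 < √((2 * β - 1) / r) := by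
      rw [Real.lt_sqrt (by norm_num), one_pow, lt_div_iff₀ hr]; linarith
    obtain ⟨z, h1, h2⟩ := exists_between this
    refine ⟨z, h1, ?_⟩
    rw [Real.lt_sqrt (by linarith), lt_div_iff₀ hr] at h2
    exact h2
  set m := (z - 1) * R * √2 / σ with hm
  have hm0 : 0 < m := by
    have : 0 < z - 1 := by linarith
    positivity
  set M1 := z * R * √2 with hM1
  have hM10 : 0 ≤ M1 := by positivity
  set k1 := 3 + Real.log (1 + M1) with hk1
  set k2 := 3 + Real.log (1 + 2) with hk2
  have hk20 : 0 ≤ k2 := by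
    have := Real.log_nonneg (show (1:ℝ) ≤ 1 + 2 by norm_num)
    linarith
  refine ⟨κ, 1 + Real.exp k2 / m, hκ0, hκ1, by positivity, ?_⟩
  have hgap : 0 < β - 1 / 2 - z ^ 2 * r / 2 := by linarith
  filter_upwards [LL_small (E + 1 / 2) (k1 / 2) _ hgap, log_tendsto.eventually_ge_atTop 1,
    eventually_ge_atTop 2] with n hn1 hL hn2 y hy
  have hn0 : (0:ℝ) < n := by positivity
  set L := Real.log n with hLd
  have hLn : Real.exp L = n := Real.exp_log hn0
  set ℓ := LL n with hℓ
  have hℓL : ℓ = Real.log L := rfl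
  have hsL : Real.exp (ℓ / 2) = √L := by
    rw [Real.sqrt_eq_rpow, Real.rpow_def_of_pos (by linarith), hℓL]; congr 1; ring
  have hsL1 : 1 ≤ √L := by rw [Real.one_le_sqrt]; exact hL
  have hL0 : 0 < L := by linarith
  set T := √(2 * L) with hT
  have hT2 : T ^ 2 / 2 = L := by rw [hT, Real.sq_sqrt (by linarith)]; ring
  have hTs : T = √2 * √L := Real.sqrt_mul (by norm_num) L
  set θ := thetaNormal β σ n with hθ
  have hθT : θ = R * T := by
    rw [hθ, thetaNormal, hR, hT, ← Real.sqrt_mul hr.le]; congr 1; ring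
  have hT0 : 0 ≤ T := Real.sqrt_nonneg _
  have hne : (n:ℝ) * epsNormal β σ n = Real.exp ((1 - β) * L + E * ℓ) := by
    rw [epsNormal, Real.rpow_def_of_pos hn0, Real.rpow_def_of_pos hL0]
    conv_lhs => rw [← hLn]
    rw [Real.log_exp, ← Real.exp_add, ← Real.exp_add, ← hE, ← hℓL]
    congr 1; ring
  rw [hne]
  set s := (n:ℝ) * BB y with hs
  have hs0 : 0 < s := mul_pos hn0 (BB_pos y)
  have hsk0 : 0 ≤ s ^ κ := Real.rpow_nonneg hs0.le _
  have hsq0 : 0 ≤ Real.exp (-(ℓ / 4)) * √s := by positivity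
  have hCm : 0 < Real.exp k2 / m := by positivity
  -- powers of lower bounds
  have hpow : ∀ a p : ℝ, 0 ≤ p → Real.exp a ≤ s → Real.exp (p * a) ≤ s ^ p := by
    intro a p hp ha
    have := Real.rpow_le_rpow (Real.exp_pos a).le ha hp
    rwa [← Real.exp_mul, mul_comm a p] at this
  rcases le_or_gt y (z * θ) with hyz | hyz
  · -- case I
    have hz0 : 0 ≤ z * θ := by rw [hθT]; positivity
    have h1 : Real.exp (L - z ^ 2 * r * L - ℓ / 2 - k1) ≤ s := by
      have := BB_low2 hL hM10 hz0 (by rw [hθT, hTs, hM1]; apply le_of_eq; ring)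
      rw [← hk1, ← hℓL] at this
      have h2 := this.trans (BB_anti hyz)
      have h3 := mul_le_mul_of_nonneg_left h2 hn0.le
      rw [← hLn, ← Real.exp_add, hLn] at h3
      refine le_trans (le_of_eq ?_) h3
      congr 1
      have : (z * θ) ^ 2 / 2 = z ^ 2 * r * L := by
        rw [hθT, ← hR2, ← hT2]; ring
      rw [this]; ring
    have h2 := hpow _ (1 / 2) (by norm_num) h1
    rw [← Real.sqrt_eq_rpow] at h2
    have h3 : Real.exp ((1 - β) * L + E * ℓ) ≤ Real.exp (-(ℓ / 4)) * √s := by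
      refine le_trans ?_ (mul_le_mul_of_nonneg_left h2 (Real.exp_pos _).le)
      rw [← Real.exp_add]
      refine Real.exp_le_exp.2 ?_
      linarith
    have h4 : Real.exp ((1 - β) * L + E * ℓ) * BB ((y - θ) / σ) ≤ Real.exp ((1 - β) * L + E * ℓ) :=
      mul_le_of_le_one_right (Real.exp_pos _).le (BB_lt_one _).le
    have h5 : 0 ≤ Real.exp k2 / m * (s ^ κ + Real.exp (-(ℓ / 4)) * √s) := by positivity
    linarith
  · -- case II
    have hθ0 : 0 < θ := by rw [hθT, hTs]; positivity
    have hyp : 0 < y := by nlinarith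
    have hy2 : y ≤ 2 * √L := by
      rcases le_or_gt y 1 with h | h
      · linarith
      · have h1 : BB y ≤ Real.exp (-y ^ 2 / 2) :=
          (BB_upper hyp).trans (div_le_self (Real.exp_pos _).le h.le)
        have h2 : (1:ℝ) ≤ Real.exp (2 * L - y ^ 2 / 2) := by
          have : Real.exp (2 * L - y ^ 2 / 2) = n * (n * Real.exp (-y ^ 2 / 2)) := by
            rw [← hLn, ← Real.exp_add, ← Real.exp_add]; congr 1; ring
          rw [this]
          refine hy.trans ?_
          exact mul_le_mul_of_nonneg_left (mul_le_mul_of_nonneg_left h1 hn0.le) hn0.le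
        have h3 := Real.one_le_exp_iff.1 h2
        refine le_of_sq_le_sq ?_ (by positivity)
        rw [mul_pow, Real.sq_sqrt hL0.le]; linarith
    have h1 : Real.exp (L - y ^ 2 / 2 - ℓ / 2 - k2) ≤ s := by
      have := BB_low2 hL (by norm_num) hyp.le hy2
      rw [← hk2, ← hℓL] at this
      have h3 := mul_le_mul_of_nonneg_left this hn0.le
      rw [← hLn, ← Real.exp_add, hLn] at h3
      refine le_trans (le_of_eq ?_) h3
      congr 1; ring
    have hw : m * √L ≤ (y - θ) / σ := by
      rw [le_div_iff₀ hσ]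
      have : m * √L * σ = (z - 1) * θ := by
        rw [hm, hθT, hTs]; field_simp
      rw [this]; linarith
    have hw0 : 0 < m * √L := by positivity
    have hψ : BB ((y - θ) / σ) ≤ Real.exp (-(y - θ) ^ 2 / (2 * σ ^ 2) - ℓ / 2) / m := by
      refine (BB_upper (lt_of_lt_of_le hw0 hw)).trans ?_
      refine (div_le_div_of_nonneg_left (Real.exp_pos _).le hw0 hw).trans (le_of_eq ?_)
      rw [← hsL, Real.exp_sub, mul_comm m, ← div_div]
      congr 3
      field_simp
    have hmain : Real.exp ((1 - β) * L + E * ℓ) * BB ((y - θ) / σ) ≤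
        Real.exp ((1 - β) * (T ^ 2 / 2) + E * ℓ - ℓ / 2 - (y - R * T) ^ 2 / (2 * σ ^ 2)) / m := by
      refine (mul_le_mul_of_nonneg_left hψ (Real.exp_pos _).le).trans (le_of_eq ?_)
      rw [← mul_div_assoc, ← Real.exp_add, hT2, hθT]
      congr 2; ring
    refine hmain.trans ?_
    rw [add_mul, one_mul, mul_add]
    rcases hpar T ℓ y with hA | hB
    · have h2 := hpow _ κ hκ0.le h1
      have h3 : Real.exp ((1 - β) * (T ^ 2 / 2) + E * ℓ - ℓ / 2 - (y - R * T) ^ 2 / (2 * σ ^ 2)) ≤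
          Real.exp k2 * s ^ κ := by
        refine le_trans ?_ (mul_le_mul_of_nonneg_left h2 (Real.exp_pos _).le)
        rw [← Real.exp_add]
        refine Real.exp_le_exp.2 (hA.trans ?_)
        rw [hT2]
        nlinarith
      have h4 := div_le_div_of_nonneg_right h3 hm0.le
      have h5 : 0 ≤ Real.exp k2 / m * (Real.exp (-(ℓ / 4)) * √s) := by positivity
      have h6 : Real.exp k2 * s ^ κ / m = Real.exp k2 / m * s ^ κ := by ring
      linarith
    · have h2 := hpow _ (1 / 2) (by norm_num) h1
      rw [← Real.sqrt_eq_rpow] at h2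
      have h3 : Real.exp ((1 - β) * (T ^ 2 / 2) + E * ℓ - ℓ / 2 - (y - R * T) ^ 2 / (2 * σ ^ 2)) ≤
          Real.exp k2 * (Real.exp (-(ℓ / 4)) * √s) := by
        refine le_trans ?_ (mul_le_mul_of_nonneg_left (mul_le_mul_of_nonneg_left h2 (Real.exp_pos _).le)
          (Real.exp_pos _).le)
        rw [← Real.exp_add, ← Real.exp_add]
        refine Real.exp_le_exp.2 (hB.trans ?_)
        rw [hT2]
        linarith
      have h4 := div_le_div_of_nonneg_right h3 hm0.le
      have h5 : 0 ≤ Real.exp k2 / m * s ^ κ := by positivity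
      have h6 : Real.exp k2 * (Real.exp (-(ℓ / 4)) * √s) / m = Real.exp k2 / m * (Real.exp (-(ℓ / 4)) * √s) := by ring
      linarith

end

open MeasureTheory Filter Topology ProbabilityTheory

noncomputable section

/-- the marginal alternative -/
def QQ (β σ : ℝ) (n : ℕ) : Measure ℝ := Qmix (gaussianReal 0 1)
    (gaussianReal (thetaNormal β σ n) ⟨σ ^ 2, sq_nonneg σ⟩) (epsNormal β σ n)

lemma Qmix_real {P μ : Measure ℝ} [IsProbabilityMeasure P] [IsProbabilityMeasure μ] {e : ℝ} (h0 : 0 ≤ e)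
    (h1 : e ≤ 1) (s : Set ℝ) : (Qmix P μ e).real s = (1 - e) * P.real s + e * μ.real s := by
  have : IsFiniteMeasure (ENNReal.ofReal (1 - e) • P) := P.smul_finite ENNReal.ofReal_ne_top
  have : IsFiniteMeasure (ENNReal.ofReal e • μ) := μ.smul_finite ENNReal.ofReal_ne_top
  rw [Qmix, measureReal_add_apply, measureReal_ennreal_smul_apply, measureReal_ennreal_smul_apply,
    ENNReal.toReal_ofReal (by linarith), ENNReal.toReal_ofReal h0]

lemma Qmix_nice {P μ : Measure ℝ} (hP : Nice P) (hμ : Nice μ) {e : ℝ} (h0 : 0 ≤ e)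
    (h1 : e < 1) : Nice (Qmix P μ e) where
  prob := by
    have := hP.prob
    have := hμ.prob
    constructor
    rw [Qmix]
    simp only [Measure.coe_add, Measure.coe_smul, Pi.add_apply, Pi.smul_apply, measure_univ, smul_eq_mul, mul_one]
    rw [← ENNReal.ofReal_add (by linarith) h0]
    simp
  noat := by
    have := hP.noat
    have := hμ.noat
    constructor
    intro x
    simp [Qmix]
  abc := by
    intro s hs
    rw [Qmix] at hs
    simp only [Measure.coe_add, Measure.coe_smul, Pi.add_apply, Pi.smul_apply, smul_eq_mul, add_eq_zero, mul_eq_zero] at hs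
    refine hP.abc ?_
    rcases hs.1 with h | h
    · rw [ENNReal.ofReal_eq_zero] at h; linarith
    · exact h

lemma eps_facts {β : ℝ} (σ : ℝ) (hβ : β ∈ Set.Ioo (1 / 2 : ℝ) 1) : ∀ᶠ n : ℕ in atTop,
    0 ≤ epsNormal β σ n ∧ epsNormal β σ n < 1 ∧ epsNormal β σ n * √n ≤ Real.exp (-(LL n / 4)) := by
  have hgap : 0 < β - 1 / 2 := by linarith [hβ.1]
  filter_upwards [LL_small (Eexp β σ + 1 / 4) 0 _ hgap, log_tendsto.eventually_ge_atTop 1,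
    LL_tendsto.eventually_ge_atTop 1, eventually_ge_atTop 2] with n h1 hL hLL hn2
  have hn0 : (0:ℝ) < n := by positivity
  have hL0 : 0 < Real.log n := by linarith
  have h3 : epsNormal β σ n * √n ≤ Real.exp (-(LL n / 4)) := by
    rw [epsNormal, Real.sqrt_eq_rpow, Real.rpow_def_of_pos hn0, Real.rpow_def_of_pos hn0,
      Real.rpow_def_of_pos hL0, ← Real.exp_add, ← Real.exp_add]
    refine Real.exp_le_exp.2 ?_
    change _ + LL n * _ + _ ≤ _
    linarith
  have h0 : 0 ≤ epsNormal β σ n := by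
    rw [epsNormal]; positivity
  refine ⟨h0, ?_, h3⟩
  have h4 : 1 ≤ √(n:ℝ) := by
    rw [Real.one_le_sqrt]; exact_mod_cast (by omega : 1 ≤ n)
  have h5 : Real.exp (-(LL n / 4)) < 1 := by rw [Real.exp_lt_one_iff]; linarith
  nlinarith

lemma QQ_nice {β σ : ℝ} (hβ : β ∈ Set.Ioo (1 / 2 : ℝ) 1) (hσ : 0 < σ) : ∀ᶠ n : ℕ in atTop,
    Nice (QQ β σ n) ∧ ∀ y, sv (QQ β σ n) y = (1 - epsNormal β σ n) * BB y +
      epsNormal β σ n * BB ((y - thetaNormal β σ n) / σ) := by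
  filter_upwards [eps_facts σ hβ] with n ⟨h0, h1, _⟩
  have hN : Nice (gaussianReal (thetaNormal β σ n) ⟨σ ^ 2, sq_nonneg σ⟩) := by
    refine nice_gauss _ ?_
    intro h
    have : σ ^ 2 = 0 := congrArg Subtype.val h
    exact absurd this (by positivity)
  refine ⟨Qmix_nice niceB hN h0 h1, fun y => ?_⟩
  have := hN.prob
  rw [QQ, sv, Qmix_real h0 h1.le, ← sv_gauss _ hσ]; rfl

set_option maxHeartbeats 1000000 in
lemma dev {β σ : ℝ} (hβ : β ∈ Set.Ioo (1 / 2 : ℝ) 1) (hσ : 0 < σ) (hr : 0 < rhoNormal β σ) :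
    ∃ κ C : ℝ, 0 < κ ∧ κ < 1 / 2 ∧ 0 < C ∧ ∀ᶠ n : ℕ in atTop, ∀ y : ℝ,
      (1 ≤ n * (n * BB y) → |n * sv (QQ β σ n) y - n * BB y| ≤
        C * ((n * BB y) ^ κ + Real.exp (-(LL n / 4)) * √(n * BB y))) ∧
      (1 ≤ n * (n * (1 - BB y)) → |n * sv (QQ β σ n) y - n * BB y| ≤
        C * ((n * (1 - BB y)) ^ κ + Real.exp (-(LL n / 4)) * √(n * (1 - BB y)))) := by
  obtain ⟨κ, C, h1, h2, h3, h4⟩ := signal hβ hσ hr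
  refine ⟨κ, C + 1, h1, h2, by linarith, ?_⟩
  filter_upwards [h4, QQ_nice hβ hσ, eps_facts σ hβ] with n hS hQ ⟨he0, he1, he2⟩ y
  have hn0 : (0:ℝ) ≤ n := Nat.cast_nonneg n
  set e := epsNormal β σ n
  set θ := thetaNormal β σ n with hθ
  have hθ0 : 0 ≤ θ := by rw [hθ, thetaNormal]; exact Real.sqrt_nonneg _
  set d := Real.exp (-(LL n / 4))
  have hd0 : 0 < d := Real.exp_pos _
  have hneb : ∀ b : ℝ, 0 < b → b < 1 → n * e * b ≤ d * √(n * b) := by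
    intro b hb0 hb1
    have e1 : (n:ℝ) * e * b = (e * √n) * (√b * √(n * b)) := by
      rw [Real.sqrt_mul hn0]
      have := Real.mul_self_sqrt hn0
      have := Real.mul_self_sqrt hb0.le
      calc (n:ℝ) * e * b = e * (√n * √n) * (√b * √b) := by simp only [*]; ring
        _ = _ := by ring
    rw [e1]
    refine mul_le_mul he2 ?_ (by positivity) hd0.le
    refine mul_le_of_le_one_left (Real.sqrt_nonneg _) ?_
    rw [Real.sqrt_le_left (by norm_num)]; linarith
  rw [hQ.2 y]
  have hgen : ∀ b ψ : ℝ, 0 < b → b < 1 → 0 ≤ ψ →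
      n * e * ψ ≤ C * ((n * b) ^ κ + d * √(n * b)) →
      |n * e * (ψ - b)| ≤ (C + 1) * ((n * b) ^ κ + d * √(n * b)) := by
    intro b ψ hb0 hb1 hψ hle
    have hb := hneb b hb0 hb1
    have p1 : 0 ≤ (n * b) ^ κ := Real.rpow_nonneg (by positivity) _
    have p2 : 0 ≤ d * √(n * b) := by positivity
    have p3 : 0 ≤ n * e * ψ := by positivity
    have p4 : 0 ≤ n * e * b := by positivity
    have p5 : 0 ≤ C * ((n * b) ^ κ + d * √(n * b)) := by positivity
    rw [mul_sub, abs_le, add_mul]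
    constructor <;> linarith
  constructor
  · intro h
    have := hgen (BB y) _ (BB_pos y) (BB_lt_one y) (BB_pos _).le (hS y h)
    convert this using 2
    ring
  · intro h
    have hB := BB_neg y
    have := hgen (1 - BB y) (BB ((θ - y) / σ)) (by linarith [BB_lt_one y]) (by linarith [BB_pos y]) (BB_pos _).le ?_
    · rw [← abs_neg]
      convert this using 2
      have : BB ((θ - y) / σ) = 1 - BB ((y - θ) / σ) := by
        rw [← BB_neg]; congr 1; ring
      rw [this]; ring
    · rw [← hB] at h ⊢
      refine le_trans ?_ (hS (-y) h)
      refine mul_le_mul_of_nonneg_left (BB_anti ?_) (by positivity)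
      refine div_le_div_of_nonneg_right ?_ hσ.le
      linarith

end

open MeasureTheory Filter Topology ProbabilityTheory

noncomputable section

/-- number of edge levels -/
def S1 (n : ℕ) : ℕ := ⌈4 * S0 n⌉₊

set_option maxHeartbeats 1000000 in
lemma edge_gen {Q : ℕ → Measure ℝ} (hQ : ∀ᶠ n in atTop, IsProbabilityMeasure (Q n)) {A : ℕ → ℝ → Set ℝ}
    (hA : ∀ n s, MeasurableSet (A n s)) (hmono : ∀ n, Monotone (A n)) {κ C : ℝ} (hκ : 0 < κ)
    (hκ2 : κ < 1 / 2) (hC : 0 < C) (x : ℝ)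
    (hdev : ∀ᶠ n : ℕ in atTop, ∀ s : ℝ, 1 ≤ n * s → s ≤ n / 2 →
      |n * (Q n).real (A n s) - s| ≤ C * (s ^ κ + Real.exp (-(LL n / 4)) * √s)) :
    Tendsto (fun n : ℕ => (Measure.pi fun _ : Fin n => Q n).real
      {Y | ∃ s : ℝ, 0 < s ∧ s ≤ S1 n ∧ uu x n * √(s * (1 - s / n)) < |(cA Y (A n s) : ℝ) - s|})
      atTop (𝓝 0) := by
  have hlim : Tendsto (fun t : ℝ => ((t ^ 2)⁻¹ + C * (((t ^ 2)⁻¹) ^ κ + √((t ^ 2)⁻¹))) +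
      (1 + 2 * C) * (2 * t⁻¹) + 14 * Real.exp (1 + 2 * C) * Real.exp (-t)) atTop (𝓝 0) := by
    have h0 : Tendsto (fun t : ℝ => t⁻¹) atTop (𝓝 0) := tendsto_inv_atTop_zero
    have h1 : Tendsto (fun t : ℝ => (t ^ 2)⁻¹) atTop (𝓝 0) :=
      (tendsto_pow_atTop (by norm_num : (2:ℕ) ≠ 0)).inv_tendsto_atTop
    have h2 : Tendsto (fun t : ℝ => ((t ^ 2)⁻¹) ^ κ) atTop (𝓝 0) := by
      have := h1.rpow_const (p := κ) (Or.inr hκ.le)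
      rwa [Real.zero_rpow hκ.ne'] at this
    have h3 : Tendsto (fun t : ℝ => √((t ^ 2)⁻¹)) atTop (𝓝 0) := by
      have := h1.sqrt
      rwa [Real.sqrt_zero] at this
    have h4 : Tendsto (fun t : ℝ => Real.exp (-t)) atTop (𝓝 0) := Real.tendsto_exp_neg_atTop_nhds_zero
    have := ((h1.add ((h2.add h3).const_mul C)).add ((h0.const_mul 2).const_mul (1 + 2 * C))).add
      (h4.const_mul (14 * Real.exp (1 + 2 * C)))
    simpa using this
  refine squeeze_zero' (Eventually.of_forall fun n => measureReal_nonneg) ?_ (hlim.comp ss_tendsto)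
  have hlog : ∀ᶠ n : ℕ in atTop, 16 * Real.log n ≤ n := by
    filter_upwards [(log_div_n).eventually_lt_const (show (0:ℝ) < 1 / 16 by norm_num), eventually_ge_atTop 1]
      with n h hn
    have hn0 : (0:ℝ) < n := by exact_mod_cast hn
    rw [div_lt_iff₀ hn0] at h
    linarith
  filter_upwards [hQ, hdev, hlog, S0_le_log, uu_bd x, poly_small x, ss_tendsto.eventually_ge_atTop (8 + 8 * (2 * C)),
    LL_tendsto.eventually_ge_atTop 0, eventually_ge_atTop 16] with n hQ hdev hlog hS0 hu hp hss hLL hn16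
  obtain ⟨hS2, hSlog, -⟩ := hS0
  simp only [Function.comp]
  set t := ss n with ht
  set u := uu x n
  have ht8 : 8 ≤ t := by linarith
  have htu : t ^ 2 ≤ u := by
    have : t ^ 2 = √(LL n) := by rw [ht, ss, Real.sq_sqrt (Real.sqrt_nonneg _)]
    rw [this]; exact hu.1
  have hn0 : (0:ℝ) < n := by positivity
  have ht0 : 0 < t := by linarith
  have ht20 : 0 < t ^ 2 := by positivity
  have hd1 : Real.exp (-(LL n / 4)) ≤ 1 := by rw [Real.exp_le_one_iff]; linarith
  have hS1a : (S1 n : ℝ) ≤ 4 * S0 n + 1 := (Nat.ceil_lt_add_one (by linarith)).le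
  have hn16' : (16:ℝ) ≤ n := by exact_mod_cast hn16
  have hS1n : (S1 n + 1 : ℝ) ≤ n / 2 := by linarith
  have hinv1 : (t ^ 2)⁻¹ ≤ 1 := inv_le_one_of_one_le₀ (by nlinarith)
  have hη : n * (Q n).real (A n ((t ^ 2)⁻¹)) ≤ (t ^ 2)⁻¹ + C * (((t ^ 2)⁻¹) ^ κ + √((t ^ 2)⁻¹)) := by
    have h1 : 1 ≤ n * (t ^ 2)⁻¹ := by
      rw [← div_eq_mul_inv, le_div_iff₀ ht20]; linarith [hp.2]
    have := hdev _ h1 (by linarith)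
    have h2 := (abs_le.1 this).2
    have h3 : Real.exp (-(LL n / 4)) * √((t ^ 2)⁻¹) ≤ √((t ^ 2)⁻¹) :=
      mul_le_of_le_one_left (Real.sqrt_nonneg _) hd1
    have h4 := mul_le_mul_of_nonneg_left h3 hC.le
    linarith
  have hC2 : ∀ s : ℝ, 1 ≤ s → s ≤ S1 n + 1 → |n * (Q n).real (A n s) - s| ≤ (2 * C) * √s := by
    intro s h1 h2
    refine (hdev s (by nlinarith) (by linarith)).trans ?_
    have h3 : Real.exp (-(LL n / 4)) * √s ≤ √s := mul_le_of_le_one_left (Real.sqrt_nonneg _) hd1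
    have h4 : s ^ κ ≤ √s := by
      rw [Real.sqrt_eq_rpow]; exact Real.rpow_le_rpow_of_exponent_le h1 hκ2.le
    nlinarith
  have hKu : t / 2 ≤ u * √((t ^ 2)⁻¹ / 2) := by
    have h1 : (1 / (2 * t)) ≤ √((t ^ 2)⁻¹ / 2) := by
      refine Real.le_sqrt_of_sq_le ?_
      rw [div_pow, mul_pow, one_pow]
      have : (1:ℝ) / (2 ^ 2 * t ^ 2) = (t ^ 2)⁻¹ / 4 := by field_simp; norm_num
      rw [this]
      have : 0 < (t ^ 2)⁻¹ := by positivity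
      linarith
    calc t / 2 = t ^ 2 * (1 / (2 * t)) := by field_simp
      _ ≤ _ := mul_le_mul htu h1 (by positivity) (by linarith)
  have hE := edge_finite (hA n) (hmono n) hS1n (by positivity : 0 < (t ^ 2)⁻¹) hinv1 hη (by positivity) hC2
    (by linarith : 1 ≤ t / 2) hKu (by nlinarith)
  refine hE.trans ?_
  have e1 : (1 + 2 * C) / (t / 2) = (1 + 2 * C) * (2 * t⁻¹) := by field_simp
  rw [e1]
  refine add_le_add_right ?_ _
  have e2 : (S1 n + 1 : ℝ) ≤ 7 * Real.exp t := by
    have : S0 n = Real.exp t := rfl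
    rw [this] at hS1a hS2
    linarith
  calc (S1 n + 1 : ℝ) * (2 * Real.exp (1 + 2 * C - u / 4)) ≤ (7 * Real.exp t) * (2 * Real.exp (1 + 2 * C - 2 * t)) := by
        refine mul_le_mul e2 (mul_le_mul_of_nonneg_left (Real.exp_le_exp.2 ?_) (by norm_num)) (by positivity) (by positivity)
        nlinarith
    _ = 14 * Real.exp (1 + 2 * C) * Real.exp (-t) := by
        have : Real.exp (1 + 2 * C - 2 * t) = Real.exp (1 + 2 * C) * (Real.exp (-t) * Real.exp (-t)) := by
          rw [← Real.exp_add, ← Real.exp_add]; congr 1; ring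
        have h2 : Real.exp t * Real.exp (-t) = 1 := by rw [← Real.exp_add]; simp
        rw [this]
        linear_combination (14 * Real.exp (1 + 2 * C) * Real.exp (-t)) * h2

end

open MeasureTheory Filter Topology ProbabilityTheory

noncomputable section

lemma BB_le_iff {y z : ℝ} : BB y ≤ BB z ↔ z ≤ y := niceB.anti.le_iff_ge
lemma BB_lt_iff {y z : ℝ} : BB y < BB z ↔ z < y := niceB.anti.lt_iff_gt

lemma cA_Ici {n : ℕ} (Y : Fin n → ℝ) (y : ℝ) : cA Y (Set.Ici y) = Ncnt Y y := by
  simp [cA, Ncnt]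

lemma cA_Iio {n : ℕ} (Y : Fin n → ℝ) (y : ℝ) : (cA Y (Set.Iio y) : ℝ) = n - Ncnt Y y := by
  have h := Finset.card_filter_add_card_filter_not (s := (Finset.univ : Finset (Fin n))) (fun i => y ≤ Y i)
  simp only [not_le, Finset.card_univ, Fintype.card_fin] at h
  have h2 : (Ncnt Y y : ℕ) + cA Y (Set.Iio y) = n := by
    refine Eq.trans ?_ h
    rw [cA, Ncnt]
    congr 2
  rw [eq_sub_iff_add_eq, add_comm]
  exact_mod_cast h2

/-- right upper-tail family -/
def AR (n : ℕ) (s : ℝ) : Set ℝ := {y | n * BB y ≤ s}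
/-- left tail family -/
def AL (n : ℕ) (s : ℝ) : Set ℝ := {y | n * (1 - BB y) < s}

lemma BB_meas : Measurable BB := niceB.anti.antitone.measurable

lemma AR_eq {n : ℕ} (hn : 0 < n) {s y : ℝ} (h : n * BB y = s) : AR n s = Set.Ici y := by
  ext z
  have hn0 : (0:ℝ) < n := by exact_mod_cast hn
  simp only [AR, Set.mem_ofPred_eq, Set.mem_Ici, ← h]
  rw [mul_le_mul_iff_right₀ hn0, BB_le_iff]

lemma AL_eq {n : ℕ} (hn : 0 < n) {s y : ℝ} (h : n * (1 - BB y) = s) : AL n s = Set.Iio y := by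
  ext z
  have hn0 : (0:ℝ) < n := by exact_mod_cast hn
  simp only [AL, Set.mem_ofPred_eq, Set.mem_Iio, ← h]
  rw [mul_lt_mul_iff_right₀ hn0, sub_lt_sub_iff_left, BB_lt_iff]

/-- bad event in the right edge -/
def badR (n : ℕ) (u : ℝ) : Set (Fin n → ℝ) :=
  {Y | ∃ y, n * BB y ≤ S1 n ∧ u * √(n * BB y * (1 - BB y)) < |(Ncnt Y y : ℝ) - n * BB y|}
/-- bad event in the left edge -/
def badL (n : ℕ) (u : ℝ) : Set (Fin n → ℝ) :=
  {Y | ∃ y, n * (1 - BB y) ≤ S1 n ∧ u * √(n * BB y * (1 - BB y)) < |(Ncnt Y y : ℝ) - n * BB y|}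

lemma edge_right {β σ : ℝ} (hβ : β ∈ Set.Ioo (1 / 2 : ℝ) 1) (hσ : 0 < σ) (hr : 0 < rhoNormal β σ) (x : ℝ) :
    Tendsto (fun n : ℕ => (Measure.pi fun _ : Fin n => QQ β σ n).real (badR n (uu x n))) atTop (𝓝 0) := by
  obtain ⟨κ, C, h1, h2, h3, h4⟩ := dev hβ hσ hr
  have hN := QQ_nice hβ hσ
  have hg := edge_gen (Q := QQ β σ) (hN.mono fun n h => h.1.prob) (A := AR)
    (fun n s => measurableSet_le (measurable_const.mul BB_meas) measurable_const)
    (fun n s t hst y hy => le_trans (show n * BB y ≤ s from hy) hst) h1 h2 h3 x ?_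
  · refine squeeze_zero' (Eventually.of_forall fun n => measureReal_nonneg) ?_ hg
    filter_upwards [hN, eventually_gt_atTop 0] with n hN hn
    have := hN.1.prob
    refine measureReal_mono ?_
    rintro Y ⟨y, hy1, hy2⟩
    have hn0 : (0:ℝ) < n := by exact_mod_cast hn
    refine ⟨n * BB y, mul_pos hn0 (BB_pos y), hy1, ?_⟩
    rw [AR_eq hn rfl, cA_Ici, mul_div_cancel_left₀ _ hn0.ne']
    exact hy2
  · filter_upwards [h4, eventually_gt_atTop 0] with n h4 hn s hs1 hs2
    have hn0 : (0:ℝ) < n := by exact_mod_cast hn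
    have hs0 : 0 < s := by
      by_contra hc
      push Not at hc
      nlinarith
    obtain ⟨y, hy⟩ := niceB.surj (t := s / n) (by positivity) (by rw [div_lt_one hn0]; linarith)
    have hy' : n * BB y = s := by
      rw [show BB y = s / n from hy]; field_simp
    have := (h4 y).1 (by rw [hy']; exact hs1)
    rw [hy'] at this
    rw [AR_eq hn hy']
    exact this

lemma edge_left {β σ : ℝ} (hβ : β ∈ Set.Ioo (1 / 2 : ℝ) 1) (hσ : 0 < σ) (hr : 0 < rhoNormal β σ) (x : ℝ) :
    Tendsto (fun n : ℕ => (Measure.pi fun _ : Fin n => QQ β σ n).real (badL n (uu x n))) atTop (𝓝 0) := by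
  obtain ⟨κ, C, h1, h2, h3, h4⟩ := dev hβ hσ hr
  have hN := QQ_nice hβ hσ
  have hg := edge_gen (Q := QQ β σ) (hN.mono fun n h => h.1.prob) (A := AL)
    (fun n s => measurableSet_lt (measurable_const.mul (measurable_const.sub BB_meas)) measurable_const)
    (fun n s t hst y hy => lt_of_lt_of_le (show n * (1 - BB y) < s from hy) hst) h1 h2 h3 x ?_
  · refine squeeze_zero' (Eventually.of_forall fun n => measureReal_nonneg) ?_ hg
    filter_upwards [hN, eventually_gt_atTop 0] with n hN hn
    have := hN.1.prob
    refine measureReal_mono ?_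
    rintro Y ⟨y, hy1, hy2⟩
    have hn0 : (0:ℝ) < n := by exact_mod_cast hn
    refine ⟨n * (1 - BB y), mul_pos hn0 (by linarith [BB_lt_one y]), hy1, ?_⟩
    rw [AL_eq hn rfl, cA_Iio, mul_div_cancel_left₀ _ hn0.ne',
      show (n:ℝ) * (1 - BB y) * (1 - (1 - BB y)) = n * BB y * (1 - BB y) by ring,
      show (n:ℝ) - Ncnt Y y - n * (1 - BB y) = -((Ncnt Y y : ℝ) - n * BB y) by ring, abs_neg]
    exact hy2
  · filter_upwards [h4, hN, eventually_gt_atTop 0] with n h4 hN hn s hs1 hs2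
    have hn0 : (0:ℝ) < n := by exact_mod_cast hn
    have hs0 : 0 < s := by
      by_contra hc
      push Not at hc
      nlinarith
    have hsn : s / n < 1 := by rw [div_lt_one hn0]; linarith
    obtain ⟨y, hy⟩ := niceB.surj (t := 1 - s / n) (by linarith) (by linarith [show 0 < s / n by positivity])
    have hy' : n * (1 - BB y) = s := by
      rw [show BB y = 1 - s / n from hy]; field_simp; ring
    have := (h4 y).2 (by rw [hy']; exact hs1)
    rw [hy'] at this
    rw [AL_eq hn hy']
    have hp := hN.1.prob
    have e : (QQ β σ n).real (Set.Iio y) = 1 - sv (QQ β σ n) y := by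
      have hc : Set.Iio y = (Set.Ici y)ᶜ := by simp
      rw [hc, probReal_compl_eq_one_sub measurableSet_Ici, sv]
    rw [e]
    have e2 : n * (1 - sv (QQ β σ n) y) - s = -(n * sv (QQ β σ n) y - n * BB y) := by
      rw [← hy']; ring
    rw [e2, abs_neg]
    exact this

end

open MeasureTheory Filter Topology ProbabilityTheory

noncomputable section

lemma vdiff {n t t' : ℝ} (h0 : 0 ≤ t) (h1 : t ≤ 1) (h0' : 0 ≤ t') (h1' : t' ≤ 1) :
    |n * t * (1 - t) - n * t' * (1 - t')| ≤ |n * t - n * t'| := by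
  have e : n * t * (1 - t) - n * t' * (1 - t') = (n * t - n * t') * (1 - t - t') := by ring
  rw [e, abs_mul]
  refine mul_le_of_le_one_right (abs_nonneg _) ?_
  rw [abs_le]; constructor <;> linarith

lemma sqrt_cmp {v w δ : ℝ} (hw : 1 ≤ w) (hδ0 : 0 ≤ δ) (hδ1 : δ ≤ 1) (h : |v - w| ≤ δ * √w) :
    √v ≤ (1 + δ) * √w ∧ (1 - δ) * √w ≤ √v := by
  have hs : √w ≤ w := by
    rw [Real.sqrt_le_left (by linarith)]; nlinarith
  have h2 := abs_le.1 (h.trans (mul_le_mul_of_nonneg_left hs hδ0))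
  have hq : √w ^ 2 = w := Real.sq_sqrt (by linarith)
  constructor
  · rw [Real.sqrt_le_left (by positivity), mul_pow, hq]
    nlinarith [mul_nonneg (mul_nonneg hδ0 hδ0) (by linarith : 0 ≤ w), mul_nonneg hδ0 (by linarith : 0 ≤ w)]
  · refine Real.le_sqrt_of_sq_le ?_
    rw [mul_pow, hq]
    have : (1 - δ) ^ 2 ≤ 1 - δ := by nlinarith
    nlinarith

lemma vB_ge {n b S : ℝ} (hS : 4 ≤ S) (h1 : S / 2 ≤ n * b) (h2 : S / 2 ≤ n * (1 - b)) :
    1 ≤ n * b * (1 - b) := by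
  rcases le_total b (1 / 2) with h | h
  · nlinarith
  · nlinarith

lemma Ncnt_anti {n : ℕ} (Y : Fin n → ℝ) {y z : ℝ} (h : y ≤ z) : Ncnt Y z ≤ Ncnt Y y := by
  rw [← cA_Ici, ← cA_Ici]
  exact cA_mono Y (Set.Ici_subset_Ici.2 h)

section incl
variable {n : ℕ} {Q : Measure ℝ} {S δ : ℝ}

lemma main_ge (hQ : Nice Q) (hn : 0 < n) (hS : 4 ≤ S) (hSn : S ≤ n / 8) (hδ0 : 0 ≤ δ) (hδ1 : δ ≤ 1 / 4)
    (hdev : ∀ y, S / 2 ≤ n * BB y → S / 2 ≤ n * (1 - BB y) →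
      |n * sv Q y - n * BB y| ≤ δ * √(n * BB y * (1 - BB y))) {y : ℝ} :
    (S ≤ n * sv Q y → S / 2 ≤ n * BB y) ∧ (S ≤ n * (1 - sv Q y) → S / 2 ≤ n * (1 - BB y)) := by
  have hn0 : (0:ℝ) < n := by exact_mod_cast hn
  have hS0 : 0 < S / 2 / n := by positivity
  have hS1 : S / 2 / n ≤ 1 / 16 := by rw [div_le_iff₀ hn0]; linarith
  have hsq : √(n * (S / 2 / n) * (1 - S / 2 / n)) ≤ S / 2 := by
    rw [Real.sqrt_le_left (by linarith), mul_div_cancel₀ _ hn0.ne']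
    nlinarith
  constructor
  · intro h
    by_contra hc
    push Not at hc
    obtain ⟨z, hz⟩ := niceB.surj hS0 (by linarith)
    have hz : BB z = S / 2 / n := hz
    have hzn : n * BB z = S / 2 := by rw [hz]; field_simp
    have hd := hdev z hzn.ge (by rw [mul_sub, hzn]; linarith)
    rw [← hz] at hsq
    have hlt : BB y < BB z := by
      rw [hz, lt_div_iff₀ hn0]; linarith
    have hG := hQ.anti.antitone (BB_lt_iff.1 hlt).le
    have h3 := (abs_le.1 hd).2
    have h4 := mul_le_mul_of_nonneg_left hG hn0.le
    nlinarith
  · intro h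
    by_contra hc
    push Not at hc
    obtain ⟨z, hz⟩ := niceB.surj (t := 1 - S / 2 / n) (by linarith) (by linarith)
    have hz : BB z = 1 - S / 2 / n := hz
    have hzn : n * (1 - BB z) = S / 2 := by rw [hz]; field_simp; ring
    have hd := hdev z (by rw [mul_sub] at hzn; linarith) hzn.ge
    have e : n * BB z * (1 - BB z) = n * (S / 2 / n) * (1 - S / 2 / n) := by rw [hz]; ring
    rw [e] at hd
    have hlt : BB z < BB y := by
      have : n * (1 - BB y) < n * (1 - BB z) := by linarith
      have := lt_of_mul_lt_mul_left this hn0.le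
      linarith
    have hG := hQ.anti.antitone (BB_lt_iff.1 hlt).le
    have h3 := (abs_le.1 hd).1
    have h4 := mul_le_mul_of_nonneg_left hG hn0.le
    nlinarith

lemma incl_upper (hQ : Nice Q) (hn : 0 < n) (hS : 4 ≤ S) (hSn : S ≤ n / 8) (hδ0 : 0 ≤ δ) (hδ1 : δ ≤ 1 / 4)
    (hdev : ∀ y, S / 2 ≤ n * BB y → S / 2 ≤ n * (1 - BB y) →
      |n * sv Q y - n * BB y| ≤ δ * √(n * BB y * (1 - BB y))) {m J0 J1 : ℕ} {u u' : ℝ}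
    (hj : ∀ j : ℕ, J0 ≤ j → j ≤ J1 → S / n ≤ (j:ℝ) / m ∧ (j:ℝ) / m ≤ 1 - S / n)
    (hu0 : 0 ≤ u') (hu : u + δ ≤ u' * (1 - δ)) : bandE n u ⊆ gridE Q n m J0 J1 u' := by
  have hn0 : (0:ℝ) < n := by exact_mod_cast hn
  intro Y hY j hj0 hj1 y hy
  obtain ⟨g1, g2⟩ := hj j hj0 hj1
  rw [← hy] at g1 g2
  have g1' : S ≤ n * sv Q y := by rw [div_le_iff₀ hn0] at g1; linarith
  have g2' : S ≤ n * (1 - sv Q y) := by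
    have : S / n ≤ 1 - sv Q y := by linarith
    rw [div_le_iff₀ hn0] at this; linarith
  have b1 := (main_ge hQ hn hS hSn hδ0 hδ1 hdev (y := y)).1 g1'
  have b2 := (main_ge hQ hn hS hSn hδ0 hδ1 hdev (y := y)).2 g2'
  have hd := hdev y b1 b2
  have hv := vB_ge hS b1 b2
  have hYy : |(Ncnt Y y : ℝ) - n * BB y| ≤ u * √(n * BB y * (1 - BB y)) := hY y
  have hvd := (vdiff (n := (n:ℝ)) (sv_nonneg Q y) (hQ.lt_one y).le (BB_pos y).le (BB_lt_one y).le).trans hd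
  have hs := (sqrt_cmp hv hδ0 (by linarith) hvd).2
  have htri : |(Ncnt Y y : ℝ) - n * sv Q y| ≤ |(Ncnt Y y : ℝ) - n * BB y| + |n * sv Q y - n * BB y| := by
    have := abs_add_le ((Ncnt Y y : ℝ) - n * BB y) (-(n * sv Q y - n * BB y))
    rw [abs_neg] at this
    refine le_trans (le_of_eq ?_) this
    congr 1; ring
  have hw0 : 0 ≤ √(n * BB y * (1 - BB y)) := Real.sqrt_nonneg _
  calc _ ≤ (u + δ) * √(n * BB y * (1 - BB y)) := by linarith
    _ ≤ u' * (1 - δ) * √(n * BB y * (1 - BB y)) := mul_le_mul_of_nonneg_right hu hw0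
    _ = u' * ((1 - δ) * √(n * BB y * (1 - BB y))) := by ring
    _ ≤ _ := mul_le_mul_of_nonneg_left hs hu0

lemma sqrt_add_le {v h w : ℝ} (hv : 1 / 4 ≤ v) (hh : 0 ≤ h) (hw : w ≤ v + h) : √w ≤ √v + h := by
  have h1 : 1 / 2 ≤ √v := Real.le_sqrt_of_sq_le (by norm_num at hv ⊢; exact hv)
  rw [Real.sqrt_le_left (by positivity)]
  have := Real.sq_sqrt (show 0 ≤ v by linarith)
  nlinarith

set_option maxHeartbeats 1000000 in
lemma incl_lower (hQ : Nice Q) (hn : 0 < n) (hS : 4 ≤ S) (hδ0 : 0 ≤ δ) (hδ1 : δ ≤ 1 / 4)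
    (hdev : ∀ y, S / 2 ≤ n * BB y → S / 2 ≤ n * (1 - BB y) →
      |n * sv Q y - n * BB y| ≤ δ * √(n * BB y * (1 - BB y))) {m J : ℕ} {u u' : ℝ} (hm : 0 < m)
    (hJ0 : 1 ≤ J) (hJm : 2 * J < m) (hJ : (J:ℝ) / m ≤ 2 * S / n) (hnm : (n:ℝ) / m ≤ δ) (hS1 : 4 * S ≤ S1 n)
    (hu0 : 0 ≤ u') (hu : u' * (1 + δ) + δ * (1 + u') + δ ≤ u) :
    gridE Q n m J (m - J) u' ⊆ bandE n u ∪ (badR n u ∪ badL n u) := by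
  have hn0 : (0:ℝ) < n := by exact_mod_cast hn
  have hm0 : (0:ℝ) < m := by exact_mod_cast hm
  intro Y hY
  by_contra hcon
  simp only [Set.mem_union, not_or] at hcon
  obtain ⟨hb, hbR, hbL⟩ := hcon
  apply hb
  intro y
  by_contra hbad
  push Not at hbad
  have r1 : (S1 n : ℝ) < n * BB y := by
    by_contra h; push Not at h; exact hbR ⟨y, h, hbad⟩
  have r2 : (S1 n : ℝ) < n * (1 - BB y) := by
    by_contra h; push Not at h; exact hbL ⟨y, h, hbad⟩
  have b1 : S / 2 ≤ n * BB y := by linarith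
  have b2 : S / 2 ≤ n * (1 - BB y) := by linarith
  have hd := hdev y b1 b2
  have hv := vB_ge hS b1 b2
  have hvd := (vdiff (n := (n:ℝ)) (sv_nonneg Q y) (hQ.lt_one y).le (BB_pos y).le (BB_lt_one y).le).trans hd
  obtain ⟨hs1, hs2⟩ := sqrt_cmp hv hδ0 (by linarith) hvd
  set b := BB y with hbdef
  set g := sv Q y with hgdef
  have hb0 : 0 < b := BB_pos y
  have hb1 : b < 1 := BB_lt_one y
  set w := √(n * b * (1 - b)) with hw
  have hw1 : 1 ≤ w := by rw [hw, Real.one_le_sqrt]; exact hv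
  have hwb : w ≤ n * b := by
    rw [hw, Real.sqrt_le_left (by positivity)]
    nlinarith [mul_pos hn0 hb0]
  have hwb' : w ≤ n * (1 - b) := by
    rw [hw, Real.sqrt_le_left (by linarith)]
    nlinarith [mul_pos hn0 hb0]
  have hdl := abs_le.1 hd
  have hδw : δ * w ≤ 1 / 4 * w := mul_le_mul_of_nonneg_right hδ1 (by linarith)
  have q1 : 2 * S < n * g := by linarith
  have q2 : 2 * S < n * (1 - g) := by linarith
  have p1 : (J:ℝ) < m * g := by
    have : (J:ℝ) / m < g := lt_of_le_of_lt hJ (by rw [div_lt_iff₀ hn0]; linarith)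
    rw [div_lt_iff₀ hm0] at this; linarith
  have p2 : (J:ℝ) < m * (1 - g) := by
    have : (J:ℝ) / m < 1 - g := lt_of_le_of_lt hJ (by rw [div_lt_iff₀ hn0]; linarith)
    rw [div_lt_iff₀ hm0] at this; linarith
  have hg0 : 0 < g := hQ.pos y
  have hg1 : g < 1 := hQ.lt_one y
  set j := ⌊(m:ℝ) * g⌋₊ with hj
  have hj1 : (j:ℝ) ≤ m * g := Nat.floor_le (by positivity)
  have hj2 : (m:ℝ) * g < j + 1 := Nat.lt_floor_add_one _
  have hJj : J ≤ j := Nat.le_floor p1.le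
  have hjm : j + 1 ≤ m - J := by
    have : (j:ℝ) + J < m := by linarith
    have : j + J < m := by exact_mod_cast this
    omega
  -- the two neighbouring grid points
  have hjm' : j + 1 < m := by omega
  have hjmR : (j:ℝ) + 1 < m := by exact_mod_cast hjm'
  have hj0R : (0:ℝ) < j := by exact_mod_cast (by omega : 0 < j)
  obtain ⟨z0, hz0⟩ := hQ.surj (t := (j:ℝ) / m) (by positivity) (by rw [div_lt_one hm0]; linarith)
  obtain ⟨z1, hz1⟩ := hQ.surj (t := ((j + 1 : ℕ):ℝ) / m) (by positivity)
    (by rw [div_lt_one hm0]; push_cast; linarith)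
  have k0 := hY j hJj (by omega) z0 hz0
  have k1 := hY (j + 1) (by omega) hjm z1 hz1
  rw [hz0] at k0
  rw [hz1] at k1
  have hyz0 : y ≤ z0 := by
    rw [← hQ.anti.le_iff_ge, hz0, div_le_iff₀ hm0]; linarith
  have hyz1 : z1 ≤ y := by
    rw [← hQ.anti.le_iff_ge, hz1, le_div_iff₀ hm0]; push_cast; linarith
  have c0 : (Ncnt Y z0 : ℝ) ≤ Ncnt Y y := by exact_mod_cast Ncnt_anti Y hyz0
  have c1 : (Ncnt Y y : ℝ) ≤ Ncnt Y z1 := by exact_mod_cast Ncnt_anti Y hyz1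
  set h := (n:ℝ) / m with hh
  have hh0 : 0 ≤ h := by positivity
  set t0 := (j:ℝ) / m with ht0
  set t1 := ((j + 1 : ℕ):ℝ) / m with ht1
  have e01 : n * t1 = n * t0 + h := by rw [ht0, ht1, hh]; push_cast; field_simp
  have d0 : n * t0 ≤ n * g := by
    refine mul_le_mul_of_nonneg_left ?_ hn0.le
    rw [ht0, div_le_iff₀ hm0]; linarith
  have d1 : n * g ≤ n * t1 := by
    refine mul_le_mul_of_nonneg_left ?_ hn0.le
    rw [ht1, le_div_iff₀ hm0]; push_cast; linarith
  have t00 : 0 ≤ t0 := by positivity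
  have t01 : t0 ≤ 1 := by rw [ht0, div_le_one hm0]; linarith
  have t10 : 0 ≤ t1 := by positivity
  have t11 : t1 ≤ 1 := by rw [ht1, div_le_one hm0]; push_cast; linarith
  have hvg : 1 / 4 ≤ n * g * (1 - g) := by
    have h1 : (3 / 4 : ℝ) * 1 ≤ √(n * g * (1 - g)) :=
      le_trans (mul_le_mul (by linarith) hw1 (by norm_num) (by linarith)) hs2
    rw [mul_one, Real.le_sqrt' (by norm_num)] at h1
    linarith
  have s0 : √(n * t0 * (1 - t0)) ≤ √(n * g * (1 - g)) + h := by
    refine sqrt_add_le hvg hh0 ?_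
    have := (abs_le.1 ((vdiff (n := (n:ℝ)) t00 t01 hg0.le hg1.le).trans
      (show |n * t0 - n * g| ≤ h by rw [abs_le]; constructor <;> linarith))).2
    linarith
  have s1 : √(n * t1 * (1 - t1)) ≤ √(n * g * (1 - g)) + h := by
    refine sqrt_add_le hvg hh0 ?_
    have := (abs_le.1 ((vdiff (n := (n:ℝ)) t10 t11 hg0.le hg1.le).trans
      (show |n * t1 - n * g| ≤ h by rw [abs_le]; constructor <;> linarith))).2
    linarith
  have s0' := mul_le_mul_of_nonneg_left s0 hu0
  have s1' := mul_le_mul_of_nonneg_left s1 hu0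
  have k0' := (abs_le.1 k0).1
  have k1' := (abs_le.1 k1).2
  have hsu := mul_le_mul_of_nonneg_left hs1 hu0
  have huh : u' * h ≤ u' * δ := mul_le_mul_of_nonneg_left hnm hu0
  have hfin : |(Ncnt Y y : ℝ) - n * b| ≤ u' * ((1 + δ) * w) + δ * (1 + u') + δ * w := by
    rw [abs_le]
    constructor
    · linarith
    · linarith
  have hfin2 : u' * ((1 + δ) * w) + δ * (1 + u') + δ * w ≤ u * w := by
    have h1 : δ * (1 + u') ≤ δ * (1 + u') * w := le_mul_of_one_le_right (by positivity) hw1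
    have h2 := mul_le_mul_of_nonneg_right hu (show 0 ≤ w by linarith)
    linarith
  exact absurd (hfin.trans hfin2) (not_le.2 hbad)

end incl
end

open MeasureTheory Filter Topology ProbabilityTheory

noncomputable section

lemma pow_cmp {κ s t : ℝ} (hκ0 : 0 < κ) (hκ : κ < 1 / 2) (hs : Real.exp t / 2 ≤ s) :
    s ^ κ ≤ 2 * Real.exp (-((1 / 2 - κ) * t)) * √s := by
  have hE : 0 < Real.exp t / 2 := by positivity
  have hs0 : 0 < s := lt_of_lt_of_le hE hs
  have e1 : s ^ κ = s ^ (-(1 / 2 - κ)) * √s := by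
    rw [Real.sqrt_eq_rpow, ← Real.rpow_add hs0]; congr 1; ring
  rw [e1]
  refine mul_le_mul_of_nonneg_right ?_ (Real.sqrt_nonneg _)
  refine (Real.rpow_le_rpow_of_nonpos hE hs (by linarith)).trans ?_
  rw [Real.div_rpow (Real.exp_pos _).le (by norm_num), ← Real.exp_mul, div_eq_mul_inv,
    ← Real.rpow_neg (by norm_num), neg_neg, mul_comm]
  have h2 : (2:ℝ) ^ (1 / 2 - κ) ≤ 2 := by
    have := Real.rpow_le_rpow_of_exponent_le (show (1:ℝ) ≤ 2 by norm_num) (show 1 / 2 - κ ≤ 1 by linarith)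
    rwa [Real.rpow_one] at this
  have e2 : t * -(1 / 2 - κ) = -((1 / 2 - κ) * t) := by ring
  rw [e2]
  exact mul_le_mul_of_nonneg_right h2 (Real.exp_pos _).le

lemma main_dev {β σ : ℝ} (hβ : β ∈ Set.Ioo (1 / 2 : ℝ) 1) (hσ : 0 < σ) (hr : 0 < rhoNormal β σ) :
    ∃ c C : ℝ, 0 < c ∧ c ≤ 1 ∧ 1 ≤ C ∧ ∀ᶠ n : ℕ in atTop, ∀ y : ℝ,
      S0 n / 2 ≤ n * BB y → S0 n / 2 ≤ n * (1 - BB y) →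
      |n * sv (QQ β σ n) y - n * BB y| ≤ (C * Real.exp (-(c * ss n))) * √(n * BB y * (1 - BB y)) := by
  obtain ⟨κ, C, h1, h2, h3, h4⟩ := dev hβ hσ hr
  set c := min (1 / 2 - κ) (1 / 4) with hc
  have hc0 : 0 < c := lt_min (by linarith) (by norm_num)
  have hc1 : c ≤ 1 / 2 - κ := min_le_left _ _
  have hc2 : c ≤ 1 / 4 := min_le_right _ _
  refine ⟨c, 6 * C + 1, hc0, by linarith, by linarith, ?_⟩
  filter_upwards [h4, S0_le_log, eventually_ge_atTop 1, ss_tendsto.eventually_ge_atTop 0] with n h4 hS hn hss y hy1 hy2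
  have hn1 : (1:ℝ) ≤ n := by exact_mod_cast hn
  have hd : Real.exp (-(LL n / 4)) ≤ Real.exp (-(c * ss n)) := by
    refine Real.exp_le_exp.2 ?_
    have := mul_le_mul_of_nonneg_right hc2 hss
    linarith [hS.2.2]
  have hk : Real.exp (-((1 / 2 - κ) * ss n)) ≤ Real.exp (-(c * ss n)) := by
    refine Real.exp_le_exp.2 ?_
    have := mul_le_mul_of_nonneg_right hc1 hss
    linarith
  set D := Real.exp (-(c * ss n)) with hD
  have hD0 : 0 < D := Real.exp_pos _
  have hgen : ∀ s : ℝ, S0 n / 2 ≤ s → C * (s ^ κ + Real.exp (-(LL n / 4)) * √s) ≤ 3 * C * D * √s := by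
    intro s hs
    have p := pow_cmp h1 h2 (t := ss n) hs
    have hs0 := Real.sqrt_nonneg s
    have p2 := mul_le_mul_of_nonneg_right (mul_le_mul_of_nonneg_left hk (show (0:ℝ) ≤ 2 by norm_num)) hs0
    have p3 := mul_le_mul_of_nonneg_right hd hs0
    have : s ^ κ + Real.exp (-(LL n / 4)) * √s ≤ 3 * (D * √s) := by linarith
    have := mul_le_mul_of_nonneg_left this h3.le
    linarith
  have hb0 := BB_pos y
  have hb1 := BB_lt_one y
  have hw0 := Real.sqrt_nonneg (n * BB y * (1 - BB y))
  have hfin : ∀ s : ℝ, s ≤ 4 * (n * BB y * (1 - BB y)) → 3 * C * D * √s ≤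
      ((6 * C + 1) * D) * √(n * BB y * (1 - BB y)) := by
    intro s hs
    have : √s ≤ 2 * √(n * BB y * (1 - BB y)) := by
      have h := Real.sqrt_le_sqrt hs
      rw [Real.sqrt_mul (by norm_num), show (4:ℝ) = 2 ^ 2 by norm_num, Real.sqrt_sq (by norm_num)] at h
      exact h
    have h5 := mul_le_mul_of_nonneg_left this (show 0 ≤ 3 * C * D by positivity)
    have h6 := mul_nonneg hD0.le hw0
    linarith
  rcases le_total (BB y) (1 / 2) with h | h
  · refine ((h4 y).1 ?_).trans ((hgen _ hy1).trans (hfin _ ?_))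
    · nlinarith [hS.1]
    · nlinarith [mul_pos (show (0:ℝ) < n by linarith) hb0]
  · refine ((h4 y).2 ?_).trans ((hgen _ hy2).trans (hfin _ ?_))
    · nlinarith [hS.1]
    · nlinarith [mul_pos (show (0:ℝ) < n by linarith) (sub_pos.2 hb1)]

lemma delta_small (x : ℝ) {c C η : ℝ} (hc : 0 < c) (hC : 1 ≤ C) (hη : 0 < η) : ∀ᶠ n : ℕ in atTop,
    0 < aHC n ∧ (C * Real.exp (-(c * ss n))) * (2 + 2 * uu x n) ≤ η / aHC n := by
  have h1 := (uu_pow_small x 2 c hc).const_mul (8 * C)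
  rw [mul_zero] at h1
  filter_upwards [h1.eventually_lt_const hη, uu_bd x, poly_small x, LL_tendsto.eventually_ge_atTop 1] with n h1 h2 h3 h4
  have ha0 : 0 < aHC n := by
    rw [aHC]; apply Real.sqrt_pos.2
    change 0 < 2 * LL n
    linarith
  refine ⟨ha0, ?_⟩
  have ha : aHC n ≤ 2 * uu x n := by
    have : aHC n ≤ 2 * √(LL n) := by
      rw [aHC, Real.sqrt_le_left (by positivity), mul_pow, Real.sq_sqrt (by linarith)]
      change 2 * LL n ≤ _
      linarith
    linarith [h2.1]
  rw [le_div_iff₀ ha0]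
  set D := Real.exp (-(c * ss n))
  set u := uu x n
  have hD : 0 < D := Real.exp_pos _
  calc C * D * (2 + 2 * u) * aHC n ≤ C * D * (4 * u) * (2 * u) := by
        refine mul_le_mul (mul_le_mul_of_nonneg_left (by linarith [h3.1]) (by positivity)) ha ha0.le ?_
        have : 0 ≤ u := by linarith [h3.1]
        positivity
    _ = 8 * C * (u ^ 2 * D) := by ring
    _ ≤ η := h1.le

lemma grid_lim {β σ : ℝ} (hβ : β ∈ Set.Ioo (1 / 2 : ℝ) 1) (hσ : 0 < σ) (x : ℝ) :
    Tendsto (fun n : ℕ => (Measure.pi fun _ : Fin n => QQ β σ n).real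
      (gridE (QQ β σ n) n (mg n) (JJ n) (mg n - JJ n) (uu x n))) atTop (𝓝 (Real.exp (-2 * Real.exp (-x)))) := by
  have h0 : Tendsto (fun n : ℕ => (n:ℝ) ^ 2 / mg n) atTop (𝓝 0) := by
    have hz : Tendsto (fun n : ℕ => 1 / (n:ℝ) ^ 10) atTop (𝓝 0) := by
      have : Tendsto (fun n : ℕ => (n:ℝ) ^ 10) atTop atTop :=
        (tendsto_pow_atTop (by norm_num)).comp tendsto_natCast_atTop_atTop
      refine (this.inv_tendsto_atTop).congr fun n => ?_
      simp [one_div]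
    refine squeeze_zero' (Eventually.of_forall fun n => by positivity) ?_ hz
    filter_upwards [hNm_grid] with n hn
    have := (hn 2 (by norm_num)).1
    rwa [mul_one_div] at this
  have hd : Tendsto (fun n : ℕ => (Measure.pi fun _ : Fin n => QQ β σ n).real
      (gridE (QQ β σ n) n (mg n) (JJ n) (mg n - JJ n) (uu x n)) -
      (latA (alv n (mg n) (JJ n) (mg n - JJ n) (uu x n)) (mg n) n : ℝ) / ((mg n).choose n : ℝ)) atTop (𝓝 0) := by
    refine squeeze_zero_norm' ?_ h0
    filter_upwards [QQ_nice hβ hσ, grid_facts] with n hN hg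
    obtain ⟨_, _, _, _, _, _, g1, g2, g3, _⟩ := hg
    exact grid_prob hN.1 g3 g1 (by omega)
  have := hd.add (null_lim x)
  simpa using this

set_option maxHeartbeats 1000000 in
lemma sandwich {β σ : ℝ} (hβ : β ∈ Set.Ioo (1 / 2 : ℝ) 1) (hσ : 0 < σ) (hr : 0 < rhoNormal β σ) (x : ℝ) {η : ℝ}
    (hη : 0 < η) : ∀ᶠ n : ℕ in atTop,
    (Measure.pi fun _ : Fin n => QQ β σ n).real (bandE n (uu x n)) ≤
      (Measure.pi fun _ : Fin n => QQ β σ n).real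
        (gridE (QQ β σ n) n (mg n) (JJ n) (mg n - JJ n) (uu (x + η) n)) ∧
    (Measure.pi fun _ : Fin n => QQ β σ n).real
        (gridE (QQ β σ n) n (mg n) (JJ n) (mg n - JJ n) (uu (x - η) n)) ≤
      (Measure.pi fun _ : Fin n => QQ β σ n).real (bandE n (uu x n)) +
      ((Measure.pi fun _ : Fin n => QQ β σ n).real (badR n (uu x n)) +
       (Measure.pi fun _ : Fin n => QQ β σ n).real (badL n (uu x n))) := by
  obtain ⟨c, C, hc0, hc1, hC1, hdev⟩ := main_dev hβ hσ hr
  have hδ : ∀ᶠ n : ℕ in atTop, C * Real.exp (-(c * ss n)) ≤ 1 / 4 := by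
    have h1 : Tendsto (fun n => C * Real.exp (-(c * ss n))) atTop (𝓝 0) := by
      have := (Real.tendsto_exp_neg_atTop_nhds_zero.comp (ss_tendsto.const_mul_atTop hc0)).const_mul C
      simpa using this
    filter_upwards [h1.eventually_lt_const (show (0:ℝ) < 1 / 4 by norm_num)] with n h using h.le
  filter_upwards [hdev, hδ, QQ_nice hβ hσ, grid_facts, hNm_grid, S0_le_log, log_le_n,
    delta_small (x + η) hc0 hC1 hη, delta_small (x - η) hc0 hC1 hη, poly_small (x + η), poly_small (x - η),
    ss_tendsto.eventually_ge_atTop 3] with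
    n hdev hδ hN hg hNm hSl hln d1 d2 u1 u2 hss
  obtain ⟨g0, g1, g2, g3, g4, g5, g6, g7, g8, g9⟩ := hg
  have hQ := hN.1
  have hp := hQ.prob
  have hn : 0 < n := by omega
  have hn0 : (0:ℝ) < n := by exact_mod_cast hn
  have hS4 : 4 ≤ S0 n := by
    have := Real.add_one_le_exp (ss n)
    change 4 ≤ Real.exp (ss n)
    linarith
  set δ := C * Real.exp (-(c * ss n)) with hδd
  have hδ0 : 0 ≤ δ := by positivity
  have e1 : uu (x + η) n = uu x n + η / aHC n := by rw [uu, uu]; ring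
  have e2 : uu (x - η) n = uu x n - η / aHC n := by rw [uu, uu]; ring
  constructor
  · refine measureReal_mono ?_
    refine incl_upper hQ hn hS4 g2 hδ0 hδ hdev (fun j h0 h1 => ?_) (by linarith [u1.1]) ?_
    · obtain ⟨a, b, _⟩ := grid_t g0 (by linarith) g3 g7 h0 h1
      exact ⟨a, b⟩
    · have := d1.2
      have h3 : 0 ≤ δ * (1 + uu (x + η) n) := mul_nonneg hδ0 (by linarith [u1.1])
      linarith
  · have hnm : (n:ℝ) / mg n ≤ δ := by
      have h1 := (hNm 1 (by norm_num)).1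
      rw [pow_one, mul_one_div] at h1
      refine h1.trans ?_
      have hn1 : (1:ℝ) ≤ n := by exact_mod_cast hn
      have h2 : (1:ℝ) / n ^ 10 ≤ 1 / n := by
        apply one_div_le_one_div_of_le hn0
        exact le_self_pow₀ hn1 (by norm_num)
      have h3 : (1:ℝ) / n ≤ 1 / S0 n := by
        apply one_div_le_one_div_of_le (by linarith)
        linarith
      have h4 : 1 / S0 n = Real.exp (-ss n) := by rw [S0, Real.exp_neg, one_div]
      have h5 : Real.exp (-ss n) ≤ δ := by
        have : Real.exp (-ss n) ≤ Real.exp (-(c * ss n)) := Real.exp_le_exp.2 (by nlinarith)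
        rw [hδd]
        nlinarith [Real.exp_pos (-(c * ss n))]
      linarith
    have hsub := incl_lower (u := uu x n) (u' := uu (x - η) n) hQ hn hS4 hδ0 hδ hdev (by omega : 0 < mg n) g6 g7 g9 hnm
      (Nat.le_ceil _) (by linarith [u2.1]) (by
        have := d2.2
        linarith)
    refine (measureReal_mono hsub).trans ((measureReal_union_le _ _).trans ?_)
    exact add_le_add_right (measureReal_union_le _ _) _

theorem main15 (β σ0 : ℝ)
    (hβ : β ∈ Set.Ioo (1 / 2 : ℝ) 1) (hσ0 : 0 < σ0)
    (hr : 0 < rhoNormal β σ0) :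
    ∀ x : ℝ,
      Tendsto (fun n =>
          ((QprodNormal β σ0 n)
            {y | aHC n * HCnormal n y - bHC n ≤ x}).toReal)
        atTop (nhds (Real.exp (-2 * Real.exp (-x)))) := by
  intro x
  have hev : (fun n : ℕ => (Measure.pi fun _ : Fin n => QQ β σ0 n).real (bandE n (uu x n))) =ᶠ[atTop]
      (fun n => ((QprodNormal β σ0 n) {y | aHC n * HCnormal n y - bHC n ≤ x}).toReal) := by
    filter_upwards [delta_small x one_pos le_rfl one_pos, eventually_ge_atTop 1] with n h hn
    rw [HC_event hn h.1 x]
    rfl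
  refine Tendsto.congr' hev ?_
  have hF : Continuous (fun x : ℝ => Real.exp (-2 * Real.exp (-x))) := by fun_prop
  have hbad := (edge_right hβ hσ0 hr x).add (edge_left hβ hσ0 hr x)
  rw [add_zero] at hbad
  rw [tendsto_order]
  constructor
  · intro a ha
    obtain ⟨η, hη, hηa⟩ : ∃ η > 0, a < Real.exp (-2 * Real.exp (-(x - η))) := by
      have hc : Tendsto (fun η : ℝ => Real.exp (-2 * Real.exp (-(x - η)))) (𝓝[>] 0)
          (𝓝 (Real.exp (-2 * Real.exp (-(x - 0))))) := by
        apply Tendsto.mono_left _ nhdsWithin_le_nhds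
        exact Continuous.tendsto (by fun_prop) 0
      rw [sub_zero] at hc
      obtain ⟨η, h1, h2⟩ := ((hc.eventually_const_lt ha).and self_mem_nhdsWithin).exists
      exact ⟨η, h2, h1⟩
    have hlim := (grid_lim hβ hσ0 (x - η)).sub hbad
    rw [sub_zero] at hlim
    filter_upwards [hlim.eventually_const_lt hηa, sandwich hβ hσ0 hr x hη] with n h1 h2
    linarith [h2.2]
  · intro a ha
    obtain ⟨η, hη, hηa⟩ : ∃ η > 0, Real.exp (-2 * Real.exp (-(x + η))) < a := by
      have hc : Tendsto (fun η : ℝ => Real.exp (-2 * Real.exp (-(x + η)))) (𝓝[>] 0)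
          (𝓝 (Real.exp (-2 * Real.exp (-(x + 0))))) := by
        apply Tendsto.mono_left _ nhdsWithin_le_nhds
        exact Continuous.tendsto (by fun_prop) 0
      rw [add_zero] at hc
      obtain ⟨η, h1, h2⟩ := ((hc.eventually_lt_const ha).and self_mem_nhdsWithin).exists
      exact ⟨η, h2, h1⟩
    filter_upwards [(grid_lim hβ hσ0 (x + η)).eventually_lt_const hηa, sandwich hβ hσ0 hr x hη] with n h1 h2
    linarith [h2.1]

end

/-- HC has no power on the detection boundary of the heteroscedastic
normal mixture model: with `r = ρ(β,σ₀) > 0` and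
`ε_n = n^{−β}(log n)^{E(β,σ₀)}`, the HC statistic has the Gumbel-squared limit under the
alternative. -/
theorem statement15 (β σ0 : ℝ)
    (hβ : β ∈ Set.Ioo (1 / 2 : ℝ) 1) (hσ0 : 0 < σ0)
    (hr : 0 < rhoNormal β σ0) :
    ∀ x : ℝ,
      Tendsto (fun n =>
          ((QprodNormal β σ0 n)
            {y | aHC n * HCnormal n y - bHC n ≤ x}).toReal)
        atTop (nhds (Real.exp (-2 * Real.exp (-x)))) := by
  exact main15 β σ0 hβ hσ0 hr

end
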